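/- arXiv:1002.4739 — 2 statements merged into one kernel-verified Lean document; each statement's English description precedes it below -/
import Mathlib

section
/- A vector w indexed by the edges of a graph G lies in the perfect matching polytope of G if and only if: (i) w is non-negative; (ii) for every vertex v, the sum of the entries of w over edges incident with v equals one; and (iii) for every odd-cardinality set S of vertices, the sum of the entries over edges with exactly one end in S is at least one. -/
open SimpleGraph
open scoped Classical

universe u

variable {V : Type u}

/-- `M` is a perfect matching of `G`: a set of edges of `G` such that every
vertex is incident to exactly one edge of `M`. -/
def IsPM (G : SimpleGraph V) (M : Set (Sym2 V)) : Prop :=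
  M ⊆ G.edgeSet ∧ ∀ v : V, ∃! e, e ∈ M ∧ v ∈ e

/-- The edge-cut `E(A, Aᶜ)`: edges of `G` with one end in `A` and one end outside. -/
def cutEdges (G : SimpleGraph V) (A : Set V) : Set (Sym2 V) :=
  {e | e ∈ G.edgeSet ∧ ∃ x y, e = s(x, y) ∧ x ∈ A ∧ y ∉ A}

/-- The edge-cut `E(A, Aᶜ)` is cyclic: both sides induce a subgraph with a cycle. -/
def CyclicCut (G : SimpleGraph V) (A : Set V) : Prop :=
  ¬(G.induce A).IsAcyclic ∧ ¬(G.induce Aᶜ).IsAcyclic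

/-- `G` has no cyclic edge-cut of size less than `k`. -/
def CyclicallyEdgeConnected (G : SimpleGraph V) (k : ℕ) : Prop :=
  ∀ A : Set V, CyclicCut G A → k ≤ (cutEdges G A).ncard

/-- Every edge-cut of `G` has at least `k` edges. -/
def EdgeConnectedGe (G : SimpleGraph V) (k : ℕ) : Prop :=
  ∀ A : Set V, A.Nonempty → Aᶜ.Nonempty → k ≤ (cutEdges G A).ncard

/-- `G` is cubic: every vertex has degree three. -/
def CubicGraph (G : SimpleGraph V) : Prop :=
  ∀ v : V, (G.neighborSet v).ncard = 3

/-- `G` has no bridges. -/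
def Bridgeless (G : SimpleGraph V) : Prop :=
  ∀ e ∈ G.edgeSet, ¬G.IsBridge e

/-- `G` is matching-covered: connected and every edge lies in a perfect matching. -/
def MatchingCovered (G : SimpleGraph V) : Prop :=
  G.Connected ∧ ∀ e ∈ G.edgeSet, ∃ M, IsPM G M ∧ e ∈ M

/-- `M` is a matching of the subgraph of `G` induced on `A` which covers exactly the
vertices of `A \ X` (i.e. covers all vertices of `A` except those in `X`). -/
def IsNearPM (G : SimpleGraph V) (A X : Set V) (M : Set (Sym2 V)) : Prop :=
  (∀ e ∈ M, ∃ x y, e = s(x, y) ∧ G.Adj x y ∧ x ∈ A ∧ y ∈ A) ∧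
  (∀ w ∈ A \ X, ∃! e, e ∈ M ∧ w ∈ e) ∧
  (∀ w ∈ X, ∀ e ∈ M, w ∉ e)

/-- `IsTwistedNet G st c`: the subgraph of `G` induced on the vertex set `st` is a
twisted net with corner set `c`.  A 4-cycle is a twisted net whose corners are its
four vertices; and one may join a twisted net and a twisted net (multiplication), or
a twisted net and a single edge (incrementation), by two edges between corners. -/
inductive IsTwistedNet (G : SimpleGraph V) : Set V → Set V → Prop
  | cyc4 (a b c d : V) (hab : a ≠ b) (hac : a ≠ c) (had : a ≠ d)
      (hbc : b ≠ c) (hbd : b ≠ d) (hcd : c ≠ d)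
      (hadj : ∀ x ∈ ({a, b, c, d} : Set V), ∀ y ∈ ({a, b, c, d} : Set V),
        (G.Adj x y ↔ s(x, y) ∈ ({s(a, b), s(b, c), s(c, d), s(d, a)} : Set (Sym2 V)))) :
      IsTwistedNet G {a, b, c, d} {a, b, c, d}
  | incr (st c : Set V) (u u' v v' : V)
      (hprev : IsTwistedNet G st c)
      (hu : u ∈ c) (hu' : u' ∈ c) (huu' : u ≠ u')
      (hv : v ∉ st) (hv' : v' ∉ st) (hvv' : v ≠ v')
      (hvv'adj : G.Adj v v') (huv : G.Adj u v) (hu'v' : G.Adj u' v')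
      (hcross : ∀ x ∈ st, (G.Adj x v ↔ x = u) ∧ (G.Adj x v' ↔ x = u')) :
      IsTwistedNet G (st ∪ {v, v'}) ((c \ {u, u'}) ∪ {v, v'})
  | mult (st₁ c₁ st₂ c₂ : Set V) (u u' v v' : V)
      (h₁ : IsTwistedNet G st₁ c₁) (h₂ : IsTwistedNet G st₂ c₂)
      (hdisj : st₁ ∩ st₂ = ∅)
      (hu : u ∈ c₁) (hu' : u' ∈ c₁) (huu' : u ≠ u')
      (hv : v ∈ c₂) (hv' : v' ∈ c₂) (hvv' : v ≠ v')
      (huv : G.Adj u v) (hu'v' : G.Adj u' v')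
      (hcross : ∀ x ∈ st₁, ∀ y ∈ st₂,
        (G.Adj x y ↔ ((x = u ∧ y = v) ∨ (x = u' ∧ y = v')))) :
      IsTwistedNet G (st₁ ∪ st₂) ((c₁ \ {u, u'}) ∪ (c₂ \ {v, v'}))

/-- The set of (vertex sets of) semiblocks of `G`: inclusion-wise minimal sides of
2-edge-cuts. -/
def Semiblocks (G : SimpleGraph V) : Set (Set V) :=
  {A | A.Nonempty ∧ (cutEdges G A).ncard = 2 ∧
    ∀ A' ⊆ A, A'.Nonempty → (cutEdges G A').ncard = 2 → A' = A}

/-- The number of semiblocks of `G`; if `G` has no 2-edge-cut, `G` itself is its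
unique semiblock, so the number of semiblocks is `1` in this case. -/
noncomputable def numSemiblocks (G : SimpleGraph V) : ℕ :=
  max 1 (Semiblocks G).ncard

/-- The side `B` of a cyclic 4-edge-cut is solid if `G[B]` has no 2-edge-cut with at
least two vertices on each side. -/
def SolidSide (G : SimpleGraph V) (B : Set V) : Prop :=
  ¬∃ X ⊆ B, 2 ≤ X.ncard ∧ 2 ≤ (B \ X).ncard ∧
      ({e | e ∈ G.edgeSet ∧ ∃ x y, e = s(x, y) ∧ x ∈ X ∧ y ∈ B \ X}).ncard = 2

/-- The subgraph of `G` induced on `A` is a ladder (a `2 × k` grid) whose two ends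
(the edges both of whose end-vertices have degree two in the ladder) are `f₁` and `f₂`. -/
def IsLadder (G : SimpleGraph V) (A : Set V) (f₁ f₂ : Sym2 V) : Prop :=
  ∃ (k : ℕ) (x y : Fin (k + 1) → V),
    Function.Injective x ∧ Function.Injective y ∧ (∀ i j, x i ≠ y j) ∧
    A = Set.range x ∪ Set.range y ∧
    (∀ u ∈ A, ∀ v ∈ A, (G.Adj u v ↔
      ((∃ i, u = x i ∧ v = y i) ∨ (∃ i, u = y i ∧ v = x i) ∨
       (∃ i : Fin k, (u = x i.castSucc ∧ v = x i.succ) ∨ (u = x i.succ ∧ v = x i.castSucc) ∨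
         (u = y i.castSucc ∧ v = y i.succ) ∨ (u = y i.succ ∧ v = y i.castSucc))))) ∧
    f₁ = s(x 0, y 0) ∧ f₂ = s(x (Fin.last k), y (Fin.last k))

/-- The subgraph of `G` induced on `A` is a cycle of length four. -/
def Is4Cycle (G : SimpleGraph V) (A : Set V) : Prop :=
  ∃ a b c d : V, a ≠ b ∧ a ≠ c ∧ a ≠ d ∧ b ≠ c ∧ b ≠ d ∧ c ≠ d ∧
    A = {a, b, c, d} ∧
    G.Adj a b ∧ G.Adj b c ∧ G.Adj c d ∧ G.Adj d a ∧ ¬G.Adj a c ∧ ¬G.Adj b d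

/-- The graph `G_{(pq)}` obtained from `G[A]` by adding a new vertex (`Sum.inr 0`)
adjacent to `p` and `q`, a new vertex (`Sum.inr 1`) adjacent to `r` and `t`, and an
edge between the two new vertices. -/
def GExt (G : SimpleGraph V) (A : Set V) (p q r t : V) : SimpleGraph (↥A ⊕ Fin 2) :=
  SimpleGraph.fromRel (fun x y =>
    (∃ u v : A, x = Sum.inl u ∧ y = Sum.inl v ∧ G.Adj u v) ∨
    (∃ u : A, x = Sum.inr 0 ∧ y = Sum.inl u ∧ ((u : V) = p ∨ (u : V) = q)) ∨
    (∃ u : A, x = Sum.inr 1 ∧ y = Sum.inl u ∧ ((u : V) = r ∨ (u : V) = t)) ∨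
    (x = Sum.inr 0 ∧ y = Sum.inr 1))

/-- Perfect matching, as a finite edge set. -/
def IsPMF (G : SimpleGraph V) (M : Finset (Sym2 V)) : Prop :=
  (↑M : Set (Sym2 V)) ⊆ G.edgeSet ∧ ∀ v : V, ∃! e, e ∈ M ∧ v ∈ e

/-- `w` lies in the perfect matching polytope of `G`: it is a convex combination of
characteristic vectors of perfect matchings of `G`. -/
def InPMPolytope [Fintype V] [DecidableEq V] (G : SimpleGraph V) (w : Sym2 V → ℝ) : Prop :=
  ∃ μ : Finset (Sym2 V) → ℝ,
    (∀ M, 0 ≤ μ M) ∧ (∀ M, μ M ≠ 0 → IsPMF G M) ∧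
    (∑ M : Finset (Sym2 V), μ M) = 1 ∧
    ∀ e : Sym2 V, w e = ∑ M : Finset (Sym2 V), μ M * (if e ∈ M then 1 else 0)

/-- The edges of the multigraph with end map `d` that have exactly one end in `S`. -/
noncomputable def cutSet {V E : Type*} [Fintype E] (d : E → Sym2 V) (S : Finset V) : Finset E :=
  {e | ∃ x y, d e = s(x, y) ∧ x ∈ S ∧ y ∉ S}

/-- A loopless set of edges meeting the star of every vertex exactly once. -/
def IsMultiPM {V E : Type*} [Fintype E] (d : E → Sym2 V) (M : Finset E) : Prop :=
  (∀ e ∈ M, ¬(d e).IsDiag) ∧ ∀ v, (M ∩ cutSet d {v}).card = 1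

/-- The cone over Edmonds' polytope at height `r`; the weights of loops are only required to be
nonnegative. -/
structure EdmondsFeasible {V E : Type*} [Fintype E] (d : E → Sym2 V) (w : E → ℝ) (r : ℝ) :
    Prop where
  nonneg : ∀ e, 0 ≤ w e
  star : ∀ v, ∑ e ∈ cutSet d {v}, w e = r
  cut : ∀ S : Finset V, Odd S.card → r ≤ ∑ e ∈ cutSet d S, w e

/-- Off the loops, `w` is a nonnegative combination, of total mass `r`, of indicators of perfect
matchings. -/
def InMatchingCone {V E : Type*} [Fintype E] (d : E → Sym2 V) (w : E → ℝ) (r : ℝ) : Prop :=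
  ∃ μ : Finset E → ℝ, (∀ M, 0 ≤ μ M) ∧ (∀ M, μ M ≠ 0 → IsMultiPM d M) ∧ ∑ M, μ M = r ∧
    ∀ e, ¬(d e).IsDiag → w e = ∑ M, if e ∈ M then μ M else 0

section

variable {W E : Type*} [Fintype E] {d : E → Sym2 V} {w : E → ℝ} {r : ℝ}

lemma mem_cutSet_iff {S : Finset V} {e : E} :
    e ∈ cutSet d S ↔ ∃ x y, d e = s(x, y) ∧ x ∈ S ∧ y ∉ S := by
  simp [cutSet]

lemma mem_cutSet {S : Finset V} {e : E} {x y : V} (h : d e = s(x, y)) :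
    e ∈ cutSet d S ↔ (x ∈ S ∧ y ∉ S) ∨ (y ∈ S ∧ x ∉ S) := by
  rw [mem_cutSet_iff, h]
  constructor
  · rintro ⟨a, b, hab, ha, hb⟩
    rcases Sym2.eq_iff.1 hab with ⟨rfl, rfl⟩ | ⟨rfl, rfl⟩ <;> tauto
  · rintro (⟨h1, h2⟩ | ⟨h1, h2⟩)
    · exact ⟨x, y, rfl, h1, h2⟩
    · exact ⟨y, x, Sym2.eq_swap, h1, h2⟩

lemma mem_cutSet_singleton {v : V} {e : E} : e ∈ cutSet d {v} ↔ v ∈ d e ∧ ¬(d e).IsDiag := by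
  induction h : d e using Sym2.ind with
  | _ x y =>
    rw [mem_cutSet h]
    simp only [Finset.mem_singleton, Sym2.mem_iff, Sym2.mk_isDiag_iff]
    grind

lemma cutSet_compl [Fintype V] (S : Finset V) : cutSet d Sᶜ = cutSet d S := by
  ext e
  induction h : d e using Sym2.ind with
  | _ x y =>
    rw [mem_cutSet h, mem_cutSet h]
    simp only [Finset.mem_compl]
    tauto

lemma cutSet_comp [Fintype V] (f : V → W) (T : Finset W) :
    cutSet (Sym2.map f ∘ d) T = cutSet d {v | f v ∈ T} := by
  ext e
  induction h : d e using Sym2.ind with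
  | _ x y =>
    rw [mem_cutSet h, mem_cutSet (x := f x) (y := f y) (by simp [h])]
    simp

/-- Contracting odd tight sets preserves feasibility. -/
lemma EdmondsFeasible.comp [Fintype V] (hw : EdmondsFeasible d w r) (f : V → W)
    (hodd : ∀ t, Odd (Finset.card {v | f v = t}))
    (htight : ∀ t, ∑ e ∈ cutSet d {v | f v = t}, w e = r) :
    EdmondsFeasible (Sym2.map f ∘ d) w r where
  nonneg := hw.nonneg
  star t := by
    rw [cutSet_comp]
    simpa using htight t
  cut T hT := by
    rw [cutSet_comp]
    apply hw.cut
    rw [Finset.card_eq_sum_card_fiberwise (f := f) (t := T) (by intro x; simp),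
      Finset.odd_sum_iff_odd_card_odd]
    convert hT using 2
    rw [Finset.filter_true_of_mem]
    intro t ht
    convert hodd t using 2
    ext v
    simp only [Finset.mem_filter, Finset.mem_univ, true_and]
    grind

/-- The decomposition of `w` that remains of a decomposition in the graph in which the complement
of `S` has been contracted. -/
def InSideCone (d : E → Sym2 V) (S : Finset V) (w : E → ℝ) (r : ℝ) : Prop :=
  ∃ μ : Finset E → ℝ, (∀ M, 0 ≤ μ M) ∧
    (∀ M, μ M ≠ 0 → (∀ e ∈ M, ∃ x y, d e = s(x, y) ∧ x ≠ y ∧ x ∈ S) ∧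
      (M ∩ cutSet d S).card = 1 ∧ ∀ v ∈ S, (M ∩ cutSet d {v}).card = 1) ∧
    ∑ M, μ M = r ∧
    ∀ e x y, d e = s(x, y) → x ≠ y → x ∈ S → w e = ∑ M, if e ∈ M then μ M else 0

lemma inSideCone_of_contraction [Fintype V] (hw : EdmondsFeasible d w r) (S : Finset V)
    (hS : Odd Sᶜ.card) (ht : ∑ e ∈ cutSet d S, w e = r)
    (ih : ∀ d' : E → Sym2 (Option S), EdmondsFeasible d' w r → InMatchingCone d' w r) :
    InSideCone d S w r := by
  let f : V → Option S := fun v => if h : v ∈ S then some ⟨v, h⟩ else none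
  have hnone : ∀ v, f v = none ↔ v ∉ S := by intro v; simp only [f]; split_ifs <;> simp [*]
  have hsome : ∀ v (s : S), f v = some s ↔ v = s := by
    intro v s
    simp only [f]
    split_ifs with h
    · simp [Subtype.ext_iff]
    · simp only [false_iff]
      rintro rfl
      exact h s.2
  have fnone : ∀ inst : DecidablePred (fun v => f v = none),
      @Finset.filter V (fun v => f v = none) inst Finset.univ = Sᶜ := by
    intro inst; ext v; simp [hnone]
  have fsome : ∀ (s : S) (inst : DecidablePred (fun v => f v = some s)),
      @Finset.filter V (fun v => f v = some s) inst Finset.univ = {s.1} := by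
    intro s inst; ext v; simp [hsome]
  have hdiag : ∀ x y, f x = f y ↔ x = y ∨ (x ∉ S ∧ y ∉ S) := by
    intro x y
    by_cases hx : x ∈ S
    · have h1 : f x = some ⟨x, hx⟩ := (hsome _ _).2 rfl
      rw [h1, eq_comm, hsome]
      simp only
      tauto
    · have h1 : f x = none := (hnone _).2 hx
      rw [h1, eq_comm, hnone]
      constructor
      · tauto
      · rintro (rfl | h) <;> tauto
  have hfeas : EdmondsFeasible (Sym2.map f ∘ d) w r := by
    apply hw.comp
    · rintro (_ | s)
      · rwa [fnone]
      · rw [fsome]; simp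
    · rintro (_ | s)
      · rwa [fnone, cutSet_compl]
      · rw [fsome]; exact hw.star s
  obtain ⟨μ, h0, hPM, hsum, hμ⟩ := ih _ hfeas
  refine ⟨μ, h0, ?_, hsum, ?_⟩
  · intro M hM
    obtain ⟨h1, h2⟩ := hPM M hM
    refine ⟨?_, ?_, ?_⟩
    · intro e he
      have := h1 e he
      induction h : d e using Sym2.ind with
      | _ x y =>
        simp only [Function.comp, h, Sym2.map_mk, Sym2.mk_isDiag_iff, hdiag] at this
        by_cases hx : x ∈ S
        · exact ⟨x, y, rfl, by tauto, hx⟩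
        · exact ⟨y, x, Sym2.eq_swap, by grind, by tauto⟩
    · have := h2 none
      rw [cutSet_comp] at this
      simpa [fnone, cutSet_compl] using this
    · intro v hv
      have := h2 (some ⟨v, hv⟩)
      rw [cutSet_comp] at this
      simpa [fsome] using this
  · intro e x y h hxy hx
    apply hμ
    simp only [Function.comp, h, Sym2.map_mk, Sym2.mk_isDiag_iff, hdiag]
    tauto

/-- Couple two families of edge sets along their common edge in `C`. -/
noncomputable def glueWeight {ι : Type*} (C : Finset ι) (w : ι → ℝ) (μ₁ μ₂ : Finset ι → ℝ)
    (M N : Finset ι) : ℝ :=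
  ∑ e ∈ C, if e ∈ M ∧ e ∈ N then μ₁ M * μ₂ N / w e else 0

lemma glueWeight_comm {ι : Type*} (C : Finset ι) (w : ι → ℝ) (μ₁ μ₂ : Finset ι → ℝ)
    (M N : Finset ι) :
    glueWeight C w μ₁ μ₂ M N = glueWeight C w μ₂ μ₁ N M := by
  simp only [glueWeight, and_comm, mul_comm]

lemma sum_glueWeight {C : Finset E} {μ₁ μ₂ : Finset E → ℝ} (h0 : ∀ M, 0 ≤ μ₁ M)
    (h1 : ∀ M, μ₁ M ≠ 0 → (M ∩ C).card = 1)
    (hw₁ : ∀ e ∈ C, w e = ∑ M, if e ∈ M then μ₁ M else 0)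
    (hw₂ : ∀ e ∈ C, w e = ∑ M, if e ∈ M then μ₂ M else 0) (M : Finset E) :
    ∑ N, glueWeight C w μ₁ μ₂ M N = μ₁ M := by
  by_cases hM : μ₁ M = 0
  · simp [glueWeight, hM]
  have key : ∀ e ∈ C, (∑ N : Finset E, if e ∈ M ∧ e ∈ N then μ₁ M * μ₂ N / w e else 0) =
      if e ∈ M then μ₁ M else 0 := by
    intro e he
    by_cases heM : e ∈ M
    · have hpos : 0 < w e := by
        rw [hw₁ e he]
        refine Finset.sum_pos' (fun N _ => ?_) ⟨M, Finset.mem_univ _, ?_⟩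
        · split_ifs <;> simp [h0]
        · simpa [heM] using lt_of_le_of_ne (h0 M) (Ne.symm hM)
      simp only [heM, true_and, if_true]
      calc (∑ N : Finset E, if e ∈ N then μ₁ M * μ₂ N / w e else 0)
          = ∑ N : Finset E, μ₁ M / w e * (if e ∈ N then μ₂ N else 0) := by
            refine Finset.sum_congr rfl fun N _ => ?_
            split_ifs <;> ring
        _ = μ₁ M := by
            rw [← Finset.mul_sum, ← hw₂ e he]
            field_simp
    · simp [heM]
  simp only [glueWeight]
  rw [Finset.sum_comm, Finset.sum_congr rfl key, Finset.sum_ite_mem, Finset.sum_const,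
    Finset.inter_comm, h1 M hM, one_smul]

lemma inMatchingCone_of_fintype {ι : Type*} [Fintype ι] (ν : ι → ℝ) (N : ι → Finset E)
    (h0 : ∀ i, 0 ≤ ν i) (hPM : ∀ i, ν i ≠ 0 → IsMultiPM d (N i)) (hsum : ∑ i, ν i = r)
    (hw : ∀ e, ¬(d e).IsDiag → w e = ∑ i, if e ∈ N i then ν i else 0) :
    InMatchingCone d w r := by
  refine ⟨fun M => ∑ i, if N i = M then ν i else 0, ?_, ?_, ?_, ?_⟩
  · intro M
    refine Finset.sum_nonneg fun i _ => ?_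
    split_ifs <;> simp [h0]
  · intro M hM
    obtain ⟨i, -, hi⟩ := Finset.exists_ne_zero_of_sum_ne_zero hM
    grind
  · rw [Finset.sum_comm]
    simpa using hsum
  · intro e he
    have : ∀ M : Finset E, (if e ∈ M then ∑ i, (if N i = M then ν i else 0) else 0) =
        ∑ i, if N i = M then (if e ∈ N i then ν i else 0) else 0 := by
      intro M
      split_ifs with h
      · exact Finset.sum_congr rfl fun i _ => by grind
      · exact (Finset.sum_eq_zero fun i _ => by grind).symm
    rw [hw e he, Finset.sum_congr rfl fun M _ => this M, Finset.sum_comm]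
    simp

lemma inMatchingCone_of_inSideCone [Fintype V] (S : Finset V) (hw0 : ∀ e, 0 ≤ w e)
    (hS : InSideCone d S w r) (hSc : InSideCone d Sᶜ w r) : InMatchingCone d w r := by
  obtain ⟨μ₁, h0₁, hPM₁, hsum₁, hw₁⟩ := hS
  obtain ⟨μ₂, h0₂, hPM₂, -, hw₂⟩ := hSc
  simp only [cutSet_compl] at hPM₂
  set C := cutSet d S with hC
  have hC₁ : ∀ e ∈ C, w e = ∑ M, if e ∈ M then μ₁ M else 0 := by
    intro e he
    obtain ⟨x, y, h, hx, hy⟩ := mem_cutSet_iff.1 he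
    exact hw₁ e x y h (by grind) hx
  have hC₂ : ∀ e ∈ C, w e = ∑ M, if e ∈ M then μ₂ M else 0 := by
    intro e he
    obtain ⟨x, y, h, hx, hy⟩ := mem_cutSet_iff.1 he
    exact hw₂ e y x (h.trans Sym2.eq_swap) (by grind) (by simpa using hy)
  let ν : Finset E × Finset E → ℝ := fun p => glueWeight C w μ₁ μ₂ p.1 p.2
  have hm₁ : ∀ M, ∑ N, ν (M, N) = μ₁ M :=
    sum_glueWeight h0₁ (fun M hM => (hPM₁ M hM).2.1) hC₁ hC₂
  have hm₂ : ∀ N, ∑ M, ν (M, N) = μ₂ N := fun N => by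
    simp only [ν, glueWeight_comm C w μ₁ μ₂]
    exact sum_glueWeight h0₂ (fun M hM => (hPM₂ M hM).2.1) hC₂ hC₁ N
  have hν : ∀ p, ν p ≠ 0 → μ₁ p.1 ≠ 0 ∧ μ₂ p.2 ≠ 0 ∧ ∃ e ∈ C, e ∈ p.1 ∧ e ∈ p.2 := by
    intro p hp
    obtain ⟨e, he, h⟩ := Finset.exists_ne_zero_of_sum_ne_zero hp
    split_ifs at h with h'
    · refine ⟨?_, ?_, e, he, h'⟩ <;> (intro h0; simp [h0] at h)
    · exact absurd rfl h
  have hcross : ∀ p, ν p ≠ 0 → ∀ e ∈ C, e ∈ p.1 ↔ e ∈ p.2 := by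
    intro p hp e he
    obtain ⟨h1, h2, e₀, he₀, h3, h4⟩ := hν p hp
    obtain ⟨a, ha⟩ := Finset.card_eq_one.1 (hPM₁ _ h1).2.1
    obtain ⟨b, hb⟩ := Finset.card_eq_one.1 (hPM₂ _ h2).2.1
    simp only [Finset.ext_iff, Finset.mem_inter, Finset.mem_singleton] at ha hb
    grind
  have hout₁ : ∀ p, ν p ≠ 0 → ∀ e x y, d e = s(x, y) → x ∉ S → e ∈ p.1 → e ∈ p.2 := by
    intro p hp e x y h hx he
    obtain ⟨a, b, h', hab, ha⟩ := (hPM₁ _ (hν p hp).1).1 e he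
    refine (hcross p hp e ?_).1 he
    rw [hC, mem_cutSet h]
    rcases Sym2.eq_iff.1 (h.symm.trans h') with ⟨rfl, rfl⟩ | ⟨rfl, rfl⟩ <;> tauto
  have hout₂ : ∀ p, ν p ≠ 0 → ∀ e x y, d e = s(x, y) → x ∈ S → e ∈ p.2 → e ∈ p.1 := by
    intro p hp e x y h hx he
    obtain ⟨a, b, h', hab, ha⟩ := (hPM₂ _ (hν p hp).2.1).1 e he
    rw [Finset.mem_compl] at ha
    refine (hcross p hp e ?_).2 he
    rw [hC, mem_cutSet h]
    rcases Sym2.eq_iff.1 (h.symm.trans h') with ⟨rfl, rfl⟩ | ⟨rfl, rfl⟩ <;> tauto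
  refine inMatchingCone_of_fintype ν (fun p => p.1 ∪ p.2) ?_ ?_ ?_ ?_
  · intro p
    refine Finset.sum_nonneg fun e _ => ?_
    split_ifs
    · exact div_nonneg (mul_nonneg (h0₁ _) (h0₂ _)) (hw0 e)
    · rfl
  · intro p hp
    obtain ⟨h1, h2, -⟩ := hν p hp
    refine ⟨?_, ?_⟩
    · intro e he
      rcases Finset.mem_union.1 he with he | he
      · obtain ⟨x, y, h, hxy, -⟩ := (hPM₁ _ h1).1 e he
        simpa [h] using hxy
      · obtain ⟨x, y, h, hxy, -⟩ := (hPM₂ _ h2).1 e he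
        simpa [h] using hxy
    · intro v
      by_cases hv : v ∈ S
      · rw [← (hPM₁ _ h1).2.2 v hv]
        congr 1
        ext e
        simp only [Finset.mem_inter, Finset.mem_union]
        refine ⟨fun ⟨h, h'⟩ => ⟨h.elim id fun h => ?_, h'⟩, fun ⟨h, h'⟩ => ⟨Or.inl h, h'⟩⟩
        obtain ⟨y, hy⟩ := Sym2.mem_iff_exists.1 (mem_cutSet_singleton.1 h').1
        exact hout₂ p hp e v y hy hv h
      · rw [← (hPM₂ _ h2).2.2 v (by simpa using hv)]
        congr 1
        ext e
        simp only [Finset.mem_inter, Finset.mem_union]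
        refine ⟨fun ⟨h, h'⟩ => ⟨h.elim (fun h => ?_) id, h'⟩, fun ⟨h, h'⟩ => ⟨Or.inr h, h'⟩⟩
        obtain ⟨y, hy⟩ := Sym2.mem_iff_exists.1 (mem_cutSet_singleton.1 h').1
        exact hout₁ p hp e v y hy hv h
  · rw [Fintype.sum_prod_type]
    simp only [hm₁, hsum₁]
  · intro e he
    induction h : d e using Sym2.ind with
    | _ x y =>
      rw [h, Sym2.mk_isDiag_iff] at he
      by_cases hx : x ∈ S
      · rw [hw₁ e x y h he hx, Fintype.sum_prod_type]
        refine Finset.sum_congr rfl fun M _ => ?_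
        split_ifs with heM
        · rw [← hm₁ M]
          exact Finset.sum_congr rfl fun N _ => by simp [heM]
        · refine (Finset.sum_eq_zero fun N _ => ?_).symm
          have := hout₂ (M, N)
          grind
      · rw [hw₂ e x y h he (by simpa using hx), Fintype.sum_prod_type_right]
        refine Finset.sum_congr rfl fun N _ => ?_
        split_ifs with heN
        · rw [← hm₂ N]
          exact Finset.sum_congr rfl fun M _ => by simp [heN]
        · refine (Finset.sum_eq_zero fun M _ => ?_).symm
          have := hout₁ (M, N)
          grind

/-- If the weights are feasible at positive height, the positive edges contain a perfect matching. -/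
lemma EdmondsFeasible.exists_isMultiPM [Fintype V] (hw : EdmondsFeasible d w r) (hr : 0 < r) :
    ∃ M, IsMultiPM d M ∧ ∀ e ∈ M, 0 < w e := by
  let H : SimpleGraph V :=
    { Adj := fun x y => x ≠ y ∧ ∃ e, d e = s(x, y) ∧ 0 < w e
      symm := ⟨fun x y ⟨h, e, he, h'⟩ => ⟨h.symm, e, he.trans Sym2.eq_swap, h'⟩⟩
      loopless := ⟨fun x h => h.1 rfl⟩ }
  have hT : ∀ u, ¬H.IsTutteViolator u := by
    intro u hu
    unfold SimpleGraph.IsTutteViolator at hu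
    set K := ((⊤ : H.Subgraph).deleteVerts u).coe with hK
    have hmem : ∀ v, v ∈ ((⊤ : H.Subgraph).deleteVerts u).verts ↔ v ∉ u := by simp
    let _ : Fintype K.ConnectedComponent := Fintype.ofFinite _
    let S : K.ConnectedComponent → Finset V := fun c => {v | ∃ h : v ∉ u, ⟨v, (hmem v).2 h⟩ ∈ c.supp}
    have hS : ∀ c v, v ∈ S c ↔ ∃ h : v ∉ u, K.connectedComponentMk ⟨v, (hmem v).2 h⟩ = c := by
      intro c v; simp [S]
    have hScard : ∀ c, (S c).card = c.supp.ncard := by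
      intro c
      rw [← Set.ncard_image_of_injective _ Subtype.val_injective, ← Set.ncard_coe_finset]
      congr 1
      ext v
      simp [hS]
    have hO : K.oddComponents.ncard = K.oddComponents.toFinset.card :=
      Set.ncard_eq_toFinset_card' _
    have hU : u.ncard = u.toFinset.card := Set.ncard_eq_toFinset_card' _
    have key : ∀ e, (∑ c ∈ K.oddComponents.toFinset, if e ∈ cutSet d (S c) then w e else 0) ≤
        ∑ v ∈ u.toFinset, if e ∈ cutSet d {v} then w e else 0 := by
      intro e
      have hnn : ∀ v ∈ u.toFinset, 0 ≤ if e ∈ cutSet d {v} then w e else 0 := by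
        intro v _
        split_ifs
        · exact hw.nonneg e
        · rfl
      by_cases hex : ∃ c, e ∈ cutSet d (S c)
      swap
      · push Not at hex
        simpa [hex] using Finset.sum_nonneg hnn
      obtain ⟨c, hc⟩ := hex
      rcases (hw.nonneg e).eq_or_lt with h0 | hpos
      · simp [← h0]
      obtain ⟨x, y, hxy, hx, hy⟩ := mem_cutSet_iff.1 hc
      obtain ⟨hxu, hxc⟩ := (hS _ _).1 hx
      have hne : x ≠ y := by rintro rfl; exact hy hx
      have hyu : y ∈ u := by
        by_contra hyu
        refine hy ((hS _ _).2 ⟨hyu, ?_⟩)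
        rw [← hxc, SimpleGraph.ConnectedComponent.eq]
        refine SimpleGraph.Adj.reachable ?_
        have : H.Adj y x := ⟨hne.symm, e, hxy.trans Sym2.eq_swap, hpos⟩
        simp [hK, hxu, hyu, this]
      have huniq : ∀ c', e ∈ cutSet d (S c') → c' = c := by
        intro c' hc'
        rw [mem_cutSet hxy, hS, hS] at hc'
        rcases hc' with ⟨⟨_, h⟩, _⟩ | ⟨⟨h, _⟩, _⟩
        · exact h.symm.trans hxc
        · exact absurd hyu h
      calc (∑ c ∈ K.oddComponents.toFinset, if e ∈ cutSet d (S c) then w e else 0)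
          ≤ ∑ c', if e ∈ cutSet d (S c') then w e else 0 := by
            refine Finset.sum_le_sum_of_subset_of_nonneg (Finset.subset_univ _) fun c' _ _ => ?_
            split_ifs
            · exact hpos.le
            · rfl
        _ = w e := by
            rw [Fintype.sum_eq_single c fun c' hc' => if_neg fun h => hc' (huniq c' h), if_pos hc]
        _ = if e ∈ cutSet d {y} then w e else 0 := by
            rw [if_pos ((mem_cutSet hxy).2 (Or.inr (by simp [hne])))]
        _ ≤ _ := Finset.single_le_sum hnn (by simpa using hyu)
    have h1 : (K.oddComponents.toFinset.card : ℝ) * r ≤ u.toFinset.card * r := by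
      calc (K.oddComponents.toFinset.card : ℝ) * r = ∑ c ∈ K.oddComponents.toFinset, r := by simp
        _ ≤ ∑ c ∈ K.oddComponents.toFinset, ∑ e, if e ∈ cutSet d (S c) then w e else 0 := by
          refine Finset.sum_le_sum fun c hc => ?_
          simpa using hw.cut (S c) (by rw [hScard]; simpa using hc)
        _ ≤ ∑ e, ∑ v ∈ u.toFinset, if e ∈ cutSet d {v} then w e else 0 := by
          rw [Finset.sum_comm]
          exact Finset.sum_le_sum fun e _ => key e
        _ = u.toFinset.card * r := by
          rw [Finset.sum_comm]
          simp [hw.star]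
    have h2 : (K.oddComponents.toFinset.card : ℝ) ≤ u.toFinset.card := le_of_mul_le_mul_right h1 hr
    rw [hO, hU] at hu
    exact absurd (by exact_mod_cast h2) (not_le.2 hu)
  obtain ⟨P, hP⟩ := SimpleGraph.tutte.2 hT
  rw [SimpleGraph.Subgraph.isPerfectMatching_iff] at hP
  have hedge : ∀ p : P.edgeSet, ∃ e, d e = p ∧ 0 < w e := by
    rintro ⟨p, hp⟩
    induction p using Sym2.ind with
    | _ x y => exact (P.adj_sub hp).2
  choose g hg hgpos using hedge
  refine ⟨({e | ∃ p, g p = e} : Finset E), ⟨?_, ?_⟩, ?_⟩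
  · intro e he
    obtain ⟨p, rfl⟩ := (Finset.mem_filter.1 he).2
    rw [hg]
    exact H.not_isDiag_of_mem_edgeSet (P.edgeSet_subset p.2)
  · intro v
    obtain ⟨x, hx, hux⟩ := hP v
    rw [Finset.card_eq_one]
    refine ⟨g ⟨s(v, x), hx⟩, ?_⟩
    ext e
    simp only [Finset.mem_inter, Finset.mem_filter, Finset.mem_univ, true_and,
      Finset.mem_singleton]
    constructor
    · rintro ⟨⟨⟨p, hp⟩, rfl⟩, h⟩
      have hv := (mem_cutSet_singleton.1 h).1
      rw [hg] at hv
      obtain ⟨y, rfl⟩ := Sym2.mem_iff_exists.1 hv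
      have := hux y hp
      subst this
      rfl
    · rintro rfl
      refine ⟨⟨_, rfl⟩, mem_cutSet_singleton.2 ?_⟩
      rw [hg]
      exact ⟨by simp, H.not_isDiag_of_mem_edgeSet (P.edgeSet_subset hx)⟩
  · intro e he
    obtain ⟨p, rfl⟩ := (Finset.mem_filter.1 he).2
    exact hgpos p

/-- The first time at which one of finitely many linearly decreasing slacks vanishes. -/
lemma exists_max_step {ι : Type*} [Fintype ι] (a b : ι → ℝ) (ha : ∀ i, 0 ≤ a i)
    (hab : ∀ i, 0 < b i → 0 < a i) (hb : ∃ i, 0 < b i) :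
    ∃ ε, 0 < ε ∧ (∀ i, ε * b i ≤ a i) ∧ ∃ i, 0 < b i ∧ a i = ε * b i := by
  obtain ⟨i, hi, hmin⟩ := Finset.exists_min_image ({i | 0 < b i} : Finset ι) (fun i => a i / b i)
    (by obtain ⟨i, hi⟩ := hb; exact ⟨i, by simpa using hi⟩)
  simp only [Finset.mem_filter, Finset.mem_univ, true_and] at hi hmin
  have hε : 0 < a i / b i := div_pos (hab i hi) hi
  refine ⟨a i / b i, hε, fun j => ?_, i, hi, by field_simp⟩
  rcases lt_or_ge 0 (b j) with hj | hj
  · exact (le_div_iff₀ hj).1 (hmin j hj)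
  · exact (mul_nonpos_of_nonneg_of_nonpos hε.le hj).trans (ha j)

lemma EdmondsFeasible.inMatchingCone_zero (hw : EdmondsFeasible d w 0) :
    InMatchingCone d w 0 := by
  refine ⟨0, by simp, by simp, by simp, fun e he => ?_⟩
  induction h : d e using Sym2.ind with
  | _ x y =>
    have := (Finset.sum_eq_zero_iff_of_nonneg fun e _ => hw.nonneg e).1 (hw.star x) e
      (mem_cutSet_singleton.2 ⟨by simp [h], he⟩)
    simpa using this

lemma EdmondsFeasible.even_card [Fintype V] (hw : EdmondsFeasible d w r) (hr : 0 < r) :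
    Even (Fintype.card V) := by
  by_contra hodd
  have h := hw.cut Finset.univ (by simpa using hodd)
  have : cutSet d (Finset.univ : Finset V) = ∅ := by
    ext e
    simp [mem_cutSet_iff]
  rw [this, Finset.sum_empty] at h
  linarith

lemma EdmondsFeasible.odd_card_compl [Fintype V] (hw : EdmondsFeasible d w r) (hr : 0 < r)
    {S : Finset V} (hS : Odd S.card) : Odd Sᶜ.card := by
  have h1 := Finset.card_add_card_compl S
  have h2 := hw.even_card hr
  grind

lemma InMatchingCone.of_sub {M : Finset E} (hM : IsMultiPM d M) {ε : ℝ} (hε : 0 < ε)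
    (h : InMatchingCone d (fun e => w e - ε * if e ∈ M then 1 else 0) (r - ε)) :
    InMatchingCone d w r := by
  obtain ⟨μ, h0, hPM, hsum, hμ⟩ := h
  refine inMatchingCone_of_fintype (ι := Option (Finset E)) (fun i => i.elim ε μ)
    (fun i => i.elim M id) ?_ ?_ ?_ ?_
  · rintro (_ | N)
    · exact hε.le
    · exact h0 N
  · rintro (_ | N) hN
    · exact hM
    · exact hPM N hN
  · rw [Fintype.sum_option]
    simp [hsum]
  · intro e he
    rw [Fintype.sum_option]
    change w e = (if e ∈ M then ε else 0) + ∑ N, if e ∈ N then μ N else 0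
    rw [← hμ e he]
    by_cases heM : e ∈ M <;> simp [heM]

lemma sum_sub_indicator {ι : Type*} (w : ι → ℝ) (C M : Finset ι) (ε : ℝ) :
    ∑ e ∈ C, (w e - ε * if e ∈ M then 1 else 0) = ∑ e ∈ C, w e - ε * (M ∩ C).card := by
  rw [Finset.sum_sub_distrib, ← Finset.mul_sum, Finset.sum_boole, Finset.filter_mem_eq_inter,
    Finset.inter_comm]

/-- A tight odd cut with at least two vertices on each side reduces the decomposition problem to
the two contractions. -/
lemma EdmondsFeasible.inMatchingCone_of_tight [Fintype V] (hw : EdmondsFeasible d w r) (hr : 0 < r)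
    (ih : ∀ (W : Type u) [Fintype W], Fintype.card W < Fintype.card V →
      ∀ (d' : E → Sym2 W) (w' : E → ℝ) (r' : ℝ), EdmondsFeasible d' w' r' → 0 ≤ r' →
        InMatchingCone d' w' r')
    {S : Finset V} (hS : Odd S.card) (h1 : S.card ≠ 1) (h2 : Sᶜ.card ≠ 1)
    (ht : ∑ e ∈ cutSet d S, w e = r) : InMatchingCone d w r := by
  have hSc := hw.odd_card_compl hr hS
  have hcard := Finset.card_add_card_compl S
  have hlt1 := hS.pos
  have hlt2 := hSc.pos
  refine inMatchingCone_of_inSideCone S hw.nonneg ?_ ?_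
  · refine inSideCone_of_contraction hw S hSc ht fun d' hd' => ih _ ?_ d' w r hd' hr.le
    simp only [Fintype.card_option, Fintype.card_coe]
    lia
  · refine inSideCone_of_contraction hw Sᶜ (by rwa [compl_compl]) (by rwa [cutSet_compl])
      fun d' hd' => ih _ ?_ d' w r hd' hr.le
    simp only [Fintype.card_option, Fintype.card_coe]
    lia

end

/-- Edmonds' theorem for multigraphs, in conic form. -/
theorem EdmondsFeasible.inMatchingCone {E : Type*} [Fintype E] [Fintype V] {d : E → Sym2 V}
    {w : E → ℝ} {r : ℝ} (hw : EdmondsFeasible d w r) (hr : 0 ≤ r) : InMatchingCone d w r := by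
  induction hn : Fintype.card V using Nat.strong_induction_on generalizing V w r with
  | _ n ihV =>
  induction hm : (Finset.card {e | w e ≠ 0}) using Nat.strong_induction_on generalizing w r with
  | _ m ihE =>
  subst hn hm
  rcases hr.eq_or_lt with rfl | hr
  · exact hw.inMatchingCone_zero
  by_cases hex : ∃ S : Finset V, Odd S.card ∧ S.card ≠ 1 ∧ Sᶜ.card ≠ 1 ∧ ∑ e ∈ cutSet d S, w e = r
  · obtain ⟨S, hS, h1, h2, ht⟩ := hex
    exact hw.inMatchingCone_of_tight hr
      (fun W _ hW d' w' r' hw' hr' => ihV _ hW hw' hr' rfl) hS h1 h2 ht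
  push Not at hex
  obtain ⟨M, hM, hMpos⟩ := hw.exists_isMultiPM hr
  have hsmall : ∀ S : Finset V, Odd S.card → 1 < (M ∩ cutSet d S).card →
      S.card ≠ 1 ∧ Sᶜ.card ≠ 1 := by
    refine fun S hS h => ⟨fun h1 => ?_, fun h1 => ?_⟩
    · obtain ⟨v, rfl⟩ := Finset.card_eq_one.1 h1
      exact h.ne' (hM.2 v)
    · obtain ⟨v, hv⟩ := Finset.card_eq_one.1 h1
      rw [← cutSet_compl, hv] at h
      exact h.ne' (hM.2 v)
  let a : Option (E ⊕ {S : Finset V // Odd S.card}) → ℝ := fun i =>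
    i.elim r (Sum.elim w fun S => ∑ e ∈ cutSet d S.1, w e - r)
  let b : Option (E ⊕ {S : Finset V // Odd S.card}) → ℝ := fun i =>
    i.elim 1 (Sum.elim (fun e => if e ∈ M then 1 else 0) fun S => (M ∩ cutSet d S.1).card - 1)
  have hcast : ∀ S, 0 < b (some (Sum.inr S)) → 1 < (M ∩ cutSet d S.1).card := by
    intro S h
    exact_mod_cast sub_pos.1 h
  obtain ⟨ε, hε, hle, i, hbi, hai⟩ := exists_max_step a b
    (by
      rintro (_ | e | S)
      · exact hr.le
      · exact hw.nonneg e
      · exact sub_nonneg.2 (hw.cut S.1 S.2))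
    (by
      rintro (_ | e | S) h
      · exact hr
      · refine hMpos e ?_
        by_contra he
        simp [b, he] at h
      · obtain ⟨h1, h2⟩ := hsmall S.1 S.2 (hcast S h)
        exact sub_pos.2 (lt_of_le_of_ne (hw.cut S.1 S.2) (hex S.1 S.2 h1 h2).symm))
    ⟨none, one_pos⟩
  have hr' : 0 ≤ r - ε := by
    have := hle none
    simp only [a, b, Option.elim] at this
    linarith
  refine InMatchingCone.of_sub hM hε ?_
  have hw' : EdmondsFeasible d (fun e => w e - ε * if e ∈ M then 1 else 0) (r - ε) := by
    refine ⟨fun e => sub_nonneg.2 (hle (some (Sum.inl e))), fun v => ?_, fun S hS => ?_⟩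
    · rw [sum_sub_indicator, hw.star, hM.2]
      simp
    · have := hle (some (Sum.inr ⟨S, hS⟩))
      simp only [a, b, Option.elim, Sum.elim_inr] at this
      rw [sum_sub_indicator]
      linarith
  rcases i with _ | e | S
  · have : r - ε = 0 := by
      simp only [a, b, Option.elim] at hai
      linarith
    rw [this] at hw' ⊢
    exact hw'.inMatchingCone_zero
  · refine ihE _ ?_ hw' hr' rfl
    have heM : e ∈ M := by
      by_contra he
      simp [b, he] at hbi
    refine Finset.card_lt_card (Finset.ssubset_iff_of_subset ?_ |>.2 ⟨e, ?_, ?_⟩)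
    · intro f
      simp only [Finset.mem_filter, Finset.mem_univ, true_and]
      intro hf h0
      have : f ∉ M := fun hfM => (hMpos f hfM).ne' h0
      simp [h0, this] at hf
    · simpa using (hMpos e heM).ne'
    · simp only [a, b, Option.elim, Sum.elim_inl] at hai
      simp [heM] at hai ⊢
      linarith
  · rcases hr'.eq_or_lt with h0 | hpos
    · rw [← h0] at hw' ⊢
      exact hw'.inMatchingCone_zero
    obtain ⟨h1, h2⟩ := hsmall S.1 S.2 (hcast S hbi)
    refine hw'.inMatchingCone_of_tight hpos
      (fun W _ hW d' w' r' hw' hr' => ihV _ hW hw' hr' rfl) S.2 h1 h2 ?_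
    simp only [a, b, Option.elim, Sum.elim_inr] at hai
    rw [sum_sub_indicator]
    linarith

lemma sum_edgeFinset_ite (G : SimpleGraph V) [Fintype V] [Fintype G.edgeSet] {w : Sym2 V → ℝ}
    (hsupp : ∀ e ∉ G.edgeSet, w e = 0) (p : Sym2 V → Prop)
    [DecidablePred p] (C : Finset (Sym2 V))
    (hp : ∀ e ∈ G.edgeSet, p e ↔ e ∈ C) :
    (∑ e ∈ G.edgeFinset, if p e then w e else 0) = ∑ e ∈ C, w e := by
  rw [← Finset.sum_filter]
  refine Finset.sum_subset (fun e => ?_) fun e he h => hsupp e fun hG => h ?_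
  · simp only [Finset.mem_filter, SimpleGraph.mem_edgeFinset]
    exact fun ⟨h, h'⟩ => (hp e h).1 h'
  · simpa [hG] using (hp e hG).2 he

/-- A perfect matching meets every odd cut. -/
lemma IsMultiPM.inter_cutSet_nonempty {E : Type*} [Fintype E] {d : E → Sym2 V} {M : Finset E}
    (hM : IsMultiPM d M) {S : Finset V} (hS : Odd S.card) : (M ∩ cutSet d S).Nonempty := by
  by_contra hempty
  rw [Finset.not_nonempty_iff_eq_empty] at hempty
  have hcard : ∑ e ∈ M, (Finset.card {v ∈ S | e ∈ cutSet d {v}}) = S.card := by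
    simp only [Finset.card_filter]
    rw [Finset.sum_comm]
    simp only [← Finset.card_filter, Finset.filter_mem_eq_inter, hM.2]
    simp
  rw [← hcard] at hS
  refine Nat.not_even_iff_odd.2 hS (Finset.even_sum _ fun e he => ?_)
  induction h : d e using Sym2.ind with
  | _ x y =>
    have hne : x ≠ y := by simpa [h] using hM.1 e he
    have hcut : e ∉ cutSet d S := fun hc => by
      have : e ∈ M ∩ cutSet d S := Finset.mem_inter.2 ⟨he, hc⟩
      simp [hempty] at this
    rw [mem_cutSet h] at hcut
    by_cases hx : x ∈ S
    · have : ({v ∈ S | e ∈ cutSet d {v}} : Finset V) = {x, y} := by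
        ext v
        simp only [Finset.mem_filter, mem_cutSet h, Finset.mem_singleton, Finset.mem_insert]
        grind
      rw [this, Finset.card_pair hne]
      exact even_two
    · have : ({v ∈ S | e ∈ cutSet d {v}} : Finset V) = ∅ := by
        ext v
        simp only [Finset.mem_filter, mem_cutSet h, Finset.mem_singleton, Finset.notMem_empty]
        grind
      simp [this]

lemma isPMF_iff [Fintype V] (G : SimpleGraph V) (M : Finset (Sym2 V)) :
    IsPMF G M ↔ (M : Set (Sym2 V)) ⊆ G.edgeSet ∧ IsMultiPM id M := by
  refine and_congr_right fun hMG => ?_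
  have hloop : ∀ e ∈ M, ¬(id e).IsDiag := fun e he => G.not_isDiag_of_mem_edgeSet (hMG he)
  rw [IsMultiPM, and_iff_right hloop]
  refine forall_congr' fun v => ?_
  simp only [Finset.card_eq_one, Finset.eq_singleton_iff_unique_mem, Finset.mem_inter,
    mem_cutSet_singleton, ExistsUnique]
  refine exists_congr fun e => ⟨fun ⟨⟨h1, h2⟩, h3⟩ => ⟨⟨h1, h2, hloop e h1⟩, fun f hf => ?_⟩,
    fun ⟨⟨h1, h2, _⟩, h3⟩ => ⟨⟨h1, h2⟩, fun f hf => ?_⟩⟩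
  · exact h3 f ⟨hf.1, hf.2.1⟩
  · exact h3 f ⟨hf.1, hf.2, hloop f hf.1⟩

/-- **Edmonds' perfect matching polytope theorem.** A vector `w` indexed by the edges
of `G` lies in the perfect matching polytope of `G` iff it is non-negative, the sum at
each vertex is one, and for every odd set `S` of vertices the total weight of edges
leaving `S` is at least one. -/
theorem perfect_matching_polytope
    [Fintype V] [DecidableEq V] (G : SimpleGraph V) [DecidableRel G.Adj]
    (w : Sym2 V → ℝ) (hsupp : ∀ e ∉ G.edgeSet, w e = 0) :
    InPMPolytope G w ↔
      ((∀ e : Sym2 V, 0 ≤ w e) ∧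
       (∀ v : V, (∑ e ∈ G.edgeFinset, if v ∈ e then w e else 0) = 1) ∧
       (∀ S : Finset V, Odd S.card →
         1 ≤ ∑ e ∈ G.edgeFinset, if e ∈ cutEdges G (↑S : Set V) then w e else 0)) := by
  obtain rfl : ‹DecidableEq V› = Classical.decEq V := Subsingleton.elim _ _
  have hstar : ∀ v, (∑ e ∈ G.edgeFinset, if v ∈ e then w e else 0) =
      ∑ e ∈ cutSet id {v}, w e := by
    refine fun v => sum_edgeFinset_ite G hsupp _ _ fun e he => ?_
    rw [mem_cutSet_singleton]
    exact (and_iff_left (G.not_isDiag_of_mem_edgeSet he)).symm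
  have hcut : ∀ S : Finset V, (∑ e ∈ G.edgeFinset, if e ∈ cutEdges G (↑S : Set V) then w e else 0) =
      ∑ e ∈ cutSet id S, w e := by
    refine fun S => sum_edgeFinset_ite G hsupp _ _ fun e he => ?_
    rw [mem_cutSet_iff]
    simp [cutEdges, he]
  simp only [hstar, hcut]
  constructor
  · rintro ⟨μ, h0, hPM, hsum, hμ⟩
    simp only [isPMF_iff] at hPM
    have hC : ∀ C : Finset (Sym2 V), ∑ e ∈ C, w e = ∑ M, μ M * (M ∩ C).card := by
      intro C
      simp only [hμ]
      rw [Finset.sum_comm]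
      refine Finset.sum_congr rfl fun M _ => ?_
      rw [← Finset.mul_sum, Finset.sum_boole, Finset.filter_mem_eq_inter, Finset.inter_comm]
    refine ⟨fun e => ?_, fun v => ?_, fun S hS => ?_⟩
    · rw [hμ e]
      exact Finset.sum_nonneg fun M _ => mul_nonneg (h0 M) (by split_ifs <;> simp)
    · rw [hC, ← hsum]
      refine Finset.sum_congr rfl fun M _ => ?_
      by_cases hM : μ M = 0
      · simp [hM]
      · have : (M ∩ cutSet id {v}).card = 1 := by convert (hPM M hM).2.2 v
        simp [this]
    · rw [hC, ← hsum]
      refine Finset.sum_le_sum fun M _ => ?_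
      by_cases hM : μ M = 0
      · simp [hM]
      · have : 1 ≤ (M ∩ cutSet id S).card := by
          convert Nat.one_le_iff_ne_zero.2 ((hPM M hM).2.inter_cutSet_nonempty hS).card_ne_zero
        exact le_mul_of_one_le_right (h0 M) (Nat.one_le_cast.2 this)
  · rintro ⟨h1, h2, h3⟩
    obtain ⟨μ, h0, hPM, hsum, hμ⟩ :=
      EdmondsFeasible.inMatchingCone (d := id) (w := w) ⟨h1, h2, h3⟩ zero_le_one
    refine ⟨μ, h0, fun M hM => ?_, by convert hsum, fun e => ?_⟩
    · refine (isPMF_iff G M).2 ⟨fun e he => ?_, hPM M hM⟩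
      by_contra hG
      have h := hμ e ((hPM M hM).1 e he)
      rw [hsupp e hG, eq_comm, Finset.sum_eq_zero_iff_of_nonneg] at h
      · exact hM (by simpa [show e ∈ M from he] using h M (Finset.mem_univ _))
      · intro N _
        split_ifs <;> simp [h0]
    · by_cases he : e.IsDiag
      · rw [hsupp e fun hG => G.not_isDiag_of_mem_edgeSet hG he]
        refine (Finset.sum_eq_zero fun M _ => ?_).symm
        by_cases hM : μ M = 0
        · simp [hM]
        · simp [show e ∉ M from fun h => (hPM M hM).1 e h he]
      · simp only [mul_ite, mul_one, mul_zero]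
        convert hμ e he
end

section
/- Every 3-edge-connected cubic graph with n vertices has at least n/8 perfect matchings avoiding any given edge e, provided e is not contained in a cyclic 3-edge-cut of G. -/
open SimpleGraph
open scoped Classical

universe u

variable {V : Type u}

/-- `μ` restricts to a fixed-point-free involution of `A` along edges of `G`: the mate function
of a perfect matching of `G[A]`. -/
def IsMate (G : SimpleGraph V) (A : Finset V) (μ : V → V) : Prop :=
  ∀ a ∈ A, μ a ∈ A ∧ G.Adj a (μ a) ∧ μ (μ a) = a

/-- `𝒞` is a family of disjoint odd sets in `A \ S` between which `G[A]` has no edges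
after removing `S`. -/
structure IsOddFamily (G : SimpleGraph V) (A S : Finset V) (𝒞 : Finset (Finset V)) : Prop where
  subset : S ⊆ A
  sub : ∀ C ∈ 𝒞, C ⊆ A
  notMem : ∀ C ∈ 𝒞, ∀ v ∈ C, v ∉ S
  odd : ∀ C ∈ 𝒞, Odd C.card
  closed : ∀ C ∈ 𝒞, ∀ v ∈ C, ∀ w ∈ A, G.Adj v w → w ∈ S ∨ w ∈ C
  eq_of_mem : ∀ C ∈ 𝒞, ∀ D ∈ 𝒞, ∀ v, v ∈ C → v ∈ D → C = D

theorem exists_isOddFamily_univ [Fintype V] (G : SimpleGraph V) (heven : Even (Fintype.card V))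
    (h : ¬∃ μ, IsMate G Finset.univ μ) :
    ∃ S 𝒞, IsOddFamily G Finset.univ S 𝒞 ∧ S.card + 2 ≤ 𝒞.card := by
  have hM : ¬∃ M : Subgraph G, M.IsPerfectMatching := by
    rintro ⟨M, hM⟩
    rw [Subgraph.isPerfectMatching_iff] at hM
    choose μ hμ hu using hM
    exact h ⟨μ, fun a _ => ⟨Finset.mem_univ _, (hμ a).adj_sub, (hu _ _ (hμ a).symm).symm⟩⟩
  rw [SimpleGraph.tutte] at hM
  push Not at hM
  obtain ⟨u, hu⟩ := hM
  unfold IsTutteViolator at hu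
  set K := (⊤ : G.Subgraph).deleteVerts u with hK
  have hodd := K.coe.odd_ncard_oddComponents
  have hverts : K.verts = uᶜ := by simp [hK, Set.compl_eq_univ_sdiff]
  have hcard : Nat.card K.verts + u.ncard = Fintype.card V := by
    rw [hverts, Nat.card_coe_set_eq, ← Nat.card_eq_fintype_card]
    have := Set.ncard_add_ncard_compl u
    omega
  have hadj : ∀ v w : K.verts, G.Adj v w → K.coe.Adj v w := by
    rintro ⟨v, hv⟩ ⟨w, hw⟩ hvw
    rw [hverts] at hv hw
    simp only [Set.mem_compl_iff] at hv hw
    simp [hK, hv, hw, hvw]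
  let F : K.coe.ConnectedComponent → Finset V := fun c =>
    c.supp.toFinset.map (Function.Embedding.subtype _)
  have hF : ∀ c v, v ∈ F c ↔ ∃ hv : v ∈ K.verts, (⟨v, hv⟩ : K.verts) ∈ c.supp := by
    intro c v
    simp [F]
  have hFe : ∀ c d v, v ∈ F c → v ∈ F d → c = d := by
    intro c d v hc hd
    obtain ⟨hv, h1⟩ := (hF c v).1 hc
    obtain ⟨_, h2⟩ := (hF d v).1 hd
    exact ConnectedComponent.eq_of_common_vertex h1 h2
  have hFcard : ∀ c, (F c).card = c.supp.ncard := by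
    intro c
    simp [F, Set.ncard_eq_toFinset_card']
  have hFodd : ∀ c ∈ K.coe.oddComponents, Odd (F c).card := by
    intro c hc
    rw [hFcard]
    exact hc
  refine ⟨u.toFinset, K.coe.oddComponents.toFinset.image F, ⟨by simp, by simp, ?_, ?_, ?_, ?_⟩, ?_⟩
  · simp only [Finset.mem_image, Set.mem_toFinset]
    rintro _ ⟨c, hc, rfl⟩ v hv
    obtain ⟨hv, -⟩ := (hF c v).1 hv
    rw [hverts] at hv
    simpa using hv
  · simp only [Finset.mem_image, Set.mem_toFinset]
    rintro _ ⟨c, hc, rfl⟩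
    exact hFodd c hc
  · simp only [Finset.mem_image, Set.mem_toFinset]
    rintro _ ⟨c, hc, rfl⟩ v hv w - hvw
    obtain ⟨hv, hvc⟩ := (hF c v).1 hv
    by_cases hw : w ∈ u
    · exact Or.inl hw
    · right
      have hw' : w ∈ K.verts := by rw [hverts]; exact hw
      exact (hF c w).2 ⟨hw', ConnectedComponent.mem_supp_of_adj_mem_supp c hvc
        (hadj ⟨v, hv⟩ ⟨w, hw'⟩ hvw)⟩
  · simp only [Finset.mem_image, Set.mem_toFinset]
    rintro _ ⟨c, hc, rfl⟩ _ ⟨d, hd, rfl⟩ v hvc hvd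
    rw [hFe c d v hvc hvd]
  · rw [Finset.card_image_of_injOn, ← Set.ncard_eq_toFinset_card', ← Set.ncard_eq_toFinset_card']
    · have : ¬ Odd (Fintype.card V) := Nat.not_odd_iff_even.2 heven
      rw [← hcard, Nat.odd_add] at this
      rw [← Nat.not_odd_iff_even] at this
      rw [← hodd] at this
      rcases Nat.even_or_odd K.coe.oddComponents.ncard with h1 | h1 <;>
      rcases Nat.even_or_odd u.ncard with h2 | h2
      · obtain ⟨a, ha⟩ := h1; obtain ⟨b, hb⟩ := h2; omega
      · exact absurd (iff_of_false (Nat.not_odd_iff_even.2 h1) (by simpa using h2)) this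
      · exact absurd (iff_of_true h1 (by simpa using h2)) this
      · obtain ⟨a, ha⟩ := h1; obtain ⟨b, hb⟩ := h2; omega
    · intro c hc d hd hcd
      simp only [Set.coe_toFinset] at hc
      obtain ⟨v, hv⟩ := Finset.card_pos.1 (hFodd c hc).pos
      exact hFe c d v hv (hcd ▸ hv)

theorem exists_isOddFamily (G : SimpleGraph V) (A : Finset V) (heven : Even A.card)
    (h : ¬∃ μ, IsMate G A μ) :
    ∃ S 𝒞, IsOddFamily G A S 𝒞 ∧ S.card + 2 ≤ 𝒞.card := by
  let ι : A ↪ V := Function.Embedding.subtype _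
  obtain ⟨S, 𝒞, hS, hc⟩ := exists_isOddFamily_univ (G.comap ι) (by simpa using heven) (by
    rintro ⟨μ, hμ⟩
    refine h ⟨fun v => if hv : v ∈ A then μ ⟨v, hv⟩ else v, fun a ha => ?_⟩
    obtain ⟨-, h1, h2⟩ := hμ ⟨a, ha⟩ (Finset.mem_univ _)
    simp only [ha, dif_pos, Finset.coe_mem, true_and, Subtype.coe_eta]
    exact ⟨h1, by rw [h2]⟩)
  have hm : ∀ (C : Finset A) (v : A), (v : V) ∈ C.map ι ↔ v ∈ C := fun C v =>
    Finset.mem_map' ι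
  have hA : ∀ (C : Finset A) v, v ∈ C.map ι → v ∈ A := by
    intro C v hv
    obtain ⟨a, _, rfl⟩ := Finset.mem_map.1 hv
    exact a.2
  refine ⟨S.map ι, 𝒞.image (fun C => C.map ι), ⟨?_, ?_, ?_, ?_, ?_, ?_⟩, ?_⟩
  · exact fun v hv => hA _ _ hv
  · simp only [Finset.mem_image]
    rintro _ ⟨C, hC, rfl⟩ v hv
    exact hA _ _ hv
  · simp only [Finset.mem_image]
    rintro _ ⟨C, hC, rfl⟩ v hv
    have := hA _ _ hv
    lift v to A using this
    rw [hm] at hv ⊢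
    exact hS.notMem C hC v hv
  · simp only [Finset.mem_image]
    rintro _ ⟨C, hC, rfl⟩
    rw [Finset.card_map]
    exact hS.odd C hC
  · simp only [Finset.mem_image]
    rintro _ ⟨C, hC, rfl⟩ v hv w hw hvw
    have := hA _ _ hv
    lift v to A using this
    lift w to A using hw
    rw [hm, hm]
    rw [hm] at hv
    exact hS.closed C hC v hv w (Finset.mem_univ _) hvw
  · simp only [Finset.mem_image]
    rintro _ ⟨C, hC, rfl⟩ _ ⟨D, hD, rfl⟩ v hv hv'
    have := hA _ _ hv
    lift v to A using this
    rw [hm] at hv hv'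
    rw [hS.eq_of_mem C hC D hD v hv hv']
  · rw [Finset.card_map, Finset.card_image_of_injective _ (Finset.map_injective ι)]
    exact hc

namespace IsMate

theorem mono {G H : SimpleGraph V} (h : G ≤ H) {A : Finset V} {μ : V → V} (hμ : IsMate G A μ) :
    IsMate H A μ := fun a ha => ⟨(hμ a ha).1, h (hμ a ha).2.1, (hμ a ha).2.2⟩

theorem congr {G : SimpleGraph V} {A : Finset V} {μ ν : V → V} (hμ : IsMate G A μ)
    (h : ∀ a ∈ A, ν a = μ a) : IsMate G A ν := by
  intro a ha
  obtain ⟨h1, h2, h3⟩ := hμ a ha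
  rw [h a ha, h _ h1]
  exact ⟨h1, h2, h3⟩

theorem restrict {G H : SimpleGraph V} {A B : Finset V} {μ : V → V} (hμ : IsMate G A μ)
    (hB : B ⊆ A) (h : ∀ b ∈ B, μ b ∈ B) (hH : ∀ b ∈ B, G.Adj b (μ b) → H.Adj b (μ b)) :
    IsMate H B μ :=
  fun b hb => ⟨h b hb, hH b hb (hμ b (hB hb)).2.1, (hμ b (hB hb)).2.2⟩

theorem even_card {G : SimpleGraph V} {A : Finset V} {μ : V → V} (hμ : IsMate G A μ) :
    Even A.card := by
  have : ∑ _a ∈ A, (1 : ZMod 2) = 0 :=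
    Finset.sum_involution (fun a _ => μ a) (fun _ _ => by decide)
      (fun a ha _ => (hμ a ha).2.1.ne') (fun a ha => (hμ a ha).1) (fun a ha => (hμ a ha).2.2)
  rw [Finset.sum_const, nsmul_eq_mul, mul_one] at this
  exact (ZMod.natCast_eq_zero_iff_even).1 this

theorem biUnion {ι : Type*} {G : SimpleGraph V} (t : Finset ι) (B : ι → Finset V) (μ : ι → V → V)
    (hμ : ∀ i ∈ t, IsMate G (B i) (μ i))
    (hB : ∀ i ∈ t, ∀ j ∈ t, ∀ v, v ∈ B i → v ∈ B j → i = j) :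
    ∃ ν, IsMate G (t.biUnion B) ν ∧ ∀ i ∈ t, ∀ v ∈ B i, ν v = μ i v := by
  let ν : V → V := fun v => if h : ∃ i ∈ t, v ∈ B i then μ h.choose v else v
  have key : ∀ i ∈ t, ∀ v ∈ B i, ν v = μ i v := by
    intro i hi v hv
    have h : ∃ i ∈ t, v ∈ B i := ⟨i, hi, hv⟩
    simp only [ν, dif_pos h]
    rw [hB _ h.choose_spec.1 i hi v h.choose_spec.2 hv]
  refine ⟨ν, ?_, key⟩
  intro a ha
  obtain ⟨i, hi, hai⟩ := Finset.mem_biUnion.1 ha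
  obtain ⟨h1, h2, h3⟩ := hμ i hi a hai
  rw [key i hi a hai, key i hi _ h1]
  exact ⟨Finset.mem_biUnion.2 ⟨i, hi, h1⟩, h2, h3⟩

theorem union {G : SimpleGraph V} {A B : Finset V} {μ ν : V → V} (hμ : IsMate G A μ)
    (hν : IsMate G B ν) (h : ∀ v ∈ A, v ∉ B) :
    IsMate G (A ∪ B) (fun v => if v ∈ A then μ v else ν v) := by
  intro a ha
  by_cases haA : a ∈ A
  · obtain ⟨h1, h2, h3⟩ := hμ a haA
    simp [haA, h1, h2, h3]
  · have haB : a ∈ B := by simpa [haA] using ha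
    obtain ⟨h1, h2, h3⟩ := hν a haB
    have : ν a ∉ A := fun h' => h _ h' h1
    simp [haA, h1, h2, h3, this]

theorem pair {G : SimpleGraph V} {a b : V} (h : G.Adj a b) :
    IsMate G {a, b} (fun v => if v = a then b else a) := by
  intro v hv
  have hab := h.ne
  simp only [Finset.mem_insert, Finset.mem_singleton] at hv
  rcases hv with rfl | rfl
  · simp [h, hab.symm]
  · simp [h.symm, hab.symm]

/-- Adding the edge `a b` to a mate function of `C \ {b}`. -/
theorem insert_pair {G : SimpleGraph V} {C : Finset V} {a b : V} {μ : V → V} (h : G.Adj a b)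
    (ha : a ∉ C) (hb : b ∈ C) (hμ : IsMate G (C.erase b) μ) :
    ∃ ν, IsMate G (insert a C) ν ∧ ν a = b ∧ ν b = a ∧ ∀ v ∈ C.erase b, ν v = μ v := by
  refine ⟨fun v => if v ∈ ({a, b} : Finset V) then (if v = a then b else a) else μ v,
    ?_, ?_, ?_, ?_⟩
  · have := (IsMate.pair h).union hμ (by
      intro v hv hv'
      simp only [Finset.mem_insert, Finset.mem_singleton] at hv
      rcases hv with rfl | rfl
      · exact ha (Finset.mem_of_mem_erase hv')
      · simp at hv')
    convert this using 1
    ext v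
    simp only [Finset.mem_insert, Finset.mem_union, Finset.mem_singleton, Finset.mem_erase]
    by_cases hvb : v = b
    · subst hvb; simp [hb]
    · simp [hvb]
  · simp
  · simp [h.ne.symm]
  · intro v hv
    have hva : v ≠ a := fun h' => ha (h' ▸ Finset.mem_of_mem_erase hv)
    simp [hva, Finset.ne_of_mem_erase hv]

end IsMate

theorem exists_isMate_of_hall [Fintype V] {D H : SimpleGraph V} (hDH : D ≤ H)
    {S : Finset V} {𝒞 : Finset (Finset V)} (hcover : ∀ v, v ∈ S ∨ ∃ C ∈ 𝒞, v ∈ C)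
    (hnot : ∀ C ∈ 𝒞, ∀ v ∈ C, v ∉ S) (heq : ∀ C ∈ 𝒞, ∀ C' ∈ 𝒞, ∀ v, v ∈ C → v ∈ C' → C = C')
    (hcard : S.card = 𝒞.card)
    (hall : ∀ X ⊆ S, X.Nonempty → X ≠ S →
      X.card + 1 ≤ (𝒞.filter (fun C => ∃ s ∈ X, ∃ c ∈ C, D.Adj s c)).card)
    (hfill : ∀ s ∈ S, ∀ C ∈ 𝒞, ∀ c ∈ C, D.Adj s c → ∃ μ, IsMate H (C.erase c) μ)
    {a b : V} {C₀ : Finset V} {ν₀ : V → V} (ha : a ∈ S) (hC₀ : C₀ ∈ 𝒞) (hb : b ∈ C₀)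
    (hab : H.Adj a b) (hν₀ : IsMate H (C₀.erase b) ν₀) :
    ∃ ν, IsMate H Finset.univ ν ∧ ν a = b ∧ (∀ v ∈ C₀.erase b, ν v = ν₀ v) ∧
      ∀ s ∈ S, ν s ∉ S := by
  let t : {x // x ∈ S.erase a} → Finset (Finset V) := fun s =>
    (𝒞.erase C₀).filter (fun C => ∃ c ∈ C, D.Adj s c)
  have hhall : ∀ X : Finset {x // x ∈ S.erase a}, X.card ≤ (X.biUnion t).card := by
    intro X
    rcases X.eq_empty_or_nonempty with rfl | hX
    · simp
    let X' : Finset V := X.map (Function.Embedding.subtype _)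
    have hX' : ∀ v ∈ X', v ∈ S.erase a := by
      intro v hv
      obtain ⟨w, _, rfl⟩ := Finset.mem_map.1 hv
      exact w.2
    have h1 := hall X' (fun v hv => Finset.mem_of_mem_erase (hX' v hv)) (by simpa [X'] using hX)
      (fun h => absurd (hX' a (h ▸ ha)) (by simp))
    have h2 : (𝒞.filter (fun C => ∃ s ∈ X', ∃ c ∈ C, D.Adj s c)).erase C₀ ⊆ X.biUnion t := by
      intro C hC
      simp only [Finset.mem_erase, Finset.mem_filter] at hC
      obtain ⟨hne, hC, s, hs, c, hc, hsc⟩ := hC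
      obtain ⟨w, hw, rfl⟩ := Finset.mem_map.1 hs
      exact Finset.mem_biUnion.2 ⟨w, hw, Finset.mem_filter.2
        ⟨Finset.mem_erase.2 ⟨hne, hC⟩, c, hc, hsc⟩⟩
    have h3 := Finset.card_le_card h2
    have h4 := Finset.pred_card_le_card_erase (a := C₀)
      (s := 𝒞.filter (fun C => ∃ s ∈ X', ∃ c ∈ C, D.Adj s c))
    have h5 : X'.card = X.card := Finset.card_map _
    omega
  obtain ⟨g, hginj, hg⟩ := (Finset.all_card_le_biUnion_card_iff_exists_injective t).1 hhall
  have hg' : ∀ s : {x // x ∈ S.erase a}, g s ∈ 𝒞 ∧ g s ≠ C₀ ∧ ∃ c ∈ g s, D.Adj s c := by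
    intro s
    have := hg s
    simp only [t, Finset.mem_filter, Finset.mem_erase] at this
    exact ⟨this.1.2, this.1.1, this.2⟩
  have hex : ∀ s ∈ S, ∃ (C : Finset V) (ν : V → V), C ∈ 𝒞 ∧ IsMate H (insert s C) ν ∧ ν s ∈ C ∧
      (∀ h : s ∈ S.erase a, C = g ⟨s, h⟩) ∧
      (s = a → C = C₀ ∧ ν a = b ∧ ∀ v ∈ C₀.erase b, ν v = ν₀ v) := by
    intro s hs
    by_cases hsa : s = a
    · subst hsa
      obtain ⟨ν, h1, h2, h3, h4⟩ := IsMate.insert_pair hab (fun h => hnot _ hC₀ _ h ha) hb hν₀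
      exact ⟨C₀, ν, hC₀, h1, h2 ▸ hb, by simp, fun _ => ⟨rfl, h2, h4⟩⟩
    · have hs' : s ∈ S.erase a := Finset.mem_erase.2 ⟨hsa, hs⟩
      obtain ⟨h1, h2, c, hc, hsc⟩ := hg' ⟨s, hs'⟩
      obtain ⟨μ, hμ⟩ := hfill s hs _ h1 c hc hsc
      obtain ⟨ν, k1, k2, k3, k4⟩ := IsMate.insert_pair (hDH hsc) (fun h => hnot _ h1 _ h hs) hc hμ
      exact ⟨_, ν, h1, k1, k2 ▸ hc, fun _ => rfl, fun h => absurd h hsa⟩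
  choose! f μ hf hμ hμs hfg hfa using hex
  have hfinj : Set.InjOn f S := by
    intro s hs s' hs' hss
    by_cases h1 : s = a <;> by_cases h2 : s' = a
    · rw [h1, h2]
    · have h2' : s' ∈ S.erase a := Finset.mem_erase.2 ⟨h2, hs'⟩
      exact absurd (by rw [← hfg s' hs' h2', ← hss, (hfa s hs h1).1]) (hg' ⟨s', h2'⟩).2.1
    · have h1' : s ∈ S.erase a := Finset.mem_erase.2 ⟨h1, hs⟩
      exact absurd (by rw [← hfg s hs h1', hss, (hfa s' hs' h2).1]) (hg' ⟨s, h1'⟩).2.1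
    · have h2' : s' ∈ S.erase a := Finset.mem_erase.2 ⟨h2, hs'⟩
      have h1' : s ∈ S.erase a := Finset.mem_erase.2 ⟨h1, hs⟩
      rw [hfg s hs h1', hfg s' hs' h2'] at hss
      exact congrArg Subtype.val (hginj hss)
  have himg : S.image f = 𝒞 := by
    apply Finset.eq_of_subset_of_card_le
    · intro C hC
      obtain ⟨s, hs, rfl⟩ := Finset.mem_image.1 hC
      exact hf s hs
    · rw [Finset.card_image_of_injOn hfinj, hcard]
  obtain ⟨ν, hν, hνeq⟩ := IsMate.biUnion S (fun s => insert s (f s)) μ hμ (by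
    intro s hs s' hs' v hv hv'
    simp only [Finset.mem_insert] at hv hv'
    rcases hv with rfl | hv <;> rcases hv' with rfl | hv'
    · rfl
    · exact absurd hs (hnot _ (hf _ hs') _ hv')
    · exact absurd hs' (hnot _ (hf _ hs) _ hv)
    · exact hfinj hs hs' (heq _ (hf _ hs) _ (hf _ hs') v hv hv'))
  refine ⟨ν, ?_, ?_, ?_, ?_⟩
  · convert hν
    ext v
    simp only [Finset.mem_univ, Finset.mem_biUnion, Finset.mem_insert, true_iff]
    rcases hcover v with h | ⟨C, hC, hv⟩
    · exact ⟨v, h, Or.inl rfl⟩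
    · rw [← himg] at hC
      obtain ⟨s, hs, rfl⟩ := Finset.mem_image.1 hC
      exact ⟨s, hs, Or.inr hv⟩
  · rw [hνeq a ha a (by simp)]
    exact (hfa a ha rfl).2.1
  · intro v hv
    rw [hνeq a ha v (by
      rw [(hfa a ha rfl).1]
      exact Finset.mem_insert_of_mem (Finset.mem_of_mem_erase hv))]
    exact (hfa a ha rfl).2.2 v hv
  · intro s hs
    rw [hνeq s hs s (by simp)]
    exact hnot _ (hf s hs) _ (hμs s hs)

theorem IsMate.override {G : SimpleGraph V} {A B : Finset V} {μ ν : V → V} (hν : IsMate G A ν)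
    (hμ : IsMate G B μ) (hBA : B ⊆ A) (hB : ∀ b ∈ B, ν b ∈ B) :
    IsMate G A (fun v => if v ∈ B then μ v else ν v) := by
  intro a ha
  by_cases haB : a ∈ B
  · obtain ⟨h1, h2, h3⟩ := hμ a haB
    simp [haB, hBA h1, h1, h2, h3]
  · obtain ⟨h1, h2, h3⟩ := hν a ha
    have : ν a ∉ B := fun h' => haB (h3 ▸ hB _ h')
    simp [haB, h1, h2, h3, this]

theorem SimpleGraph.Reachable.mem_of_closed {G : SimpleGraph V} {a b : V} (h : G.Reachable a b)
    {Z : Set V} (hZ : ∀ v ∈ Z, ∀ w, G.Adj v w → w ∈ Z) (ha : a ∈ Z) : b ∈ Z := by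
  obtain ⟨p⟩ := h
  induction p with
  | nil => exact ha
  | cons h _ ih => exact ih (hZ _ ha _ h)

theorem SimpleGraph.Preconnected.mem_of_closed {G : SimpleGraph V} (hG : G.Preconnected)
    {Z : Set V} (hZ : ∀ v ∈ Z, ∀ w, G.Adj v w → w ∈ Z) {a : V} (ha : a ∈ Z) (b : V) : b ∈ Z :=
  (hG a b).mem_of_closed hZ ha

/-- A mate function matches a tight barrier bijectively with its odd family. -/
theorem IsOddFamily.tight {G : SimpleGraph V} {A S : Finset V} {𝒞 : Finset (Finset V)}
    (hS : IsOddFamily G A S 𝒞) {μ : V → V} (hμ : IsMate G A μ) (hle : S.card ≤ 𝒞.card) :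
    S.card = 𝒞.card ∧ (∀ s ∈ S, ∃ C ∈ 𝒞, μ s ∈ C) ∧
      ∀ C ∈ 𝒞, ∃ c ∈ C, μ c ∈ S ∧ ∀ v ∈ C.erase c, μ v ∈ C.erase c := by
  have hcl : ∀ C ∈ 𝒞, ∀ v ∈ C, μ v ∈ S ∨ μ v ∈ C := fun C hC v hv =>
    hS.closed C hC v hv _ (hμ v (hS.sub C hC hv)).1 (hμ v (hS.sub C hC hv)).2.1
  have hex : ∀ C ∈ 𝒞, ∃ c ∈ C, μ c ∈ S := by
    intro C hC
    by_contra! hno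
    have : IsMate G C μ := hμ.restrict (hS.sub C hC)
      (fun b hb => (hcl C hC b hb).resolve_left (hno b hb)) (fun _ _ h => h)
    exact Nat.not_even_iff_odd.2 (hS.odd C hC) this.even_card
  have hinv : ∀ C ∈ 𝒞, ∀ v ∈ C, μ (μ v) = v := fun C hC v hv => (hμ v (hS.sub C hC hv)).2.2
  rcases 𝒞.eq_empty_or_nonempty with rfl | ⟨C₁, hC₁⟩
  · have : S = ∅ := by simpa using hle
    subst this
    simp
  have : Nonempty V := ⟨(hex C₁ hC₁).choose⟩
  choose! c hc hcS using hex
  have hinj : Set.InjOn (fun C => μ (c C)) 𝒞 := by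
    intro C hC D hD h
    have : c C = c D := by
      rw [← hinv C hC _ (hc C hC), ← hinv D hD _ (hc D hD)]
      exact congrArg μ h
    exact hS.eq_of_mem C hC D hD (c C) (hc C hC) (this ▸ hc D hD)
  have himg : 𝒞.image (fun C => μ (c C)) = S := by
    apply Finset.eq_of_subset_of_card_le
    · intro s hs
      obtain ⟨C, hC, rfl⟩ := Finset.mem_image.1 hs
      exact hcS C hC
    · rwa [Finset.card_image_of_injOn hinj]
  have hback : ∀ s ∈ S, ∃ C ∈ 𝒞, μ s = c C := by
    intro s hs
    rw [← himg] at hs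
    obtain ⟨C, hC, rfl⟩ := Finset.mem_image.1 hs
    exact ⟨C, hC, hinv C hC _ (hc C hC)⟩
  refine ⟨?_, ?_, ?_⟩
  · rw [← himg, Finset.card_image_of_injOn hinj]
  · intro s hs
    obtain ⟨C, hC, h⟩ := hback s hs
    exact ⟨C, hC, h ▸ hc C hC⟩
  · intro C hC
    refine ⟨c C, hc C hC, hcS C hC, fun v hv => ?_⟩
    obtain ⟨hvc, hvC⟩ := Finset.mem_erase.1 hv
    rw [Finset.mem_erase]
    refine ⟨fun h => ?_, (hcl C hC v hvC).resolve_left fun h => ?_⟩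
    · have : v = μ (c C) := by rw [← h, hinv C hC v hvC]
      exact hS.notMem C hC v hvC (this ▸ hcS C hC)
    · obtain ⟨D, hD, h'⟩ := hback _ h
      rw [hinv C hC v hvC] at h'
      have := hS.eq_of_mem C hC D hD v hvC (h' ▸ hc D hD)
      exact hvc (this ▸ h')

/-- `D` is connected and each of its edges lies in a perfect matching of `D`. -/
structure IsExtendable [Fintype V] (D : SimpleGraph V) : Prop where
  preconnected : D.Preconnected
  exists_mate : ∀ a b, D.Adj a b → ∃ ν, IsMate D Finset.univ ν ∧ ν a = b

namespace IsExtendable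

variable [Fintype V] {D : SimpleGraph V} {S : Finset V} {𝒞 : Finset (Finset V)}

theorem mem_or_mem (hD : IsExtendable D) (hS : IsOddFamily D Finset.univ S 𝒞)
    (hle : S.card ≤ 𝒞.card) (hne : S.Nonempty) (v : V) : v ∈ S ∨ ∃ C ∈ 𝒞, v ∈ C := by
  obtain ⟨x, hx⟩ := hne
  refine by_contra fun hv => ?_
  refine hD.preconnected.mem_of_closed (Z := {v | ¬(v ∈ S ∨ ∃ C ∈ 𝒞, v ∈ C)}) ?_ hv x (Or.inl hx)
  intro v hv w hvw hw
  obtain ⟨ν, hν, rfl⟩ := hD.exists_mate v w hvw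
  obtain ⟨-, h1, h2⟩ := hS.tight hν hle
  rcases hw with hw | ⟨C, hC, hw⟩
  · obtain ⟨C, hC, h⟩ := h1 _ hw
    rw [(hν v (Finset.mem_univ _)).2.2] at h
    exact hv (Or.inr ⟨C, hC, h⟩)
  · rcases hS.closed C hC _ hw v (Finset.mem_univ _) hvw.symm with h | h
    · exact hv (Or.inl h)
    · exact hv (Or.inr ⟨C, hC, h⟩)

theorem hall (hD : IsExtendable D) (hS : IsOddFamily D Finset.univ S 𝒞)
    (hle : S.card ≤ 𝒞.card) {X : Finset V} (hXS : X ⊆ S) (hX : X.Nonempty) (hne : X ≠ S) :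
    X.card + 1 ≤ (𝒞.filter (fun C => ∃ s ∈ X, ∃ c ∈ C, D.Adj s c)).card := by
  by_contra! hlt
  set 𝒩 := 𝒞.filter (fun C => ∃ s ∈ X, ∃ c ∈ C, D.Adj s c) with h𝒩
  have hfam : ∀ ν, IsMate D Finset.univ ν → ∀ C ∈ 𝒩, ∀ v ∈ C, ν v ∈ S → ν v ∈ X := by
    intro ν hν
    obtain ⟨-, h1, h2⟩ := hS.tight hν hle
    choose! f hf hνf using h1
    have hfN : ∀ s ∈ X, f s ∈ 𝒩 := fun s hs => Finset.mem_filter.2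
      ⟨hf s (hXS hs), s, hs, ν s, hνf s (hXS hs), (hν s (Finset.mem_univ _)).2.1⟩
    have hinv : ∀ v, ν (ν v) = v := fun v => (hν v (Finset.mem_univ _)).2.2
    have huniq : ∀ C ∈ 𝒞, ∀ v ∈ C, ∀ w ∈ C, ν v ∈ S → ν w ∈ S → v = w := by
      intro C hC v hv w hw hvS hwS
      obtain ⟨c, -, -, h⟩ := h2 C hC
      have : ∀ u ∈ C, ν u ∈ S → u = c := fun u hu huS => by
        by_contra hne
        exact hS.notMem C hC _ (Finset.mem_of_mem_erase (h u (Finset.mem_erase.2 ⟨hne, hu⟩))) huS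
      rw [this v hv hvS, this w hw hwS]
    have hinj : Set.InjOn f X := by
      intro s hs t ht hst
      have hs' := hXS hs
      have ht' := hXS ht
      have : ν s = ν t := huniq (f s) (hf s hs') _ (hνf s hs') _ (hst ▸ hνf t ht')
        (by rwa [hinv]) (by rwa [hinv])
      rw [← hinv s, this, hinv]
    have himg : X.image f = 𝒩 := by
      apply Finset.eq_of_subset_of_card_le
      · intro C hC
        obtain ⟨s, hs, rfl⟩ := Finset.mem_image.1 hC
        exact hfN s hs
      · rw [Finset.card_image_of_injOn hinj]
        omega
    intro C hC v hv hvS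
    rw [← himg] at hC
    obtain ⟨s, hs, rfl⟩ := Finset.mem_image.1 hC
    have := huniq (f s) (hf s (hXS hs)) v hv _ (hνf s (hXS hs)) hvS (by rw [hinv]; exact hXS hs)
    rw [this, hinv]
    exact hs
  obtain ⟨x, hx⟩ := hX
  have hall : ∀ b, b ∈ {v | v ∈ X ∨ ∃ C ∈ 𝒩, v ∈ C} := by
    refine fun b => hD.preconnected.mem_of_closed ?_ (Or.inl hx) b
    rintro v (hv | ⟨C, hC, hv⟩) w hvw
    · obtain ⟨ν, hν, rfl⟩ := hD.exists_mate v w hvw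
      obtain ⟨-, h1, -⟩ := hS.tight hν hle
      obtain ⟨C, hC, hC'⟩ := h1 v (hXS hv)
      exact Or.inr ⟨C, Finset.mem_filter.2 ⟨hC, v, hv, _, hC', hvw⟩, hC'⟩
    · obtain ⟨ν, hν, rfl⟩ := hD.exists_mate v w hvw
      have hC' := (Finset.mem_filter.1 hC).1
      rcases hS.closed C hC' v hv _ (Finset.mem_univ _) hvw with h | h
      · exact Or.inl (hfam ν hν C hC v hv h)
      · exact Or.inr ⟨C, hC, h⟩
  apply hne
  refine Finset.Subset.antisymm hXS fun s hs => ?_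
  rcases hall s with h | ⟨C, hC, h⟩
  · exact h
  · exact absurd hs (hS.notMem C (Finset.mem_filter.1 hC).1 s h)

theorem fill (hD : IsExtendable D) (hS : IsOddFamily D Finset.univ S 𝒞)
    (hle : S.card ≤ 𝒞.card) {s c : V} {C : Finset V} (hs : s ∈ S) (hC : C ∈ 𝒞) (hc : c ∈ C)
    (hsc : D.Adj s c) :
    ∃ ν, IsMate D Finset.univ ν ∧ ν s = c ∧ (∀ v ∈ C.erase c, ν v ∈ C.erase c) := by
  obtain ⟨ν, hν, rfl⟩ := hD.exists_mate s c hsc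
  obtain ⟨-, -, h2⟩ := hS.tight hν hle
  obtain ⟨c, -, hcS, h⟩ := h2 C hC
  have : ν s = c := by
    by_contra hne
    have := h _ (Finset.mem_erase.2 ⟨hne, hc⟩)
    rw [(hν s (Finset.mem_univ _)).2.2] at this
    exact hS.notMem C hC _ (Finset.mem_of_mem_erase this) hs
  exact ⟨ν, hν, rfl, by rwa [this]⟩

end IsExtendable

theorem IsOddFamily.mono {G H : SimpleGraph V} {A S : Finset V} {𝒞 : Finset (Finset V)}
    (hS : IsOddFamily H A S 𝒞) (h : G ≤ H) : IsOddFamily G A S 𝒞 :=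
  { hS with closed := fun C hC v hv w hw hvw => hS.closed C hC v hv w hw (h hvw) }

theorem IsMate.insert_two {H : SimpleGraph V} {A : Finset V} {a b : V} {μ : V → V}
    (hab : H.Adj a b) (ha : a ∈ A) (hb : b ∈ A) (hμ : IsMate H (A \ {a, b}) μ) :
    ∃ ν, IsMate H A ν ∧ ν a = b ∧ ∀ v ∈ A \ {a, b}, ν v = μ v := by
  have h1 : A \ {a, b} = (A.erase a).erase b := by
    ext v
    simp only [Finset.mem_sdiff, Finset.mem_insert, Finset.mem_singleton, Finset.mem_erase]
    tauto
  rw [h1] at hμ ⊢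
  obtain ⟨ν, hν, h2, -, h3⟩ := IsMate.insert_pair hab (Finset.notMem_erase a A)
    (Finset.mem_erase.2 ⟨hab.ne', hb⟩) hμ
  exact ⟨ν, by rwa [Finset.insert_erase ha] at hν, h2, h3⟩

theorem IsOddFamily.insert {G : SimpleGraph V} {A S : Finset V} {𝒞 : Finset (Finset V)} {c : V}
    (h : IsOddFamily G (A.erase c) S 𝒞) (hc : c ∈ A) : IsOddFamily G A (insert c S) 𝒞 := by
  refine ⟨?_, fun C hC => (h.sub C hC).trans (Finset.erase_subset _ _), ?_, h.odd, ?_,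
    h.eq_of_mem⟩
  · exact Finset.insert_subset hc (h.subset.trans (Finset.erase_subset _ _))
  · intro C hC v hv hvS
    rcases Finset.mem_insert.1 hvS with rfl | hvS
    · exact Finset.notMem_erase v A (h.sub C hC hv)
    · exact h.notMem C hC v hv hvS
  · intro C hC v hv w hw hvw
    by_cases hwc : w = c
    · exact Or.inl (hwc ▸ Finset.mem_insert_self _ _)
    · exact (h.closed C hC v hv w (Finset.mem_erase.2 ⟨hwc, hw⟩) hvw).imp_left
        Finset.mem_insert_of_mem

theorem exists_isOddFamily_single (G : SimpleGraph V) {A : Finset V} {c : V} (hc : c ∈ A)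
    (hodd : Odd A.card) (h : ¬∃ μ, IsMate G (A.erase c) μ) :
    ∃ S 𝒞, IsOddFamily G A S 𝒞 ∧ c ∈ S ∧ S.card + 1 ≤ 𝒞.card := by
  obtain ⟨S, 𝒞, hS, hle⟩ := exists_isOddFamily G (A.erase c) (by
    rw [Finset.card_erase_of_mem hc]
    exact Nat.Odd.sub_odd hodd odd_one) h
  refine ⟨insert c S, 𝒞, hS.insert hc, Finset.mem_insert_self _ _, ?_⟩
  have := Finset.card_insert_le c S
  omega

theorem exists_isOddFamily_pair (G : SimpleGraph V) {A : Finset V} {a b : V} (ha : a ∈ A)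
    (hb : b ∈ A) (hab : a ≠ b) (heven : Even A.card) (h : ¬∃ μ, IsMate G (A \ {a, b}) μ) :
    ∃ S 𝒞, IsOddFamily G A S 𝒞 ∧ a ∈ S ∧ b ∈ S ∧ S.card ≤ 𝒞.card := by
  have h1 : A \ {a, b} = (A.erase a).erase b := by
    ext v
    simp only [Finset.mem_sdiff, Finset.mem_insert, Finset.mem_singleton, Finset.mem_erase]
    tauto
  rw [h1] at h
  obtain ⟨S, 𝒞, hS, hbS, hle⟩ := exists_isOddFamily_single G (A := A.erase a)
    (Finset.mem_erase.2 ⟨hab.symm, hb⟩) (by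
      rw [Finset.card_erase_of_mem ha]
      exact Nat.Even.sub_odd (Finset.card_pos.2 ⟨a, ha⟩) heven odd_one) h
  refine ⟨_, 𝒞, hS.insert ha, Finset.mem_insert_self _ _, Finset.mem_insert_of_mem hbS, ?_⟩
  have := Finset.card_insert_le a S
  omega

/-- `D ⊔ Q` is obtained from the extendable graph `D` by adding the matching `Q`, and the edges of
`Q` appear in mate functions of `D ⊔ Q` only all together. -/
structure IsLinked [Fintype V] (D Q : SimpleGraph V) (N : V → V) : Prop where
  extendable : IsExtendable D
  unique : ∀ a b c, Q.Adj a b → Q.Adj a c → b = c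
  disj : ∀ a b, D.Adj a b → ¬Q.Adj a b
  mate : IsMate (D ⊔ Q) Finset.univ N
  mate_eq : ∀ a b, Q.Adj a b → N a = b
  all : ∀ ν, IsMate (D ⊔ Q) Finset.univ ν → ∀ a b c d, Q.Adj a b → Q.Adj c d → ν a = b → ν c = d

/-- A barrier certifying that every mate function through `x y` uses `p q`. -/
structure IsLinkBarrier [Fintype V] (D Q : SimpleGraph V) (x y p q : V) (S : Finset V)
    (𝒞 : Finset (Finset V)) : Prop where
  hx : x ∈ S
  hy : y ∈ S
  adj : Q.Adj p q
  ne : p ≠ x ∧ p ≠ y ∧ q ≠ x ∧ q ≠ y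
  family : IsOddFamily ((D ⊔ Q).deleteEdges {s(p, q)}) Finset.univ S 𝒞
  le : S.card ≤ 𝒞.card

namespace IsLinkBarrier

variable [Fintype V] {D Q : SimpleGraph V} {N : V → V} {x y p q : V} {S : Finset V}
  {𝒞 : Finset (Finset V)}

theorem swap (h : IsLinkBarrier D Q x y p q S 𝒞) : IsLinkBarrier D Q x y q p S 𝒞 :=
  { h with
    adj := h.adj.symm
    ne := ⟨h.ne.2.2.1, h.ne.2.2.2, h.ne.1, h.ne.2.1⟩
    family := by have := h.family; rwa [Sym2.eq_swap] at this }

theorem family_left (h : IsLinkBarrier D Q x y p q S 𝒞) (hL : IsLinked D Q N) :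
    IsOddFamily D Finset.univ S 𝒞 := by
  refine h.family.mono ?_
  intro a b hab
  rw [deleteEdges_adj]
  refine ⟨Or.inl hab, fun h' => hL.disj a b hab ?_⟩
  rcases (Sym2.eq_iff.1 h') with ⟨rfl, rfl⟩ | ⟨rfl, rfl⟩
  · exact h.adj
  · exact h.adj.symm

theorem closed (h : IsLinkBarrier D Q x y p q S 𝒞) {C : Finset V} (hC : C ∈ 𝒞) {v w : V}
    (hv : v ∈ C) (hvw : (D ⊔ Q).Adj v w) (hne : s(v, w) ≠ s(p, q)) : w ∈ S ∨ w ∈ C :=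
  h.family.closed C hC v hv w (Finset.mem_univ _) (by rw [deleteEdges_adj]; exact ⟨hvw, hne⟩)

theorem mates (h : IsLinkBarrier D Q x y p q S 𝒞) (hL : IsLinked D Q N) (hxy : Q.Adj x y) :
    (∀ s ∈ S, s ≠ x → s ≠ y → ∃ C ∈ 𝒞, p ∉ C ∧ q ∉ C ∧ N s ∈ C) ∧
    (∀ C ∈ 𝒞, p ∉ C → q ∉ C →
      ∃ c ∈ C, N c ∈ S ∧ N c ≠ x ∧ N c ≠ y ∧ ∀ v ∈ C.erase c, N v ∈ C.erase c) ∧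
    ∃ C₁ ∈ 𝒞, p ∈ C₁ ∧ q ∉ C₁ ∧ ∀ v ∈ C₁.erase p, N v ∈ C₁.erase p := by
  have hinv : ∀ v, N (N v) = v := fun v => (hL.mate v (Finset.mem_univ _)).2.2
  have hadj : ∀ v, (D ⊔ Q).Adj v (N v) := fun v => (hL.mate v (Finset.mem_univ _)).2.1
  have hNx : N x = y := hL.mate_eq x y hxy
  have hNy : N y = x := hL.mate_eq y x hxy.symm
  have hNp : N p = q := hL.mate_eq p q h.adj
  have hNq : N q = p := hL.mate_eq q p h.adj.symm
  set A : Finset V := Finset.univ \ {x, y} with hA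
  have hmA : ∀ v, v ∈ A ↔ v ≠ x ∧ v ≠ y := by intro v; simp [hA]
  have hNA : IsMate (D ⊔ Q) A N := hL.mate.restrict (Finset.subset_univ _) (fun v hv => by
      rw [hmA] at hv ⊢
      exact ⟨fun h' => hv.2 (by rw [← hinv v, h', hNx]),
        fun h' => hv.1 (by rw [← hinv v, h', hNy])⟩)
    (fun _ _ h => h)
  set 𝒞' := 𝒞.filter (fun C => p ∉ C ∧ q ∉ C) with h𝒞'
  set S' : Finset V := S \ {x, y} with hS'
  have hmS' : ∀ v, v ∈ S' ↔ v ∈ S ∧ v ≠ x ∧ v ≠ y := by intro v; simp [hS']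
  have hfam : IsOddFamily (D ⊔ Q) A S' 𝒞' := by
    refine ⟨?_, ?_, ?_, ?_, ?_, ?_⟩
    · intro v hv
      exact (hmA v).2 ((hmS' v).1 hv).2
    · intro C hC v hv
      have := h.family.notMem C (Finset.mem_filter.1 hC).1 v hv
      rw [hmA]
      exact ⟨fun h' => this (h' ▸ h.hx), fun h' => this (h' ▸ h.hy)⟩
    · intro C hC v hv hvS
      exact h.family.notMem C (Finset.mem_filter.1 hC).1 v hv ((hmS' v).1 hvS).1
    · exact fun C hC => h.family.odd C (Finset.mem_filter.1 hC).1
    · intro C hC v hv w hw hvw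
      obtain ⟨hC, hpC, hqC⟩ := Finset.mem_filter.1 hC
      rw [hmS']
      have := h.closed hC hv hvw (by
        intro h'
        rcases (Sym2.eq_iff.1 h') with ⟨rfl, rfl⟩ | ⟨rfl, rfl⟩
        · exact hpC hv
        · exact hqC hv)
      exact this.imp_left fun h' => ⟨h', (hmA w).1 hw⟩
    · exact fun C hC D hD => h.family.eq_of_mem C (Finset.mem_filter.1 hC).1 D
        (Finset.mem_filter.1 hD).1
  have hcS : S'.card + 2 = S.card := by
    have h1 : ({x, y} : Finset V) ⊆ S := by
      intro v hv
      simp only [Finset.mem_insert, Finset.mem_singleton] at hv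
      rcases hv with rfl | rfl
      · exact h.hx
      · exact h.hy
    have h2 := Finset.card_sdiff_add_card_eq_card h1
    rwa [Finset.card_pair hxy.ne] at h2
  have hle1 : ∀ r, (𝒞.filter (fun C => r ∈ C)).card ≤ 1 := by
    intro r
    refine Finset.card_le_one.2 fun C hC E hE => ?_
    rw [Finset.mem_filter] at hC hE
    exact h.family.eq_of_mem C hC.1 E hE.1 r hC.2 hE.2
  have hunion : 𝒞 ⊆ 𝒞' ∪ (𝒞.filter (fun C => p ∈ C) ∪ 𝒞.filter (fun C => q ∈ C)) := by
    intro C hC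
    simp only [h𝒞', Finset.mem_union, Finset.mem_filter, hC, true_and]
    tauto
  have hcard := (Finset.card_le_card hunion).trans (Finset.card_union_le _ _)
  have hcard2 := Finset.card_union_le (𝒞.filter (fun C => p ∈ C)) (𝒞.filter (fun C => q ∈ C))
  have hp1 := hle1 p
  have hq1 := hle1 q
  have hle := h.le
  obtain ⟨t1, t2, t3⟩ := hfam.tight hNA (by omega)
  refine ⟨?_, ?_, ?_⟩
  · intro s hs hsx hsy
    obtain ⟨C, hC, hsC⟩ := t2 s ((hmS' s).2 ⟨hs, hsx, hsy⟩)
    rw [h𝒞', Finset.mem_filter] at hC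
    exact ⟨C, hC.1, hC.2.1, hC.2.2, hsC⟩
  · intro C hC hpC hqC
    obtain ⟨c, hc, hcS, hcl⟩ := t3 C (Finset.mem_filter.2 ⟨hC, hpC, hqC⟩)
    rw [hmS'] at hcS
    exact ⟨c, hc, hcS.1, hcS.2.1, hcS.2.2, hcl⟩
  · have hpos : 0 < (𝒞.filter (fun C => p ∈ C)).card := by omega
    obtain ⟨C₁, hC₁⟩ := Finset.card_pos.1 hpos
    obtain ⟨hC₁, hpC₁⟩ := Finset.mem_filter.1 hC₁
    have hqC₁ : q ∉ C₁ := by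
      intro hq
      have : 𝒞.filter (fun C => q ∈ C) ⊆ 𝒞.filter (fun C => p ∈ C) := by
        intro C hC
        rw [Finset.mem_filter] at hC ⊢
        exact ⟨hC.1, h.family.eq_of_mem C hC.1 C₁ hC₁ q hC.2 hq ▸ hpC₁⟩
      rw [Finset.union_eq_left.2 this] at hcard
      omega
    refine ⟨C₁, hC₁, hpC₁, hqC₁, fun v hv => ?_⟩
    obtain ⟨hvp, hv⟩ := Finset.mem_erase.1 hv
    have hNvp : N v ≠ p := fun h' => hqC₁ (by rw [← hNp, ← h', hinv]; exact hv)
    refine Finset.mem_erase.2 ⟨hNvp, (h.closed hC₁ hv (hadj v) ?_).resolve_left fun hs => ?_⟩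
    · intro h'
      rcases (Sym2.eq_iff.1 h') with ⟨rfl, _⟩ | ⟨_, h'⟩
      · exact hvp rfl
      · exact hNvp h'
    · by_cases hx : N v = x
      · have : v = y := by rw [← hinv v, hx, hNx]
        exact h.family.notMem C₁ hC₁ v hv (this ▸ h.hy)
      by_cases hy : N v = y
      · have : v = x := by rw [← hinv v, hy, hNy]
        exact h.family.notMem C₁ hC₁ v hv (this ▸ h.hx)
      obtain ⟨C, hC, hsC⟩ := t2 (N v) ((hmS' _).2 ⟨hs, hx, hy⟩)
      rw [hinv] at hsC
      rw [h𝒞', Finset.mem_filter] at hC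
      exact hC.2.1 (h.family.eq_of_mem C hC.1 C₁ hC₁ v hsC hv ▸ hpC₁)

/-- Away from `x`, the barrier set is not incident with edges of `Q`. -/
theorem not_adj (h : IsLinkBarrier D Q x y p q S 𝒞) (hL : IsLinked D Q N) (hxy : Q.Adj x y)
    {a b : V} (ha : a ∈ S) (hax : a ≠ x) (hay : a ≠ y) : ¬Q.Adj a b := by
  intro hab
  obtain ⟨t1, t2, -⟩ := h.mates hL hxy
  have hfam := h.family_left hL
  obtain ⟨C, hC, hpC, hqC, hbC⟩ := t1 a ha hax hay
  rw [hL.mate_eq a b hab] at hbC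
  obtain ⟨c, hc, hcS, -, -, hcl⟩ := t2 C hC hpC hqC
  have hbc : b = c := by
    by_contra hne
    have := hcl b (Finset.mem_erase.2 ⟨hne, hbC⟩)
    rw [hL.mate_eq b a hab.symm] at this
    exact h.family.notMem C hC a (Finset.mem_of_mem_erase this) ha
  subst hbc
  obtain ⟨x', hx'⟩ : ∃ x', D.Adj x x' := by
    by_contra! hno
    have := hL.extendable.preconnected.mem_of_closed (Z := {x})
      (fun v hv w hvw => absurd (hv ▸ hvw) (hno w)) rfl y
    exact hxy.ne this.symm
  obtain ⟨μ, hμ, -⟩ := hL.extendable.exists_mate x x' hx'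
  obtain ⟨ν, hν, hνa, -, hνS⟩ := exists_isMate_of_hall (D := D) (H := D ⊔ Q) le_sup_left
    (hL.extendable.mem_or_mem hfam h.le ⟨x, h.hx⟩) hfam.notMem hfam.eq_of_mem
    (hfam.tight hμ h.le).1
    (fun X hXS hX hne => hL.extendable.hall hfam h.le hXS hX hne)
    (fun s hs C hC c hc hsc => by
      obtain ⟨ν, hν, -, hcl⟩ := hL.extendable.fill hfam h.le hs hC hc hsc
      exact ⟨ν, hν.restrict (Finset.subset_univ _) hcl (fun _ _ h => Or.inl h)⟩)
    ha hC hbC (Or.inr hab)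
    (hL.mate.restrict (Finset.subset_univ _) hcl (fun _ _ h => h))
  have := hL.all ν hν a b x y hab hxy hνa
  exact hνS x h.hx (this ▸ h.hy)

/-- If a further edge of `Q` has an end in the odd set containing `p`, then the barrier grows. -/
theorem enlarge (h : IsLinkBarrier D Q x y p q S 𝒞) (hL : IsLinked D Q N) (hxy : Q.Adj x y)
    {a b : V} (hab : Q.Adj a b) (hax : a ≠ x) (hay : a ≠ y) (hap : a ≠ p) (haq : a ≠ q)
    {C₁ : Finset V} (hC₁ : C₁ ∈ 𝒞) (hpC₁ : p ∈ C₁) (haC₁ : a ∈ C₁) :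
    ∃ S' 𝒞', S.card < S'.card ∧ IsLinkBarrier D Q x y a b S' 𝒞' := by
  obtain ⟨-, -, C₁', hC₁', hpC₁', hqC₁, hcl⟩ := h.mates hL hxy
  obtain rfl := h.family.eq_of_mem C₁ hC₁ C₁' hC₁' p hpC₁ hpC₁'
  have hNa := hL.mate_eq a b hab
  have hbne : b ≠ x ∧ b ≠ y := ⟨fun h' => hay (hL.unique x a y (h' ▸ hab.symm) hxy),
    fun h' => hax (hL.unique y a x (h' ▸ hab.symm) hxy.symm)⟩
  have haB : a ∈ C₁.erase p := Finset.mem_erase.2 ⟨hap, haC₁⟩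
  have hNB : IsMate (D ⊔ Q) (C₁.erase p) N :=
    hL.mate.restrict (Finset.subset_univ _) hcl (fun _ _ h => h)
  have hno : ¬∃ μ, IsMate ((D ⊔ Q).deleteEdges {s(a, b)}) (C₁.erase p) μ := by
    rintro ⟨μ, hμ⟩
    have hν := hL.mate.override (hμ.mono (deleteEdges_le _)) (Finset.subset_univ _) hcl
    have h1 := hL.all _ hν x y a b hxy hab (by
      have : x ∉ C₁.erase p := fun h' =>
        h.family.notMem C₁ hC₁ x (Finset.mem_of_mem_erase h') h.hx
      simp only [this, if_false]
      exact hL.mate_eq x y hxy)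
    simp only [haB, if_true] at h1
    have h2 := (hμ a haB).2.1
    rw [h1, deleteEdges_adj] at h2
    exact h2.2 rfl
  obtain ⟨S₁, 𝒞₁, h₁, hc₁⟩ := exists_isOddFamily _ _ hNB.even_card hno
  have hsubC : ∀ C ∈ 𝒞₁, ∀ v ∈ C, v ∈ C₁ ∧ v ≠ p := fun C hC v hv =>
    ⟨Finset.mem_of_mem_erase (h₁.sub C hC hv), Finset.ne_of_mem_erase (h₁.sub C hC hv)⟩
  have hS₁C : ∀ v ∈ S₁, v ∈ C₁ ∧ v ≠ p := fun v hv =>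
    ⟨Finset.mem_of_mem_erase (h₁.subset hv), Finset.ne_of_mem_erase (h₁.subset hv)⟩
  have hcS : (insert p (S ∪ S₁)).card = S.card + S₁.card + 1 := by
    rw [Finset.card_insert_of_notMem, Finset.card_union_of_disjoint]
    · rw [Finset.disjoint_left]
      exact fun v hv hv' => h.family.notMem C₁ hC₁ v (hS₁C v hv').1 hv
    · rw [Finset.mem_union]
      rintro (h' | h')
      · exact h.family.notMem C₁ hC₁ p hpC₁ h'
      · exact (hS₁C p h').2 rfl
  refine ⟨insert p (S ∪ S₁), 𝒞.erase C₁ ∪ 𝒞₁, by omega, ?_, ?_, hab, ⟨hax, hay, hbne⟩, ?_, ?_⟩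
  · simp [h.hx]
  · simp [h.hy]
  · refine ⟨Finset.subset_univ _, fun _ _ => Finset.subset_univ _, ?_, ?_, ?_, ?_⟩
    · intro C hC v hv hvS
      simp only [Finset.mem_union, Finset.mem_erase] at hC
      simp only [Finset.mem_insert, Finset.mem_union] at hvS
      rcases hC with ⟨hne, hC⟩ | hC
      · rcases hvS with rfl | hvS | hvS
        · exact hne (h.family.eq_of_mem C hC C₁ hC₁ v hv hpC₁)
        · exact h.family.notMem C hC v hv hvS
        · exact hne (h.family.eq_of_mem C hC C₁ hC₁ v hv (hS₁C v hvS).1)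
      · rcases hvS with rfl | hvS | hvS
        · exact (hsubC C hC v hv).2 rfl
        · exact h.family.notMem C₁ hC₁ v (hsubC C hC v hv).1 hvS
        · exact h₁.notMem C hC v hv hvS
    · intro C hC
      simp only [Finset.mem_union, Finset.mem_erase] at hC
      rcases hC with ⟨-, hC⟩ | hC
      · exact h.family.odd C hC
      · exact h₁.odd C hC
    · intro C hC v hv w _ hvw
      rw [deleteEdges_adj] at hvw
      simp only [Finset.mem_union, Finset.mem_erase] at hC
      simp only [Finset.mem_insert, Finset.mem_union]
      rcases hC with ⟨hne, hC⟩ | hC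
      · by_cases hg : s(v, w) = s(p, q)
        · rcases (Sym2.eq_iff.1 hg) with ⟨rfl, rfl⟩ | ⟨rfl, rfl⟩
          · exact absurd (h.family.eq_of_mem C hC C₁ hC₁ v hv hpC₁) hne
          · exact Or.inl (Or.inl rfl)
        · rcases h.closed hC hv hvw.1 hg with h' | h'
          · exact Or.inl (Or.inr (Or.inl h'))
          · exact Or.inr h'
      · obtain ⟨hvC₁, hvp⟩ := hsubC C hC v hv
        rcases h.closed hC₁ hvC₁ hvw.1 (by
          intro hg
          rcases (Sym2.eq_iff.1 hg) with ⟨rfl, rfl⟩ | ⟨rfl, rfl⟩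
          · exact hvp rfl
          · exact hqC₁ hvC₁) with h' | h'
        · exact Or.inl (Or.inr (Or.inl h'))
        · by_cases hwp : w = p
          · exact Or.inl (Or.inl hwp)
          · rcases h₁.closed C hC v hv w (Finset.mem_erase.2 ⟨hwp, h'⟩)
              (by rw [deleteEdges_adj]; exact hvw) with h'' | h''
            · exact Or.inl (Or.inr (Or.inr h''))
            · exact Or.inr h''
    · intro C hC E hE v hv hv'
      simp only [Finset.mem_union, Finset.mem_erase] at hC hE
      rcases hC with ⟨hne, hC⟩ | hC <;> rcases hE with ⟨hne', hE⟩ | hE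
      · exact h.family.eq_of_mem C hC E hE v hv hv'
      · exact absurd (h.family.eq_of_mem C hC C₁ hC₁ v hv (hsubC E hE v hv').1) hne
      · exact absurd (h.family.eq_of_mem E hE C₁ hC₁ v hv' (hsubC C hC v hv).1) hne'
      · exact h₁.eq_of_mem C hC E hE v hv hv'
  · rw [hcS, Finset.card_union_of_disjoint, Finset.card_erase_of_mem hC₁]
    · have := h.le
      have := Finset.card_pos.2 ⟨C₁, hC₁⟩
      omega
    · rw [Finset.disjoint_left]
      intro C hC hC'
      obtain ⟨hne, hC⟩ := Finset.mem_erase.1 hC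
      obtain ⟨v, hv⟩ := Finset.card_pos.1 (h₁.odd C hC').pos
      exact hne (h.family.eq_of_mem C hC C₁ hC₁ v hv (hsubC C hC' v hv).1)

theorem exists_larger (h : IsLinkBarrier D Q x y p q S 𝒞) (hL : IsLinked D Q N)
    (hxy : Q.Adj x y) {a b : V} (hab : Q.Adj a b) (hax : a ≠ x) (hay : a ≠ y) (hap : a ≠ p)
    (haq : a ≠ q) : ∃ p' q' S' 𝒞', S.card < S'.card ∧ IsLinkBarrier D Q x y p' q' S' 𝒞' := by
  have hfam := h.family_left hL
  have haS : a ∉ S := fun ha => h.not_adj hL hxy ha hax hay hab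
  obtain ⟨C, hC, haC⟩ :=
    (hL.extendable.mem_or_mem hfam h.le ⟨x, h.hx⟩ a).resolve_left haS
  by_cases hpC : p ∈ C
  · obtain ⟨S', 𝒞', h'⟩ := h.enlarge hL hxy hab hax hay hap haq hC hpC haC
    exact ⟨a, b, S', 𝒞', h'⟩
  by_cases hqC : q ∈ C
  · obtain ⟨S', 𝒞', h'⟩ := h.swap.enlarge hL hxy hab hax hay haq hap hC hqC haC
    exact ⟨a, b, S', 𝒞', h'⟩
  exfalso
  obtain ⟨-, t2, -⟩ := h.mates hL hxy
  obtain ⟨c, hc, hcS, hcx, hcy, hcl⟩ := t2 C hC hpC hqC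
  have hadj := (hL.mate c (Finset.mem_univ _)).2.1.symm
  have hinv := (hL.mate c (Finset.mem_univ _)).2.2
  have hDadj : D.Adj (N c) c := hadj.resolve_right (h.not_adj hL hxy hcS hcx hcy)
  obtain ⟨ν, hν, hνc, hcl'⟩ := hL.extendable.fill hfam h.le hcS hC hc hDadj
  have hac : a ≠ c := by
    rintro rfl
    rw [hL.mate_eq a b hab] at hcS hcx hcy
    exact h.not_adj hL hxy hcS hcx hcy hab.symm
  have hmate := (hν.mono (le_sup_left : D ≤ D ⊔ Q)).override
    (hL.mate.restrict (Finset.subset_univ _) hcl (fun _ _ h => h)) (Finset.subset_univ _) hcl'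
  have h1 := hL.all _ hmate a b x y hab hxy (by
    simp only [Finset.mem_erase.2 ⟨hac, haC⟩, if_true]
    exact hL.mate_eq a b hab)
  have hxC : x ∉ C.erase c := fun h' =>
    h.family.notMem C hC x (Finset.mem_of_mem_erase h') h.hx
  simp only [hxC, if_false] at h1
  exact hL.disj x y (h1 ▸ (hν x (Finset.mem_univ _)).2.1) hxy

end IsLinkBarrier

theorem IsLinked.exists_barrier [Fintype V] {D Q : SimpleGraph V} {N : V → V}
    (hL : IsLinked D Q N) {x y p q : V} (hxy : Q.Adj x y) (hpq : Q.Adj p q)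
    (hpx : p ≠ x) (hpy : p ≠ y) : ∃ S 𝒞, IsLinkBarrier D Q x y p q S 𝒞 := by
  have hqne : q ≠ x ∧ q ≠ y := ⟨fun h' => hpy (hL.unique x p y (h' ▸ hpq.symm) hxy),
    fun h' => hpx (hL.unique y p x (h' ▸ hpq.symm) hxy.symm)⟩
  obtain ⟨S, 𝒞, h, hx, hy, hc⟩ := exists_isOddFamily_pair ((D ⊔ Q).deleteEdges {s(p, q)})
    (Finset.mem_univ x) (Finset.mem_univ y) hxy.ne hL.mate.even_card (by
      rintro ⟨μ, hμ⟩
      obtain ⟨ν, hν, hνx, hνμ⟩ := IsMate.insert_two (H := D ⊔ Q) (Or.inr hxy)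
        (Finset.mem_univ x) (Finset.mem_univ y) (hμ.mono (deleteEdges_le _))
      have hpA : p ∈ Finset.univ \ {x, y} := by simp [hpx, hpy]
      have h1 := hL.all ν hν x y p q hxy hpq hνx
      have h2 := (hμ p hpA).2.1
      rw [← hνμ p hpA, h1, deleteEdges_adj] at h2
      exact h2.2 rfl)
  exact ⟨S, 𝒞, hx, hy, hpq, ⟨hpx, hpy, hqne⟩, h, hc⟩

/-- At most two edges can be linked in this way. -/
theorem IsLinked.card_le_four [Fintype V] {D Q : SimpleGraph V} {N : V → V}
    (hL : IsLinked D Q N) : (Finset.univ.filter fun a => ∃ b, Q.Adj a b).card ≤ 4 := by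
  by_contra! hlt
  set T := Finset.univ.filter fun a => ∃ b, Q.Adj a b with hT
  have hex : ∀ B : Finset V, B.card ≤ 4 → ∃ a b, a ∉ B ∧ Q.Adj a b := by
    intro B hB
    obtain ⟨a, ha, haB⟩ := Finset.exists_mem_notMem_of_card_lt_card (lt_of_le_of_lt hB hlt)
    obtain ⟨b, hb⟩ := (Finset.mem_filter.1 ha).2
    exact ⟨a, b, haB, hb⟩
  obtain ⟨x, y, -, hxy⟩ := hex ∅ (by simp)
  obtain ⟨p, q, hp, hpq⟩ := hex {x, y} (Finset.card_le_two.trans (by norm_num))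
  simp only [Finset.mem_insert, Finset.mem_singleton, not_or] at hp
  have key : ∀ k : ℕ, ∃ p q S 𝒞, k ≤ S.card ∧ IsLinkBarrier D Q x y p q S 𝒞 := by
    intro k
    induction k with
    | zero =>
      obtain ⟨S, 𝒞, h⟩ := hL.exists_barrier hxy hpq hp.1 hp.2
      exact ⟨p, q, S, 𝒞, Nat.zero_le _, h⟩
    | succ k ih =>
      obtain ⟨p, q, S, 𝒞, hk, h⟩ := ih
      obtain ⟨a, b, ha, hab⟩ := hex {x, y, p, q} Finset.card_le_four
      simp only [Finset.mem_insert, Finset.mem_singleton, not_or] at ha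
      obtain ⟨p', q', S', 𝒞', hlt, h'⟩ :=
        h.exists_larger hL hxy hab ha.1 ha.2.1 ha.2.2.1 ha.2.2.2
      exact ⟨p', q', S', 𝒞', by omega, h'⟩
  obtain ⟨_, _, S, _, hS, -⟩ := key (Fintype.card V + 1)
  have := Finset.card_le_univ S
  omega

section Counting

variable [Fintype V]

/-- The darts of `G` leaving `X`. -/
noncomputable def outDarts (G : SimpleGraph V) (X : Finset V) : Finset (V × V) :=
  Finset.univ.filter fun d => G.Adj d.1 d.2 ∧ d.1 ∈ X ∧ d.2 ∉ X

theorem mem_outDarts {G : SimpleGraph V} {X : Finset V} {d : V × V} :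
    d ∈ outDarts G X ↔ G.Adj d.1 d.2 ∧ d.1 ∈ X ∧ d.2 ∉ X := by
  simp [outDarts]

theorem ncard_cutEdges (G : SimpleGraph V) (X : Finset V) :
    (cutEdges G (X : Set V)).ncard = (outDarts G X).card := by
  have : cutEdges G (X : Set V) =
      (fun d : V × V => s(d.1, d.2)) '' (outDarts G X : Set (V × V)) := by
    ext e
    simp only [cutEdges, Set.mem_ofPred_eq, Set.mem_image, Finset.mem_coe, mem_outDarts]
    constructor
    · rintro ⟨he, x, y, rfl, hx, hy⟩
      exact ⟨(x, y), ⟨he, hx, hy⟩, rfl⟩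
    · rintro ⟨⟨x, y⟩, ⟨h, hx, hy⟩, rfl⟩
      exact ⟨h, x, y, rfl, hx, hy⟩
  rw [this, Set.InjOn.ncard_image, Set.ncard_coe_finset]
  rintro ⟨a, b⟩ h ⟨c, d⟩ h' heq
  simp only [Finset.mem_coe, mem_outDarts] at h h'
  rcases Sym2.eq_iff.1 heq with ⟨rfl, rfl⟩ | ⟨rfl, rfl⟩
  · rfl
  · exact absurd h.2.1 h'.2.2

theorem EdgeConnectedGe.le_card_outDarts {G : SimpleGraph V} {k : ℕ} (hG : EdgeConnectedGe G k)
    {X : Finset V} {a b : V} (ha : a ∈ X) (hb : b ∉ X) : k ≤ (outDarts G X).card := by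
  rw [← ncard_cutEdges]
  exact hG _ ⟨a, ha⟩ ⟨b, hb⟩

theorem CubicGraph.card_darts {G : SimpleGraph V} (hG : CubicGraph G) (S : Finset V) :
    (Finset.univ.filter fun d : V × V => G.Adj d.1 d.2 ∧ d.1 ∈ S).card = 3 * S.card := by
  have h1 : (Finset.univ.filter fun d : V × V => G.Adj d.1 d.2 ∧ d.1 ∈ S) =
      S.biUnion fun s => (G.neighborFinset s).image fun w => (s, w) := by
    ext ⟨v, w⟩
    simp only [Finset.mem_filter, Finset.mem_univ, true_and, Finset.mem_biUnion, Finset.mem_image,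
      mem_neighborFinset, Prod.mk.injEq]
    constructor
    · rintro ⟨h, hv⟩
      exact ⟨v, hv, w, h, rfl, rfl⟩
    · rintro ⟨_, hv, _, h, rfl, rfl⟩
      exact ⟨h, hv⟩
  rw [h1, Finset.card_biUnion]
  · rw [Finset.sum_congr rfl (g := fun _ => 3)]
    · rw [Finset.sum_const, smul_eq_mul, mul_comm]
    · intro s hs
      rw [Finset.card_image_of_injective _ (fun a b h => (Prod.mk.inj h).2), ← hG s,
        neighborFinset_def, Set.ncard_eq_toFinset_card']
  · intro s _ t _ hst
    simp only [Finset.disjoint_left, Finset.mem_image]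
    rintro _ ⟨w, -, rfl⟩ ⟨w', -, h⟩
    exact hst (Prod.mk.inj h).1.symm

/-- The darts leaving a member of `𝒞` which do not end in `S`. -/
noncomputable def strayDarts (G : SimpleGraph V) (S : Finset V) (𝒞 : Finset (Finset V)) :
    Finset (V × V) :=
  Finset.univ.filter fun d => G.Adj d.1 d.2 ∧ ∃ C ∈ 𝒞, d.1 ∈ C ∧ d.2 ∉ C ∧ d.2 ∉ S

/-- The darts starting in `S` which do not end in a member of `𝒞`. -/
noncomputable def lostDarts (G : SimpleGraph V) (S : Finset V) (𝒞 : Finset (Finset V)) :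
    Finset (V × V) :=
  Finset.univ.filter fun d => G.Adj d.1 d.2 ∧ d.1 ∈ S ∧ ∀ C ∈ 𝒞, d.2 ∉ C

theorem mem_strayDarts {G : SimpleGraph V} {S : Finset V} {𝒞 : Finset (Finset V)} {d : V × V} :
    d ∈ strayDarts G S 𝒞 ↔ G.Adj d.1 d.2 ∧ ∃ C ∈ 𝒞, d.1 ∈ C ∧ d.2 ∉ C ∧ d.2 ∉ S := by
  simp [strayDarts]

theorem mem_lostDarts {G : SimpleGraph V} {S : Finset V} {𝒞 : Finset (Finset V)} {d : V × V} :
    d ∈ lostDarts G S 𝒞 ↔ G.Adj d.1 d.2 ∧ d.1 ∈ S ∧ ∀ C ∈ 𝒞, d.2 ∉ C := by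
  simp [lostDarts]

theorem CubicGraph.sum_card_outDarts {G : SimpleGraph V} (hG : CubicGraph G) {S : Finset V}
    {𝒞 : Finset (Finset V)} (hnot : ∀ C ∈ 𝒞, ∀ v ∈ C, v ∉ S)
    (heq : ∀ C ∈ 𝒞, ∀ D ∈ 𝒞, ∀ v, v ∈ C → v ∈ D → C = D) :
    ∑ C ∈ 𝒞, (outDarts G C).card + (lostDarts G S 𝒞).card =
      3 * S.card + (strayDarts G S 𝒞).card := by
  set E : Finset (V × V) := Finset.univ.filter fun d => G.Adj d.1 d.2 ∧ d.1 ∈ S ∧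
    ¬∀ C ∈ 𝒞, d.2 ∉ C with hE
  have h1 : 3 * S.card = (lostDarts G S 𝒞).card + E.card := by
    rw [← hG.card_darts S, lostDarts, hE,
      ← Finset.card_filter_add_card_filter_not (p := fun d => ∀ C ∈ 𝒞, d.2 ∉ C)]
    simp only [Finset.filter_filter, and_assoc]
  have h2 : ∑ C ∈ 𝒞, (outDarts G C).card = (strayDarts G S 𝒞).card + E.card := by
    rw [← Finset.card_biUnion]
    · rw [← Finset.card_filter_add_card_filter_not (p := fun d : V × V => d.2 ∉ S)]
      congr 1
      · congr 1
        ext d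
        simp only [Finset.mem_filter, Finset.mem_biUnion, mem_outDarts, mem_strayDarts]
        grind
      · apply Finset.card_bij (fun d _ => (d.2, d.1))
        · intro d hd
          simp only [Finset.mem_filter, Finset.mem_biUnion, mem_outDarts, not_not] at hd
          obtain ⟨⟨C, hC, h1, h2, h3⟩, h4⟩ := hd
          simp only [hE, Finset.mem_filter, Finset.mem_univ, true_and]
          exact ⟨h1.symm, h4, fun h => h C hC h2⟩
        · rintro ⟨a, b⟩ _ ⟨c, d⟩ _ h
          obtain ⟨rfl, rfl⟩ := Prod.mk.inj h
          rfl
        · rintro ⟨a, b⟩ h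
          simp only [hE, Finset.mem_filter, Finset.mem_univ, true_and] at h
          obtain ⟨h1, h2, h3⟩ := h
          push Not at h3
          obtain ⟨C, hC, hb⟩ := h3
          refine ⟨(b, a), ?_, rfl⟩
          simp only [Finset.mem_filter, Finset.mem_biUnion, mem_outDarts, not_not]
          exact ⟨⟨C, hC, h1.symm, hb, fun h => hnot C hC a h h2⟩, h2⟩
    · intro C hC D hD hCD
      simp only [Finset.disjoint_left, mem_outDarts, Finset.mem_coe] at *
      intro d hd hd'
      exact hCD (heq C hC D hD d.1 hd.2.1 hd'.2.1)
  omega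

theorem SimpleGraph.IsAcyclic.card_edgeFinset_lt [Nonempty V] {G : SimpleGraph V}
    [Fintype G.edgeSet]
    (hG : G.IsAcyclic) : G.edgeFinset.card < Fintype.card V := by
  obtain ⟨T, hGT, -, hT⟩ :=
    (connected_top (V := V)).exists_isTree_le_of_le_of_isAcyclic le_top hG
  have h1 := hT.card_edgeFinset
  have h2 := Finset.card_le_card (edgeFinset_mono hGT)
  omega

theorem CubicGraph.card_add_two_le {G : SimpleGraph V} (hG : CubicGraph G) {X : Finset V}
    (hX : X.Nonempty) (hac : (G.induce (X : Set V)).IsAcyclic) :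
    X.card + 2 ≤ (outDarts G X).card := by
  have : Nonempty (X : Set V) := hX.to_subtype
  have h1 := hac.card_edgeFinset_lt
  have h2 := (G.induce (X : Set V)).dart_card_eq_twice_card_edges
  have h3 := hG.card_darts X
  rw [← Finset.card_filter_add_card_filter_not (p := fun d => d.2 ∈ X)] at h3
  simp only [Finset.filter_filter] at h3
  have h4 : (Finset.univ.filter fun d : V × V => (G.Adj d.1 d.2 ∧ d.1 ∈ X) ∧ d.2 ∉ X) =
      outDarts G X := by
    ext d
    simp [mem_outDarts, and_assoc]
  have h5 : (Finset.univ.filter fun d : V × V => (G.Adj d.1 d.2 ∧ d.1 ∈ X) ∧ d.2 ∈ X).card ≤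
      Fintype.card (G.induce (X : Set V)).Dart := by
    rw [← Finset.card_univ]
    apply Finset.card_le_card_of_surjOn (fun d => ((d.fst : V), (d.snd : V)))
    rintro ⟨a, b⟩ hd
    simp only [Finset.coe_filter, Finset.mem_univ, true_and, Set.mem_ofPred_eq] at hd
    exact ⟨⟨(⟨a, hd.1.2⟩, ⟨b, hd.2⟩), hd.1.1⟩, by simp, rfl⟩
  have h6 : Fintype.card (X : Set V) = X.card := by simp
  rw [h4] at h3
  omega

end Counting

section Cubic

variable [Fintype V] {G : SimpleGraph V}

theorem CubicGraph.even_card (hG : CubicGraph G) : Even (Fintype.card V) := by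
  have h := hG.card_darts Finset.univ
  have h1 := G.dart_card_eq_twice_card_edges
  have h2 : (Finset.univ.filter fun d : V × V => G.Adj d.1 d.2 ∧ d.1 ∈ Finset.univ).card =
      Fintype.card G.Dart := by
    rw [← Finset.card_univ]
    symm
    apply Finset.card_bij (fun d _ => d.toProd)
    · intro d _
      simp
    · intro d _ d' _ h
      exact Dart.ext _ _ h
    · intro d hd
      simp only [Finset.mem_filter, Finset.mem_univ, true_and, and_true] at hd
      exact ⟨⟨d, hd⟩, Finset.mem_univ _, rfl⟩
  rw [h2, h1, Finset.card_univ] at h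
  rw [Nat.even_iff]
  omega

theorem card_outDarts_compl (G : SimpleGraph V) (X : Finset V) :
    (outDarts G Xᶜ).card = (outDarts G X).card := by
  apply Finset.card_bij (fun d _ => (d.2, d.1))
  · intro d hd
    rw [mem_outDarts] at hd ⊢
    simp only [Finset.mem_compl, not_not] at hd
    exact ⟨hd.1.symm, hd.2.2, hd.2.1⟩
  · rintro ⟨a, b⟩ _ ⟨c, d⟩ _ h
    obtain ⟨rfl, rfl⟩ := Prod.mk.inj h
    rfl
  · rintro ⟨a, b⟩ h
    rw [mem_outDarts] at h
    refine ⟨(b, a), ?_, rfl⟩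
    rw [mem_outDarts]
    simp only [Finset.mem_compl, not_not]
    exact ⟨h.1.symm, h.2.2, h.2.1⟩

theorem CubicGraph.eq_singleton (hG : CubicGraph G) {X : Finset V} {v : V} (hv : v ∈ X)
    (hac : (G.induce (X : Set V)).IsAcyclic) (hX : (outDarts G X).card = 3) : X = {v} := by
  have := hG.card_add_two_le ⟨v, hv⟩ hac
  obtain ⟨w, hw⟩ := Finset.card_eq_one.1
    (le_antisymm (by omega) (Finset.card_pos.2 ⟨v, hv⟩) : X.card = 1)
  rw [hw, Finset.mem_singleton] at hv
  rw [hw, hv]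

/-- A barrier certifying that no perfect matching of `G` contains `a b` and avoids `u v`. -/
structure IsBadEdge (G : SimpleGraph V) (u v a b : V) (S : Finset V) (𝒞 : Finset (Finset V)) :
    Prop where
  adj : (G.deleteEdges {s(u, v)}).Adj a b
  left_mem : a ∈ S
  right_mem : b ∈ S
  family : IsOddFamily (G.deleteEdges {s(u, v)}) Finset.univ S 𝒞
  card_eq : S.card = 𝒞.card
  card_outDarts : ∀ C ∈ 𝒞, (outDarts G C).card = 3
  singleton_left : {u} ∈ 𝒞
  singleton_right : {v} ∈ 𝒞
  lost : ∀ s ∈ S, ∀ w, G.Adj s w → (∃ C ∈ 𝒞, w ∈ C) ∨ (s = a ∧ w = b) ∨ (s = b ∧ w = a)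
  cover : ∀ w, w ∈ S ∨ ∃ C ∈ 𝒞, w ∈ C

theorem exists_isBadEdge (hG : CubicGraph G) (h3 : EdgeConnectedGe G 3) {u v : V}
    (huv : G.Adj u v)
    (hnc : ∀ A : Set V, CyclicCut G A → (cutEdges G A).ncard = 3 → s(u, v) ∉ cutEdges G A)
    {a b : V} (hab : (G.deleteEdges {s(u, v)}).Adj a b)
    (hno : ¬∃ ν, IsMate (G.deleteEdges {s(u, v)}) Finset.univ ν ∧ ν a = b) :
    ∃ S 𝒞, IsBadEdge G u v a b S 𝒞 := by
  obtain ⟨S, 𝒞, hS, ha, hb, hle⟩ := exists_isOddFamily_pair (G.deleteEdges {s(u, v)})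
    (Finset.mem_univ a) (Finset.mem_univ b) hab.ne (by rw [Finset.card_univ]; exact hG.even_card)
    (by
      rintro ⟨μ, hμ⟩
      obtain ⟨ν, hν, hνa, -⟩ := IsMate.insert_two hab (Finset.mem_univ a) (Finset.mem_univ b) hμ
      exact hno ⟨ν, hν, hνa⟩)
  have habG : G.Adj a b := (deleteEdges_le _ : G.deleteEdges {s(u, v)} ≤ G) hab
  have hcut : ∀ C ∈ 𝒞, 3 ≤ (outDarts G C).card := by
    intro C hC
    obtain ⟨w, hw⟩ := Finset.card_pos.1 (hS.odd C hC).pos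
    exact h3.le_card_outDarts hw (fun h => hS.notMem C hC a h ha)
  have hstray : strayDarts G S 𝒞 ⊆ {(u, v), (v, u)} := by
    rintro ⟨x, y⟩ hd
    obtain ⟨hd, C, hC, hx, hy, hyS⟩ := mem_strayDarts.1 hd
    by_contra hne
    have := hS.closed C hC x hx y (Finset.mem_univ _) (by
      rw [deleteEdges_adj]
      refine ⟨hd, fun h => hne ?_⟩
      rcases Sym2.eq_iff.1 h with ⟨rfl, rfl⟩ | ⟨rfl, rfl⟩ <;> simp)
    tauto
  have hlost : {(a, b), (b, a)} ⊆ lostDarts G S 𝒞 := by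
    intro d hd
    simp only [Finset.mem_insert, Finset.mem_singleton] at hd
    rcases hd with rfl | rfl
    · exact mem_lostDarts.2 ⟨habG, ha, fun C hC h => hS.notMem C hC b h hb⟩
    · exact mem_lostDarts.2 ⟨habG.symm, hb, fun C hC h => hS.notMem C hC a h ha⟩
  have hpair : ∀ x y : V, x ≠ y → ({(x, y), (y, x)} : Finset (V × V)).card = 2 := fun x y h =>
    Finset.card_pair (fun h' => h (Prod.mk.inj h').1)
  have c1 := Finset.card_le_card hstray
  have c2 := Finset.card_le_card hlost
  rw [hpair _ _ huv.ne] at c1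
  rw [hpair _ _ hab.ne] at c2
  have c3 := hG.sum_card_outDarts hS.notMem hS.eq_of_mem
  have c4 := Finset.sum_le_sum hcut
  rw [Finset.sum_const, smul_eq_mul] at c4
  have hcard : S.card = 𝒞.card := by omega
  have hcut3 : ∀ C ∈ 𝒞, (outDarts G C).card = 3 := by
    have := (Finset.sum_eq_sum_iff_of_le hcut).1 (by rw [Finset.sum_const, smul_eq_mul]; omega)
    exact fun C hC => (this C hC).symm
  have hlost' := Finset.eq_of_subset_of_card_le hlost (by rw [hpair _ _ hab.ne]; omega)
  have hstray' := Finset.eq_of_subset_of_card_le hstray (by rw [hpair _ _ huv.ne]; omega)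
  have hlost_adj : ∀ s ∈ S, ∀ w, G.Adj s w →
      (∃ C ∈ 𝒞, w ∈ C) ∨ (s = a ∧ w = b) ∨ (s = b ∧ w = a) := by
    intro s hs w hsw
    by_cases h : ∃ C ∈ 𝒞, w ∈ C
    · exact Or.inl h
    · push Not at h
      have : (s, w) ∈ lostDarts G S 𝒞 := mem_lostDarts.2 ⟨hsw, hs, h⟩
      rw [← hlost'] at this
      simpa using Or.inr this
  have hsing : ∀ x y : V, s(x, y) = s(u, v) → (x, y) ∈ strayDarts G S 𝒞 → {x} ∈ 𝒞 := by
    intro x y hxy hd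
    obtain ⟨hadj, C, hC, hx, hy, hyS⟩ := mem_strayDarts.1 hd
    have hC3 := hcut3 C hC
    have hmem : s(u, v) ∈ cutEdges G (C : Set V) := by
      rw [← hxy]
      exact ⟨hadj, x, y, rfl, hx, hy⟩
    have hncyc : ¬CyclicCut G (C : Set V) := fun h => hnc _ h (by rw [ncard_cutEdges, hC3]) hmem
    unfold CyclicCut at hncyc
    rw [← Finset.coe_compl] at hncyc
    rw [not_and_or, not_not, not_not] at hncyc
    rcases hncyc with h | h
    · rw [← hG.eq_singleton hx h hC3]
      exact hC
    · have haC : a ∈ Cᶜ := Finset.mem_compl.2 fun h => hS.notMem C hC a h ha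
      have hbC : b ∈ Cᶜ := Finset.mem_compl.2 fun h => hS.notMem C hC b h hb
      rw [hG.eq_singleton haC h (by rw [card_outDarts_compl, hC3]), Finset.mem_singleton] at hbC
      exact absurd hbC.symm hab.ne
  have huC : {u} ∈ 𝒞 := hsing u v rfl (by rw [hstray']; simp)
  have hvC : {v} ∈ 𝒞 := hsing v u Sym2.eq_swap (by rw [hstray']; simp)
  refine ⟨S, 𝒞, hab, ha, hb, hS, hcard, hcut3, huC, hvC, hlost_adj, ?_⟩
  intro w
  by_contra hw
  have := h3.le_card_outDarts (X := Finset.univ.filter fun w => ¬(w ∈ S ∨ ∃ C ∈ 𝒞, w ∈ C))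
    (a := w) (b := a) (by simpa using hw) (by simp [ha])
  obtain ⟨⟨x, y⟩, hxy⟩ := Finset.card_pos.1 (lt_of_lt_of_le (by norm_num) this)
  simp only [mem_outDarts, Finset.mem_filter, Finset.mem_univ, true_and, not_not] at hxy
  obtain ⟨hadj, hx, hy⟩ := hxy
  rcases hy with hy | ⟨C, hC, hy⟩
  · rcases hlost_adj y hy x hadj.symm with h | ⟨-, rfl⟩ | ⟨-, rfl⟩
    · exact hx (Or.inr h)
    · exact hx (Or.inl hb)
    · exact hx (Or.inl ha)
  · have : (y, x) ∈ strayDarts G S 𝒞 := mem_strayDarts.2 ⟨hadj.symm, C, hC, hy,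
      fun h => hx (Or.inr ⟨C, hC, h⟩), fun h => hx (Or.inl h)⟩
    rw [hstray'] at this
    simp only [Finset.mem_insert, Finset.mem_singleton, Prod.mk.injEq] at this
    rcases this with ⟨-, rfl⟩ | ⟨-, rfl⟩
    · exact hx (Or.inr ⟨_, hvC, Finset.mem_singleton_self _⟩)
    · exact hx (Or.inr ⟨_, huC, Finset.mem_singleton_self _⟩)

end Cubic

section Fill

variable [Fintype V] {G : SimpleGraph V}

theorem exists_isMate_erase (hG : CubicGraph G) (h3 : EdgeConnectedGe G 3) {C : Finset V}
    (hodd : Odd C.card) (hC : (outDarts G C).card = 3) {c s : V} (hc : c ∈ C) (hs : s ∉ C)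
    (hcs : G.Adj c s) : ∃ μ, IsMate G (C.erase c) μ := by
  by_contra hno
  obtain ⟨S, 𝒪, hS, hcS, hle⟩ := exists_isOddFamily_single G hc hodd hno
  have hcut : ∀ O ∈ 𝒪, 3 ≤ (outDarts G O).card := by
    intro O hO
    obtain ⟨w, hw⟩ := Finset.card_pos.1 (hS.odd O hO).pos
    exact h3.le_card_outDarts hw (fun h => hS.notMem O hO c h hcS)
  have hout : (c, s) ∈ outDarts G C := mem_outDarts.2 ⟨hcs, hc, hs⟩
  have hstray : strayDarts G S 𝒪 ⊆ (outDarts G C).erase (c, s) := by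
    intro d hd
    obtain ⟨hd, O, hO, hx, hy, hyS⟩ := mem_strayDarts.1 hd
    refine Finset.mem_erase.2 ⟨?_, mem_outDarts.2 ⟨hd, hS.sub O hO hx, fun hyC => ?_⟩⟩
    · rintro rfl
      exact hS.notMem O hO c hx hcS
    · have := hS.closed O hO d.1 hx d.2 hyC hd
      tauto
  have hlost : {(c, s)} ⊆ lostDarts G S 𝒪 := by
    rw [Finset.singleton_subset_iff, mem_lostDarts]
    exact ⟨hcs, hcS, fun O hO h => hs (hS.sub O hO h)⟩
  have c1 := Finset.card_le_card hstray
  have c2 := Finset.card_le_card hlost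
  rw [Finset.card_erase_of_mem hout] at c1
  rw [Finset.card_singleton] at c2
  have c3 := hG.sum_card_outDarts hS.notMem hS.eq_of_mem
  have c4 := Finset.sum_le_sum hcut
  rw [Finset.sum_const, smul_eq_mul] at c4
  omega

/-- The graph obtained from `G` by contracting the complement of `C` to the vertex `s`. -/
def contractCompl (G : SimpleGraph V) (C : Finset V) (s : V) : SimpleGraph V where
  Adj a b := a ≠ b ∧ ∃ x y, G.Adj x y ∧ (if x ∈ C then x else s) = a ∧
    (if y ∈ C then y else s) = b
  symm := ⟨fun _ _ ⟨h, x, y, hxy, hx, hy⟩ => ⟨h.symm, y, x, hxy.symm, hy, hx⟩⟩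
  loopless := ⟨fun _ h => h.1 rfl⟩

theorem exists_isMate_erase_of_adj (hG : CubicGraph G) (h3 : EdgeConnectedGe G 3) {C : Finset V}
    (hodd : Odd C.card) (hC : (outDarts G C).card = 3) {p q : V} (hp : p ∈ C) (hq : q ∈ C)
    (hpq : G.Adj p q) : ∃ c ∈ C, ∃ s ∉ C, G.Adj c s ∧ p ≠ c ∧
      ∃ μ, IsMate G (C.erase c) μ ∧ μ p = q := by
  obtain ⟨⟨c₀, s₀⟩, hd⟩ := Finset.card_pos.1 (by omega : 0 < (outDarts G C).card)
  obtain ⟨-, -, hs₀⟩ := mem_outDarts.1 hd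
  simp only at hs₀
  set φ : V → V := fun x => if x ∈ C then x else s₀ with hφ
  have hφC : ∀ x ∈ C, φ x = x := fun x hx => if_pos hx
  have hφs : ∀ x, x ∉ C → φ x = s₀ := fun x hx => if_neg hx
  have hφi : ∀ x, φ x ∈ C → x ∈ C := fun x hx => by
    by_contra h
    rw [hφs x h] at hx
    exact hs₀ hx
  set G' := contractCompl G C s₀ with hG'
  have hadj : ∀ a b, G'.Adj a b ↔ a ≠ b ∧ ∃ x y, G.Adj x y ∧ φ x = a ∧ φ y = b :=
    fun a b => Iff.rfl
  have hadjφ : ∀ x y, G.Adj x y → φ x ≠ φ y → G'.Adj (φ x) (φ y) := fun x y h hne =>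
    ⟨hne, x, y, h, rfl, rfl⟩
  have hadjC : ∀ a b, a ∈ C → b ∈ C → (G'.Adj a b ↔ G.Adj a b) := by
    intro a b ha hb
    constructor
    · rintro ⟨-, x, y, hxy, hx, hy⟩
      have hxC := hφi x (by rw [← hx] at ha; exact ha)
      have hyC := hφi y (by rw [← hy] at hb; exact hb)
      rw [← hx, ← hy]
      rwa [if_pos hxC, if_pos hyC]
    · intro h
      have := hadjφ a b h
      rw [hφC a ha, hφC b hb] at this
      exact this h.ne
  have hps : p ≠ s₀ := fun h => hs₀ (h ▸ hp)
  have hqs : q ≠ s₀ := fun h => hs₀ (h ▸ hq)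
  by_cases hM : ∃ μ, IsMate G' (insert s₀ C \ {p, q}) μ
  · obtain ⟨μ, hμ⟩ := hM
    obtain ⟨ν, hν, hνp, -⟩ := IsMate.insert_two ((hadjC p q hp hq).2 hpq)
      (Finset.mem_insert_of_mem hp) (Finset.mem_insert_of_mem hq) hμ
    obtain ⟨h1, h2, h3'⟩ := hν s₀ (Finset.mem_insert_self _ _)
    have hcC : ν s₀ ∈ C := (Finset.mem_insert.1 h1).resolve_left h2.ne'
    obtain ⟨-, x, y, hxy, hx, hy⟩ := h2
    have hyC := hφi y (by rw [← hy] at hcC; exact hcC)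
    have hxC : x ∉ C := fun h => hs₀ (by rw [if_pos h] at hx; rwa [hx] at h)
    rw [if_pos hyC] at hy
    subst hy
    have hpc : p ≠ ν s₀ := by
      intro h
      rw [← h, hνp] at h3'
      exact hqs h3'
    refine ⟨ν s₀, hcC, x, hxC, hxy.symm, hpc, ν, ?_, hνp⟩
    have hcl : ∀ v ∈ C.erase (ν s₀), ν v ∈ C.erase (ν s₀) := by
      intro v hv
      obtain ⟨hvc, hvC⟩ := Finset.mem_erase.1 hv
      obtain ⟨k1, k2, k3⟩ := hν v (Finset.mem_insert_of_mem hvC)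
      refine Finset.mem_erase.2 ⟨fun h => ?_, (Finset.mem_insert.1 k1).resolve_left fun h => ?_⟩
      · rw [h, h3'] at k3
        exact hs₀ (k3 ▸ hvC)
      · rw [h] at k3
        exact hvc k3.symm
    refine hν.restrict ((Finset.erase_subset _ _).trans (Finset.subset_insert _ _)) hcl ?_
    intro v hv h
    exact (hadjC _ _ (Finset.mem_of_mem_erase hv) (Finset.mem_of_mem_erase (hcl v hv))).1 h
  exfalso
  obtain ⟨S, 𝒪, hS, hpS, hqS, hle⟩ := exists_isOddFamily_pair G'
    (Finset.mem_insert_of_mem (b := s₀) hp) (Finset.mem_insert_of_mem (b := s₀) hq) hpq.ne (by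
      rw [Finset.card_insert_of_notMem hs₀]
      exact Odd.add_one hodd) hM
  have hpair : ({(p, q), (q, p)} : Finset (V × V)).card = 2 :=
    Finset.card_pair (fun h' => hpq.ne (Prod.mk.inj h').1)
  set T : Finset V → Finset V := fun O => Finset.univ.filter fun x => φ x ∈ O with hT
  have hmT : ∀ O x, x ∈ T O ↔ φ x ∈ O := fun O x => by simp [hT]
  have hTO : ∀ O ∈ 𝒪, ∃ x, φ x ∈ O := by
    intro O hO
    obtain ⟨w, hw⟩ := Finset.card_pos.1 (hS.odd O hO).pos
    rcases Finset.mem_insert.1 (hS.sub O hO hw) with rfl | h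
    · exact ⟨w, by rwa [hφs w hs₀]⟩
    · exact ⟨w, by rwa [hφC w h]⟩
  have hTinj : Set.InjOn T 𝒪 := by
    intro O hO O' hO' h
    obtain ⟨x, hx⟩ := hTO O hO
    refine hS.eq_of_mem O hO O' hO' _ hx ?_
    rw [← hmT, ← h, hmT]
    exact hx
  have hTnot : ∀ O ∈ 𝒪, ∀ x, φ x ∈ O → x ∉ S.erase s₀ := by
    intro O hO x hx hxS
    obtain ⟨hne, hxS⟩ := Finset.mem_erase.1 hxS
    rw [hφC x ((Finset.mem_insert.1 (hS.subset hxS)).resolve_left hne)] at hx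
    exact hS.notMem O hO x hx hxS
  have c3 := hG.sum_card_outDarts (S := S.erase s₀) (𝒞 := 𝒪.image T)
    (by
      simp only [Finset.mem_image]
      rintro _ ⟨O, hO, rfl⟩ x hx
      exact hTnot O hO x ((hmT O x).1 hx))
    (by
      simp only [Finset.mem_image]
      rintro _ ⟨O, hO, rfl⟩ _ ⟨O', hO', rfl⟩ x hx hx'
      rw [hS.eq_of_mem O hO O' hO' _ ((hmT O x).1 hx) ((hmT O' x).1 hx')])
  have hcut : ∀ O ∈ 𝒪.image T, 3 ≤ (outDarts G O).card := by
    simp only [Finset.mem_image]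
    rintro _ ⟨O, hO, rfl⟩
    obtain ⟨x, hx⟩ := hTO O hO
    exact h3.le_card_outDarts ((hmT O x).2 hx) (b := p) fun h =>
      hTnot O hO p ((hmT O p).1 h) (Finset.mem_erase.2 ⟨hps, hpS⟩)
  have hlost : {(p, q), (q, p)} ⊆ lostDarts G (S.erase s₀) (𝒪.image T) := by
    have hno : ∀ x ∈ S, x ≠ s₀ → ∀ O ∈ 𝒪.image T, x ∉ O := by
      simp only [Finset.mem_image]
      rintro x hx hxs _ ⟨O, hO, rfl⟩ h
      exact hTnot O hO x ((hmT O x).1 h) (Finset.mem_erase.2 ⟨hxs, hx⟩)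
    intro d hd
    simp only [Finset.mem_insert, Finset.mem_singleton] at hd
    rcases hd with rfl | rfl
    · exact mem_lostDarts.2 ⟨hpq, Finset.mem_erase.2 ⟨hps, hpS⟩, hno q hqS hqs⟩
    · exact mem_lostDarts.2 ⟨hpq.symm, Finset.mem_erase.2 ⟨hqs, hqS⟩, hno p hpS hps⟩
  have hstray : ∀ d ∈ strayDarts G (S.erase s₀) (𝒪.image T), s₀ ∈ S ∧ d ∈ outDarts G C := by
    rintro ⟨x, y⟩ hd
    obtain ⟨hd, _, hO', hx, hy, hyS⟩ := mem_strayDarts.1 hd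
    obtain ⟨O, hO, rfl⟩ := Finset.mem_image.1 hO'
    simp only [hmT] at hd hx hy hyS
    have hyA : φ y ∈ insert s₀ C := by
      by_cases h : y ∈ C
      · rw [hφC y h]; exact Finset.mem_insert_of_mem h
      · rw [hφs y h]; exact Finset.mem_insert_self _ _
    have hφy : φ y ∈ S := (hS.closed O hO _ hx _ hyA
      (hadjφ x y hd (fun h => hy (h ▸ hx)))).resolve_right hy
    have hyC : y ∉ C := by
      intro h
      rw [hφC y h] at hφy
      exact hyS (Finset.mem_erase.2 ⟨fun h' => hs₀ (h' ▸ h), hφy⟩)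
    rw [hφs y hyC] at hφy
    refine ⟨hφy, mem_outDarts.2 ⟨hd, ?_, hyC⟩⟩
    by_contra hxC
    simp only at hxC
    rw [hφs x hxC] at hx
    exact hS.notMem O hO _ hx hφy
  have c2 := Finset.card_le_card hlost
  rw [hpair] at c2
  have c4 := Finset.sum_le_sum hcut
  rw [Finset.sum_const, smul_eq_mul, Finset.card_image_of_injOn hTinj] at c4
  by_cases hs : s₀ ∈ S
  · have c1 := Finset.card_le_card (fun d hd => (hstray d hd).2)
    have c5 := Finset.card_erase_add_one hs
    omega
  · have c1 : strayDarts G (S.erase s₀) (𝒪.image T) = ∅ :=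
      Finset.eq_empty_of_forall_notMem fun d hd => hs (hstray d hd).1
    rw [c1, Finset.card_empty, Finset.erase_eq_of_notMem hs] at c3
    rw [Finset.erase_eq_of_notMem hs] at c2
    omega

end Fill

section Extendable

variable [Fintype V] {G : SimpleGraph V}

theorem EdgeConnectedGe.preconnected_deleteEdges {k : ℕ} (hG : EdgeConnectedGe G k)
    {E : Set (Sym2 V)} (hE : E.ncard < k) : (G.deleteEdges E).Preconnected := by
  intro x y
  by_contra hxy
  have h := hG {z | (G.deleteEdges E).Reachable x z} ⟨x, Reachable.refl x⟩ ⟨y, hxy⟩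
  have hsub : cutEdges G {z | (G.deleteEdges E).Reachable x z} ⊆ E := by
    rintro _ ⟨he, p, q, rfl, hp, hq⟩
    by_contra hpq
    exact hq (hp.trans (Adj.reachable (deleteEdges_adj.2 ⟨he, hpq⟩)))
  have := Set.ncard_le_ncard hsub (Set.toFinite _)
  omega

namespace IsBadEdge

variable {u v a b : V} {S : Finset V} {𝒞 : Finset (Finset V)}

theorem adj_of_mem (h : IsBadEdge G u v a b S 𝒞) {C : Finset V} (hC : C ∈ 𝒞) {x y : V}
    (hx : x ∈ S) (hy : y ∈ C) (hxy : G.Adj x y) :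
    (G.deleteEdges {s(u, v), s(a, b)}).Adj x y := by
  refine deleteEdges_adj.2 ⟨hxy, ?_⟩
  rintro (h' | h')
  · rcases Sym2.eq_iff.1 h' with ⟨rfl, -⟩ | ⟨rfl, -⟩
    · exact h.family.notMem _ h.singleton_left _ (Finset.mem_singleton_self _) hx
    · exact h.family.notMem _ h.singleton_right _ (Finset.mem_singleton_self _) hx
  · rcases Sym2.eq_iff.1 h' with ⟨-, rfl⟩ | ⟨-, rfl⟩
    · exact h.family.notMem _ hC _ hy h.right_mem
    · exact h.family.notMem _ hC _ hy h.left_mem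

theorem adj_of_mem_of_mem (h : IsBadEdge G u v a b S 𝒞) (huv : u ≠ v) {C : Finset V}
    (hC : C ∈ 𝒞) {x y : V} (hx : x ∈ C) (hy : y ∈ C) (hxy : G.Adj x y) :
    (G.deleteEdges {s(u, v), s(a, b)}).Adj x y := by
  refine deleteEdges_adj.2 ⟨hxy, ?_⟩
  have hne : ¬(u ∈ C ∧ v ∈ C) := by
    rintro ⟨hu, hv⟩
    rw [h.family.eq_of_mem _ hC _ h.singleton_left u hu (Finset.mem_singleton_self _),
      Finset.mem_singleton] at hv
    exact huv hv.symm
  rintro (h' | h')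
  · rcases Sym2.eq_iff.1 h' with ⟨rfl, rfl⟩ | ⟨rfl, rfl⟩ <;> tauto
  · rcases Sym2.eq_iff.1 h' with ⟨-, rfl⟩ | ⟨-, rfl⟩
    · exact h.family.notMem _ hC _ hy h.right_mem
    · exact h.family.notMem _ hC _ hy h.left_mem

theorem hall (h : IsBadEdge G u v a b S 𝒞) (hG : CubicGraph G) (h3 : EdgeConnectedGe G 3)
    {D : SimpleGraph V} (hD : D = G.deleteEdges {s(u, v), s(a, b)}) {X : Finset V} (hXS : X ⊆ S)
    (hX : X.Nonempty) (hne : X ≠ S) :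
    X.card + 1 ≤ (𝒞.filter fun C => ∃ s ∈ X, ∃ c ∈ C, D.Adj s c).card := by
  by_contra! hlt
  set 𝒩 := 𝒞.filter fun C => ∃ s ∈ X, ∃ c ∈ C, D.Adj s c with h𝒩
  have hsub : ∀ C ∈ 𝒩, C ∈ 𝒞 := fun C hC => (Finset.mem_filter.1 hC).1
  have hlost : ∀ d ∈ lostDarts G X 𝒩, d.1 ∈ X ∧ (d = (a, b) ∨ d = (b, a)) := by
    rintro ⟨x, y⟩ hd
    obtain ⟨hxy, hx, hy⟩ := mem_lostDarts.1 hd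
    refine ⟨hx, ?_⟩
    rcases h.lost x (hXS hx) y hxy with ⟨C, hC, hyC⟩ | h' | h'
    · exact absurd hyC (hy C (Finset.mem_filter.2
        ⟨hC, x, hx, y, hyC, hD ▸ h.adj_of_mem hC (hXS hx) hyC hxy⟩))
    · exact Or.inl (Prod.ext h'.1 h'.2)
    · exact Or.inr (Prod.ext h'.1 h'.2)
  have c1 := hG.sum_card_outDarts (S := X) (𝒞 := 𝒩)
    (fun C hC v hv hvX => h.family.notMem C (hsub C hC) v hv (hXS hvX))
    (fun C hC C' hC' => h.family.eq_of_mem C (hsub C hC) C' (hsub C' hC'))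
  rw [Finset.sum_congr rfl fun C hC => h.card_outDarts C (hsub C hC), Finset.sum_const,
    smul_eq_mul] at c1
  obtain ⟨s, hs, hsX⟩ : ∃ s ∈ S, s ∉ X := by
    by_contra! h'
    exact hne (hXS.antisymm h')
  obtain ⟨x₀, hx₀⟩ := hX
  have c2 := h3.le_card_outDarts (X := X ∪ 𝒩.biUnion id) (Finset.mem_union_left _ hx₀) (b := s) (by
    simp only [Finset.mem_union, Finset.mem_biUnion, id, not_or, not_exists, not_and]
    exact ⟨hsX, fun C hC h' => h.family.notMem C (hsub C hC) s h' hs⟩)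
  have c3 : outDarts G (X ∪ 𝒩.biUnion id) ⊆
      strayDarts G X 𝒩 ∪ (lostDarts G X 𝒩).filter fun d => d.2 ∉ X := by
    rintro ⟨x, y⟩ hd
    rw [mem_outDarts] at hd
    simp only [Finset.mem_union, Finset.mem_biUnion, id, not_or, not_exists, not_and] at hd
    obtain ⟨hxy, hx, hyX, hy⟩ := hd
    rw [Finset.mem_union, Finset.mem_filter, mem_strayDarts, mem_lostDarts]
    rcases hx with hx | ⟨C, hC, hx⟩
    · exact Or.inr ⟨⟨hxy, hx, hy⟩, hyX⟩
    · exact Or.inl ⟨hxy, C, hC, hx, hy C hC, hyX⟩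
  have c4 := (Finset.card_le_card c3).trans (Finset.card_union_le _ _)
  have c5 : (lostDarts G X 𝒩).card ≤ 2 := by
    refine (Finset.card_le_card (t := {(a, b), (b, a)}) fun d hd => ?_).trans Finset.card_le_two
    simpa using (hlost d hd).2
  by_cases hab : a ∈ X ∧ b ∈ X
  · have : ((lostDarts G X 𝒩).filter fun d => d.2 ∉ X) = ∅ := by
      refine Finset.filter_eq_empty_iff.2 fun d hd => ?_
      rcases (hlost d hd).2 with rfl | rfl
      · exact not_not.2 hab.2
      · exact not_not.2 hab.1
    rw [this, Finset.card_empty] at c4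
    omega
  · have c6 : (lostDarts G X 𝒩).card ≤ 1 := by
      refine Finset.card_le_one.2 fun d hd d' hd' => ?_
      obtain ⟨h1, h2⟩ := hlost d hd
      obtain ⟨h1', h2'⟩ := hlost d' hd'
      rcases h2 with rfl | rfl <;> rcases h2' with rfl | rfl
      · rfl
      · exact absurd ⟨h1, h1'⟩ hab
      · exact absurd ⟨h1', h1⟩ hab
      · rfl
    have c7 := Finset.card_filter_le (lostDarts G X 𝒩) fun d => d.2 ∉ X
    omega

theorem isExtendable (h : IsBadEdge G u v a b S 𝒞) (hG : CubicGraph G)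
    (h3 : EdgeConnectedGe G 3) (huv : u ≠ v) :
    IsExtendable (G.deleteEdges {s(u, v), s(a, b)}) := by
  have hcut := h.card_outDarts
  have hmem := fun C hC x y => h.adj_of_mem (C := C) hC (x := x) (y := y)
  have hmem' := fun C hC x y => h.adj_of_mem_of_mem huv (C := C) hC (x := x) (y := y)
  have hpre := h3.preconnected_deleteEdges (E := {s(u, v), s(a, b)})
    ((Set.ncard_insert_le _ _).trans_lt (by simp))
  have hadj : ∀ x y, (G.deleteEdges {s(u, v), s(a, b)}).Adj x y ↔
      G.Adj x y ∧ ¬s(x, y) = s(u, v) ∧ ¬s(x, y) = s(a, b) := by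
    intro x y
    simp only [deleteEdges_adj, Set.mem_insert_iff, Set.mem_singleton_iff, not_or]
  have hall := fun D hD X => h.hall hG h3 (D := D) hD (X := X)
  generalize G.deleteEdges {s(u, v), s(a, b)} = D at *
  have hDG : D ≤ G := fun x y hxy => ((hadj x y).1 hxy).1
  have htrans : ∀ C ∈ 𝒞, ∀ c μ, IsMate G (C.erase c) μ → IsMate D (C.erase c) μ := by
    intro C hC c μ hμ
    refine hμ.restrict subset_rfl (fun x hx => (hμ x hx).1) fun x hx hadj => ?_
    exact hmem' C hC _ _ (Finset.mem_of_mem_erase hx)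
      (Finset.mem_of_mem_erase (hμ x hx).1) hadj
  have hfill : ∀ s ∈ S, ∀ C ∈ 𝒞, ∀ c ∈ C, D.Adj s c → ∃ μ, IsMate D (C.erase c) μ := by
    intro s hs C hC c hc hsc
    obtain ⟨μ, hμ⟩ := exists_isMate_erase hG h3 (h.family.odd C hC) (hcut C hC) hc
      (fun h' => h.family.notMem C hC s h' hs) (hDG hsc.symm)
    exact ⟨μ, htrans C hC c μ hμ⟩
  have hext : ∀ s ∈ S, ∀ C ∈ 𝒞, ∀ c ∈ C, D.Adj s c → ∀ μ, IsMate D (C.erase c) μ →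
      ∃ ν, IsMate D Finset.univ ν ∧ ν s = c ∧ ∀ w ∈ C.erase c, ν w = μ w := by
    intro s hs C hC c hc hsc μ hμ
    obtain ⟨ν, hν, h1, h2, -⟩ := exists_isMate_of_hall le_rfl h.cover h.family.notMem
      h.family.eq_of_mem h.card_eq (hall D rfl) hfill hs hC hc
      hsc hμ
    exact ⟨ν, hν, h1, h2⟩
  have hin : ∀ s ∈ S, ∀ C ∈ 𝒞, ∀ c ∈ C, D.Adj s c → ∃ ν, IsMate D Finset.univ ν ∧ ν s = c := by
    intro s hs C hC c hc hsc
    obtain ⟨μ, hμ⟩ := hfill s hs C hC c hc hsc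
    obtain ⟨ν, hν, h1, -⟩ := hext s hs C hC c hc hsc μ hμ
    exact ⟨ν, hν, h1⟩
  refine ⟨hpre, ?_⟩
  intro p q hpq
  obtain ⟨hpqG, hne, hneab⟩ := (hadj p q).1 hpq
  rcases h.cover p with hp | ⟨C, hC, hp⟩
  · rcases h.lost p hp q hpqG with ⟨C, hC, hq⟩ | ⟨rfl, rfl⟩ | ⟨rfl, rfl⟩
    · exact hin p hp C hC q hq hpq
    · exact absurd rfl hneab
    · exact absurd Sym2.eq_swap hneab
  · rcases h.family.closed C hC p hp q (Finset.mem_univ _)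
      (deleteEdges_adj.2 ⟨hpqG, hne⟩) with hq | hq
    · obtain ⟨ν, hν, h1⟩ := hin q hq C hC p hp hpq.symm
      exact ⟨ν, hν, by rw [← h1, (hν q (Finset.mem_univ _)).2.2]⟩
    · obtain ⟨c, hc, s, hs, hcs, hpc, μ, hμ, hμp⟩ :=
        exists_isMate_erase_of_adj hG h3 (h.family.odd C hC) (hcut C hC) hp hq hpqG
      have hsing : ∀ w, {w} ∈ 𝒞 → c ≠ w := by
        rintro w hw rfl
        rw [h.family.eq_of_mem C hC _ hw c hc (Finset.mem_singleton_self _)] at hp hq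
        rw [Finset.mem_singleton] at hp hq
        exact hpqG.ne (hp.trans hq.symm)
      have hsS : s ∈ S := by
        refine (h.family.closed C hC c hc s (Finset.mem_univ _)
          (deleteEdges_adj.2 ⟨hcs, fun h' => ?_⟩)).resolve_right hs
        rcases Sym2.eq_iff.1 h' with ⟨h', -⟩ | ⟨h', -⟩
        · exact hsing u h.singleton_left h'
        · exact hsing v h.singleton_right h'
      obtain ⟨ν, hν, -, h2⟩ := hext s hsS C hC c hc (hmem C hC _ _ hsS hc hcs.symm) μ
        (htrans C hC c μ hμ)
      exact ⟨ν, hν, by rw [h2 p (Finset.mem_erase.2 ⟨hpc, hp⟩), hμp]⟩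

end IsBadEdge

/-- Deleting an edge that lies in no cyclic 3-edge-cut, and possibly one further edge, leaves an
extendable graph. -/
theorem exists_isExtendable (hG : CubicGraph G) (h3 : EdgeConnectedGe G 3) {u v : V}
    (huv : G.Adj u v)
    (hnc : ∀ A : Set V, CyclicCut G A → (cutEdges G A).ncard = 3 → s(u, v) ∉ cutEdges G A) :
    ∃ a b, IsExtendable (G.deleteEdges {s(u, v), s(a, b)}) := by
  by_cases h : ∀ a b, (G.deleteEdges {s(u, v)}).Adj a b →
      ∃ ν, IsMate (G.deleteEdges {s(u, v)}) Finset.univ ν ∧ ν a = b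
  · refine ⟨u, v, ?_⟩
    rw [Set.pair_eq_singleton]
    exact ⟨h3.preconnected_deleteEdges (by simp), h⟩
  · push Not at h
    obtain ⟨a, b, hab, hno⟩ := h
    obtain ⟨S, 𝒞, hbad⟩ := exists_isBadEdge hG h3 huv hnc hab (by
      rintro ⟨ν, hν, h⟩
      exact hno ν hν h)
    exact ⟨a, b, hbad.isExtendable hG h3 huv.ne⟩

end Extendable

section Ears

variable [Fintype V]

/-- A connected graph of maximum degree two has at most two vertices of degree at most one. -/
theorem SimpleGraph.card_reachable_le_two {L : SimpleGraph V} {T : Finset V} {f g : V → V}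
    (hL : ∀ v w, L.Adj v w → w = f v ∨ (v ∉ T ∧ w = g v)) (x : V) :
    (T.filter fun y => L.Reachable x y).card ≤ 2 := by
  set K := L.connectedComponentMk x with hK
  have hconn := K.connected_toSimpleGraph
  have h1 := hconn.card_vert_le_card_edgeSet_add_one
  have h2 := K.toSimpleGraph.sum_degrees_eq_twice_card_edges
  have hdeg : ∀ v : K, K.toSimpleGraph.degree v + (if (v : V) ∈ T then 1 else 0) ≤ 2 := by
    intro v
    have himg : ((K.toSimpleGraph.neighborFinset v).image Subtype.val) ⊆
        if (v : V) ∈ T then {f v} else {f v, g v} := by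
      intro w hw
      obtain ⟨w, hvw, rfl⟩ := Finset.mem_image.1 hw
      rw [mem_neighborFinset] at hvw
      have := hL v w hvw
      split_ifs with hv
      · simpa using this.resolve_right fun h => h.1 hv
      · rcases this with h | h
        · simp [h]
        · simp [h.2]
    have := Finset.card_le_card himg
    rw [Finset.card_image_of_injective _ Subtype.val_injective,
      card_neighborFinset_eq_degree] at this
    split_ifs at this ⊢
    · rw [Finset.card_singleton] at this
      omega
    · have := this.trans Finset.card_le_two
      omega
  have h3 := Finset.sum_le_sum fun v (_ : v ∈ Finset.univ) => hdeg v
  rw [Finset.sum_add_distrib, h2, Finset.sum_const, Finset.card_univ, smul_eq_mul,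
    ← Finset.card_filter] at h3
  rw [Nat.card_eq_fintype_card, Nat.card_eq_fintype_card, ← edgeFinset_card] at h1
  have h4 : (T.filter fun y => L.Reachable x y).card ≤
      (Finset.univ.filter fun v : K => (v : V) ∈ T).card := by
    refine (Finset.card_le_card fun y hy => ?_).trans (Finset.card_image_le (f := Subtype.val))
    obtain ⟨hy, hxy⟩ := Finset.mem_filter.1 hy
    exact Finset.mem_image.2 ⟨⟨y, ConnectedComponent.sound hxy.symm⟩, by simpa using hy, rfl⟩
  omega

/-- A stage of an ear decomposition of `G₀`: all edges of `H` outside `U` belong to the mate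
function `M`, and `H[U]` is an extendable component. -/
structure IsStage (G₀ H : SimpleGraph V) (M : V → V) (U : Finset V) : Prop where
  le : H ≤ G₀
  nonempty : U.Nonempty
  mate : IsMate H Finset.univ M
  eq_mate : ∀ v, v ∉ U → ∀ w, H.Adj v w → w = M v
  mem_of_adj : ∀ v ∈ U, ∀ w, H.Adj v w → w ∈ U
  reachable : ∀ v ∈ U, ∀ w ∈ U, H.Reachable v w
  exists_mate : ∀ a b, H.Adj a b → ∃ ν, IsMate H Finset.univ ν ∧ ν a = b
  card_le : (Finset.univ.filter fun v => 3 ≤ (Finset.univ.filter (H.Adj v)).card).card + 4 ≤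
    4 * (Finset.univ.filter fun μ : V → V => IsMate H Finset.univ μ).card

/-- The vertices at which the mate function `N` leaves the stage `H` on `U`. -/
noncomputable def exits (H : SimpleGraph V) (U : Finset V) (N : V → V) : Finset V :=
  U.filter fun v => ¬H.Adj v (N v)

/-- The union of the ears along which `N` leaves the stage `H` on `U`. -/
def earGraph (H : SimpleGraph V) (M N : V → V) (U : Finset V) : SimpleGraph V :=
  SimpleGraph.fromRel fun v w => ((v ∈ U → ¬H.Adj v (N v)) ∧ w = N v) ∨ (v ∉ U ∧ w = M v)

namespace IsStage

variable {G₀ H : SimpleGraph V} {M N : V → V} {U : Finset V}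

theorem mate_mem_iff (h : IsStage G₀ H M U) (v : V) : M v ∈ U ↔ v ∈ U :=
  ⟨fun hv => h.mem_of_adj _ hv _ (h.mate v (Finset.mem_univ _)).2.1.symm,
    fun hv => h.mem_of_adj _ hv _ (h.mate v (Finset.mem_univ _)).2.1⟩

theorem not_adj_mate (h : IsStage G₀ H M U) (hN : IsMate G₀ Finset.univ N) {v : V}
    (hv : v ∈ U → ¬H.Adj v (N v)) : N v ∈ U → ¬H.Adj (N v) (N (N v)) := by
  rw [(hN v (Finset.mem_univ _)).2.2]
  exact fun hNv hadj => hv (h.mem_of_adj _ hNv _ hadj) hadj.symm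

theorem earGraph_adj (h : IsStage G₀ H M U) (hN : IsMate G₀ Finset.univ N) {v w : V} :
    (earGraph H M N U).Adj v w ↔
      ((v ∈ U → ¬H.Adj v (N v)) ∧ w = N v) ∨ (v ∉ U ∧ w = M v) := by
  have hNi : ∀ v, N (N v) = v := fun v => (hN v (Finset.mem_univ _)).2.2
  have hMi : ∀ v, M (M v) = v := fun v => (h.mate v (Finset.mem_univ _)).2.2
  rw [earGraph, fromRel_adj]
  constructor
  · rintro ⟨-, h' | ⟨hw, rfl⟩ | ⟨hw, rfl⟩⟩
    · exact h'
    · exact Or.inl ⟨h.not_adj_mate hN hw, (hNi w).symm⟩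
    · exact Or.inr ⟨mt (h.mate_mem_iff w).1 hw, (hMi w).symm⟩
  · intro h'
    refine ⟨?_, Or.inl h'⟩
    rcases h' with ⟨-, rfl⟩ | ⟨-, rfl⟩
    · exact (hN v (Finset.mem_univ _)).2.1.ne
    · exact (h.mate v (Finset.mem_univ _)).2.1.ne

theorem not_adj_of_reachable (h : IsStage G₀ H M U) (hN : IsMate G₀ Finset.univ N) {v w : V}
    (hvw : (earGraph H M N U).Reachable v w) (hv : v ∈ exits H U N) :
    w ∈ U → ¬H.Adj w (N w) := by
  refine hvw.mem_of_closed (Z := {w | w ∈ U → ¬H.Adj w (N w)}) ?_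
    fun _ => (Finset.mem_filter.1 hv).2
  intro x hx y hxy
  rcases (h.earGraph_adj hN).1 hxy with ⟨-, rfl⟩ | ⟨hxU, rfl⟩
  · exact h.not_adj_mate hN hx
  · exact fun hy => absurd ((h.mate_mem_iff x).1 hy) hxU

theorem mem_exits_of_reachable (h : IsStage G₀ H M U) (hN : IsMate G₀ Finset.univ N) {v w : V}
    (hvw : (earGraph H M N U).Reachable v w) (hv : v ∈ exits H U N) (hw : w ∈ U) :
    w ∈ exits H U N :=
  Finset.mem_filter.2 ⟨hw, h.not_adj_of_reachable hN hvw hv hw⟩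

theorem eq_or_eq_of_reachable (h : IsStage G₀ H M U) (hN : IsMate G₀ Finset.univ N) {x y z : V}
    (hx : x ∈ exits H U N) (hy : y ∈ U) (hz : z ∈ U) (hxy : (earGraph H M N U).Reachable x y)
    (hxz : (earGraph H M N U).Reachable x z) (hne : x ≠ y) : z = x ∨ z = y := by
  have hc := card_reachable_le_two (L := earGraph H M N U) (T := exits H U N) (f := N) (g := M)
    (fun v w hvw => by
      rcases (h.earGraph_adj hN).1 hvw with ⟨-, h'⟩ | ⟨hv, h'⟩
      · exact Or.inl h'
      · exact Or.inr ⟨fun hv' => hv (Finset.mem_filter.1 hv').1, h'⟩) x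
  by_contra hz'
  push Not at hz'
  have : ({x, y, z} : Finset V) ⊆
      (exits H U N).filter fun y => (earGraph H M N U).Reachable x y := by
    intro w hw
    simp only [Finset.mem_insert, Finset.mem_singleton] at hw
    rcases hw with rfl | rfl | rfl
    · exact Finset.mem_filter.2 ⟨hx, Reachable.refl _⟩
    · exact Finset.mem_filter.2 ⟨h.mem_exits_of_reachable hN hxy hx hy, hxy⟩
    · exact Finset.mem_filter.2 ⟨h.mem_exits_of_reachable hN hxz hx hz, hxz⟩
  have := Finset.card_le_card this
  rw [Finset.card_eq_three.2 ⟨x, y, z, hne, hz'.1.symm, hz'.2.symm, rfl⟩] at this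
  omega

theorem exists_reachable_ne (h : IsStage G₀ H M U) (hN : IsMate G₀ Finset.univ N) {x : V}
    (hx : x ∈ exits H U N) : ∃ y ∈ U, y ≠ x ∧ (earGraph H M N U).Reachable x y := by
  by_contra! hno
  set K := Finset.univ.filter fun y => (earGraph H M N U).Reachable x y with hK
  have hmK : ∀ y, y ∈ K ↔ (earGraph H M N U).Reachable x y := fun y => by simp [hK]
  have hKU : ∀ y ∈ K, y ∈ U → y = x := fun y hy hyU =>
    by_contra fun hne => hno y hyU hne ((hmK y).1 hy)
  have hxK : x ∈ K := (hmK x).2 (Reachable.refl _)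
  have h1 : IsMate G₀ K N := hN.restrict (Finset.subset_univ _) (fun y hy => (hmK _).2
    (((hmK y).1 hy).trans (Adj.reachable ((h.earGraph_adj hN).2
      (Or.inl ⟨h.not_adj_of_reachable hN ((hmK y).1 hy) hx, rfl⟩))))) fun _ _ h => h
  have h2 : IsMate H (K.erase x) M := by
    refine h.mate.restrict (Finset.subset_univ _) (fun y hy => ?_) fun _ _ h => h
    obtain ⟨hyx, hyK⟩ := Finset.mem_erase.1 hy
    have hyU : y ∉ U := fun hyU => hyx (hKU y hyK hyU)
    refine Finset.mem_erase.2 ⟨?_, (hmK _).2 (((hmK y).1 hyK).trans (Adj.reachable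
      ((h.earGraph_adj hN).2 (Or.inr ⟨hyU, rfl⟩))))⟩
    intro hMy
    exact hyU ((h.mate_mem_iff y).1 (hMy ▸ (Finset.mem_filter.1 hx).1))
  have e1 := h1.even_card
  have e2 := h2.even_card
  rw [← Finset.card_erase_add_one hxK] at e1
  exact (Nat.even_add_one.1 e1) e2

/-- Following `N` along some of its ears and a mate function `μ` of `H` elsewhere in `U`. -/
theorem exists_switch (h : IsStage G₀ H M U) (hN : IsMate G₀ Finset.univ N) {I : Finset V}
    {μ : V → V} (hI : ∀ v ∈ I, v ∈ U → ¬H.Adj v (N v))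
    (hcl : ∀ v ∈ I, ∀ w, (earGraph H M N U).Adj v w → w ∈ I) (hμ : IsMate H (U \ I) μ) :
    ∃ ρ, IsMate G₀ Finset.univ ρ ∧ (∀ v ∈ I, ρ v = N v) ∧ (∀ v ∈ U, v ∉ I → ρ v = μ v) ∧
      (∀ v, v ∉ U → v ∉ I → ρ v = M v) ∧ exits H U ρ = exits H U N ∩ I := by
  have h1 : IsMate G₀ I N := hN.restrict (Finset.subset_univ _)
    (fun v hv => hcl v hv _ ((h.earGraph_adj hN).2 (Or.inl ⟨hI v hv, rfl⟩))) fun _ _ h => h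
  have h2 : IsMate G₀ ((U ∪ I)ᶜ) M := by
    refine (h.mate.mono h.le).restrict (Finset.subset_univ _) (fun v hv => ?_) fun _ _ h => h
    simp only [Finset.mem_compl, Finset.mem_union, not_or] at hv ⊢
    refine ⟨mt (h.mate_mem_iff v).1 hv.1, fun hMv => hv.2 ?_⟩
    have := hcl _ hMv (M (M v)) ((h.earGraph_adj hN).2
      (Or.inr ⟨mt (h.mate_mem_iff v).1 hv.1, rfl⟩))
    rwa [(h.mate v (Finset.mem_univ _)).2.2] at this
  have h3 := (h1.union (hμ.mono h.le) (by simp +contextual)).union h2 (by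
    simp only [Finset.mem_union, Finset.mem_sdiff, Finset.mem_compl]
    tauto)
  refine ⟨_, h3.restrict (B := Finset.univ) (fun v _ => ?_) (fun _ _ => Finset.mem_univ _)
    (fun _ _ h => h), ?_, ?_, ?_, ?_⟩
  · simp only [Finset.mem_union, Finset.mem_sdiff, Finset.mem_compl]
    tauto
  · intro v hv
    simp [hv]
  · intro v hv hvI
    simp [hv, hvI]
  · intro v hv hvI
    simp [hv, hvI]
  · ext v
    simp only [exits, Finset.mem_inter, Finset.mem_filter]
    by_cases hvI : v ∈ I
    · simp [hvI]
    · simp only [hvI, and_false, iff_false, not_and, not_not]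
      intro hvU
      have := (hμ v (Finset.mem_sdiff.2 ⟨hvU, hvI⟩)).2.1
      simpa [hvI, hvU] using this

end IsStage

end Ears

section Linked

variable [Fintype V]

namespace IsStage

variable {G₀ H : SimpleGraph V} {M N : V → V} {U : Finset V}

/-- The link graph on `U`, joining the two ends of each ear. -/
def linkGraph (H : SimpleGraph V) (M N : V → V) (U : Finset V) : SimpleGraph {v // v ∈ U} where
  Adj x y := x ≠ y ∧ ¬H.Adj x (N x) ∧ ¬H.Adj y (N y) ∧ (earGraph H M N U).Reachable x y
  symm := ⟨fun _ _ h => ⟨h.1.symm, h.2.2.1, h.2.1, h.2.2.2.symm⟩⟩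
  loopless := ⟨fun _ h => h.1 rfl⟩

theorem linkGraph_adj (h : IsStage G₀ H M U) (hN : IsMate G₀ Finset.univ N) {x y : {v // v ∈ U}} :
    (linkGraph H M N U).Adj x y ↔
      x ≠ y ∧ (x : V) ∈ exits H U N ∧ (earGraph H M N U).Reachable x y := by
  constructor
  · rintro ⟨h1, h2, h3, h4⟩
    exact ⟨h1, Finset.mem_filter.2 ⟨x.2, h2⟩, h4⟩
  · rintro ⟨h1, h2, h3⟩
    exact ⟨h1, (Finset.mem_filter.1 h2).2,
      (Finset.mem_filter.1 (h.mem_exits_of_reachable hN h3 h2 y.2)).2, h3⟩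

theorem linkGraph_unique (h : IsStage G₀ H M U) (hN : IsMate G₀ Finset.univ N)
    {x y z : {v // v ∈ U}} (hxy : (linkGraph H M N U).Adj x y) (hxz : (linkGraph H M N U).Adj x z) :
    y = z := by
  rw [h.linkGraph_adj hN] at hxy hxz
  refine Subtype.ext ((h.eq_or_eq_of_reachable hN hxy.2.1 y.2 z.2 hxy.2.2 hxz.2.2
    (fun h' => hxy.1 (Subtype.ext h'))).resolve_left fun h' => hxz.1 (Subtype.ext h'.symm)).symm

theorem isExtendable (h : IsStage G₀ H M U) :
    IsExtendable (H.comap (Subtype.val : {v // v ∈ U} → V)) := by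
  constructor
  · intro x y
    obtain ⟨_, hy⟩ := (h.reachable x x.2 y y.2).mem_of_closed
      (Z := {v | ∃ hv : v ∈ U, (H.comap (Subtype.val : {v // v ∈ U} → V)).Reachable x ⟨v, hv⟩})
      (by
        rintro v ⟨hv, hxv⟩ w hvw
        refine ⟨h.mem_of_adj v hv w hvw, hxv.trans (Adj.reachable ?_)⟩
        exact hvw)
      ⟨x.2, Reachable.refl _⟩
    exact hy
  · intro x y hxy
    obtain ⟨ν, hν, hνx⟩ := h.exists_mate x y hxy
    have hmem : ∀ v ∈ U, ν v ∈ U := fun v hv => h.mem_of_adj v hv _ (hν v (Finset.mem_univ _)).2.1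
    refine ⟨fun v => ⟨ν v, hmem v v.2⟩, fun v _ => ⟨Finset.mem_univ _,
      (hν v (Finset.mem_univ _)).2.1, Subtype.ext (hν v (Finset.mem_univ _)).2.2⟩, Subtype.ext hνx⟩

theorem card_exits_le_four (h : IsStage G₀ H M U) (hN : IsMate G₀ Finset.univ N)
    (hmin : ∀ ρ, IsMate G₀ Finset.univ ρ → (exits H U ρ).Nonempty →
      (exits H U N).card ≤ (exits H U ρ).card) : (exits H U N).card ≤ 4 := by
  have hsub : ∀ (I : Finset V) (μ : V → V), (∀ v ∈ I, v ∈ U → ¬H.Adj v (N v)) →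
      (∀ v ∈ I, ∀ w, (earGraph H M N U).Adj v w → w ∈ I) → IsMate H (U \ I) μ →
      (∃ v ∈ exits H U N, v ∈ I) → exits H U N ⊆ I := by
    rintro I μ h1 h2 h3 ⟨v, hv, hvI⟩
    obtain ⟨ρ, hρ, -, -, -, h4⟩ := h.exists_switch hN h1 h2 h3
    have := hmin ρ hρ (by rw [h4]; exact ⟨v, Finset.mem_inter.2 ⟨hv, hvI⟩⟩)
    rw [h4] at this
    rw [← Finset.eq_of_subset_of_card_le Finset.inter_subset_left this]
    exact Finset.inter_subset_right
  by_cases hdisj : ∃ x ∈ exits H U N, ∃ y, (earGraph H M N U).Reachable x y ∧ H.Adj x y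
  · obtain ⟨x, hx, y, hxy, hadj⟩ := hdisj
    have hxU := (Finset.mem_filter.1 hx).1
    have hyU := h.mem_of_adj x hxU y hadj
    obtain ⟨ν, hν, hνx⟩ := h.exists_mate x y hadj
    have hνi : ∀ v, ν (ν v) = v := fun v => (hν v (Finset.mem_univ _)).2.2
    have hor : ∀ v ∈ U, (earGraph H M N U).Reachable x v → v = x ∨ v = y := fun v hv hxv =>
      h.eq_or_eq_of_reachable hN hx hyU hv hxy hxv hadj.ne
    have := hsub (Finset.univ.filter fun v => (earGraph H M N U).Reachable x v) ν
      (fun v hv => h.not_adj_of_reachable hN (Finset.mem_filter.1 hv).2 hx)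
      (fun v hv w hvw => by
        simp only [Finset.mem_filter, Finset.mem_univ, true_and] at hv ⊢
        exact hv.trans hvw.reachable)
      (hν.restrict (Finset.subset_univ _) (fun v hv => by
        simp only [Finset.mem_sdiff, Finset.mem_filter, Finset.mem_univ, true_and] at hv ⊢
        have hvU := h.mem_of_adj v hv.1 _ (hν v (Finset.mem_univ _)).2.1
        refine ⟨hvU, fun hxv => hv.2 ?_⟩
        rcases hor _ hvU hxv with h' | h'
        · rw [← hνi v, h', hνx]
          exact hxy
        · rw [← hνi v, h', ← hνx, hνi]) fun _ _ h => h)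
      ⟨x, hx, by simp⟩
    have hpair : exits H U N ⊆ {x, y} := fun v hv => by
      simpa using hor v (Finset.mem_filter.1 hv).1 (Finset.mem_filter.1 (this hv)).2
    have := (Finset.card_le_card hpair).trans Finset.card_le_two
    omega
  push Not at hdisj
  have hlink : ∀ x (hx : x ∈ exits H U N), ∃ y : {v // v ∈ U}, (linkGraph H M N U).Adj
      ⟨x, (Finset.mem_filter.1 hx).1⟩ y := by
    intro x hx
    obtain ⟨y, hy, hyx, hxy⟩ := h.exists_reachable_ne hN hx
    exact ⟨⟨y, hy⟩, (h.linkGraph_adj hN).2 ⟨fun h' => hyx (congrArg Subtype.val h').symm, hx, hxy⟩⟩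
  set D := H.comap (Subtype.val : {v // v ∈ U} → V) with hD
  set Q := linkGraph H M N U with hQ
  have hd : ∀ x y, D.Adj x y → ¬Q.Adj x y := by
    intro x y hxy hq
    rw [hQ, h.linkGraph_adj hN] at hq
    exact hdisj x hq.2.1 y hq.2.2 hxy
  have hνex : ∀ x : {v // v ∈ U}, ∃ y, (D ⊔ Q).Adj x y ∧ ((x : V) ∈ exits H U N → Q.Adj x y) ∧
      ((x : V) ∉ exits H U N → (y : V) = N x) := by
    intro x
    by_cases hx : (x : V) ∈ exits H U N
    · obtain ⟨y, hy⟩ := hlink x hx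
      exact ⟨y, Or.inr hy, fun _ => hy, fun h' => absurd hx h'⟩
    · have hadj : H.Adj x (N x) := by
        by_contra hadj
        exact hx (Finset.mem_filter.2 ⟨x.2, hadj⟩)
      exact ⟨⟨N x, h.mem_of_adj x x.2 _ hadj⟩, Or.inl hadj, fun h' => absurd h' hx, fun _ => rfl⟩
  choose P hP1 hP2 hP3 using hνex
  have hQexit : ∀ x y, Q.Adj x y → (x : V) ∈ exits H U N := fun x y hxy =>
    ((h.linkGraph_adj hN).1 hxy).2.1
  have hlinked : IsLinked D Q P := by
    refine ⟨h.isExtendable, fun x y z => h.linkGraph_unique hN, hd, ?_, ?_, ?_⟩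
    · intro x _
      refine ⟨Finset.mem_univ _, hP1 x, ?_⟩
      by_cases hx : (x : V) ∈ exits H U N
      · have h1 := hP2 x hx
        exact h.linkGraph_unique hN (hP2 _ (hQexit _ _ h1.symm)) h1.symm
      · have h1 := hP3 x hx
        have h2 : (P x : V) ∉ exits H U N := by
          rw [h1]
          intro h'
          refine h.not_adj_mate hN (fun _ => (Finset.mem_filter.1 h').2) ?_ ?_ <;>
            rw [(hN _ (Finset.mem_univ _)).2.2]
          · exact x.2
          · by_contra hadj
            exact hx (Finset.mem_filter.2 ⟨x.2, hadj⟩)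
        exact Subtype.ext (by rw [hP3 _ h2, h1, (hN _ (Finset.mem_univ _)).2.2])
    · intro x y hxy
      exact h.linkGraph_unique hN (hP2 x (hQexit _ _ hxy)) hxy
    · intro ν hν a b c d hab hcd hνa
      have hνi : ∀ v, ν (ν v) = v := fun v => (hν v (Finset.mem_univ _)).2.2
      have hνadj : ∀ v, D.Adj v (ν v) ∨ Q.Adj v (ν v) := fun v => (hν v (Finset.mem_univ _)).2.1
      set I : Finset V := Finset.univ.filter fun v => ∃ x : {v // v ∈ U}, Q.Adj x (ν x) ∧
        (earGraph H M N U).Reachable x v with hI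
      have hmI : ∀ v, v ∈ I ↔ ∃ x : {v // v ∈ U}, Q.Adj x (ν x) ∧
          (earGraph H M N U).Reachable x v := fun v => by simp [hI]
      have hIν : ∀ v : {v // v ∈ U}, (v : V) ∈ I ↔ Q.Adj v (ν v) := by
        intro v
        rw [hmI]
        refine ⟨?_, fun hv => ⟨v, hv, Reachable.refl _⟩⟩
        rintro ⟨x, hx, hxv⟩
        by_cases hxv' : x = v
        · rwa [← hxv']
        · have h1 : Q.Adj x v := (h.linkGraph_adj hN).2 ⟨hxv', hQexit _ _ hx, hxv⟩
          have h2 := h.linkGraph_unique hN h1 hx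
          rw [h2, hνi]
          exact hx.symm
      let μ : V → V := fun v => if hv : v ∈ U then ν ⟨v, hv⟩ else v
      have hμ : ∀ v (hv : v ∈ U), μ v = ν ⟨v, hv⟩ := fun v hv => dif_pos hv
      have hTI := hsub I μ
        (fun v hv => by
          obtain ⟨x, hx, hxv⟩ := (hmI v).1 hv
          exact h.not_adj_of_reachable hN hxv (hQexit _ _ hx))
        (fun v hv w hvw => by
          obtain ⟨x, hx, hxv⟩ := (hmI v).1 hv
          exact (hmI w).2 ⟨x, hx, hxv.trans hvw.reachable⟩)
        (by
          intro v hv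
          obtain ⟨hvU, hvI⟩ := Finset.mem_sdiff.1 hv
          have hvI' := mt (hIν ⟨v, hvU⟩).2 hvI
          rw [hμ v hvU, hμ _ (ν ⟨v, hvU⟩).2]
          refine ⟨Finset.mem_sdiff.2 ⟨(ν _).2, fun h' => hvI' ?_⟩,
            (hνadj ⟨v, hvU⟩).resolve_right hvI', by rw [Subtype.coe_eta, hνi]⟩
          have := (hIν _).1 h'
          rw [hνi] at this
          exact this.symm)
        ⟨a, hQexit _ _ hab, (hIν a).2 (by rwa [hνa])⟩
      exact h.linkGraph_unique hN ((hIν c).1 (hTI (hQexit _ _ hcd))) hcd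
  refine le_trans ?_ hlinked.card_le_four
  refine (Finset.card_le_card fun x hx => ?_).trans (Finset.card_image_le (f := Subtype.val))
  obtain ⟨y, hy⟩ := hlink x hx
  exact Finset.mem_image.2 ⟨_, Finset.mem_filter.2 ⟨Finset.mem_univ _, y, hy⟩, rfl⟩

end IsStage

end Linked

section Growth

variable [Fintype V]

namespace IsStage

variable {G₀ H : SimpleGraph V} {M N : V → V} {U : Finset V}

theorem exists_exits_nonempty (h : IsStage G₀ H M U) (hG₀ : IsExtendable G₀) (hne : H ≠ G₀) :
    ∃ N, IsMate G₀ Finset.univ N ∧ (exits H U N).Nonempty := by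
  by_contra! hno
  have hadj : ∀ x ∈ U, ∀ y, G₀.Adj x y → H.Adj x y := by
    intro x hx y hxy
    by_contra hH
    obtain ⟨N, hN, hNx⟩ := hG₀.exists_mate x y hxy
    have : x ∈ exits H U N := Finset.mem_filter.2 ⟨hx, by rwa [hNx]⟩
    rw [hno N hN] at this
    exact Finset.notMem_empty _ this
  obtain ⟨x, hx⟩ := h.nonempty
  have huniv : ∀ y, y ∈ U := fun y => hG₀.preconnected.mem_of_closed (Z := (U : Set V))
    (fun v hv w hvw => h.mem_of_adj v hv w (hadj v hv w hvw)) hx y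
  exact hne (le_antisymm h.le fun x y hxy => hadj x (huniv x) y hxy)

/-- The graph obtained from `H` by adding the edges of the mate function `ρ`. -/
def addMate (H : SimpleGraph V) {G₀ : SimpleGraph V} {ρ : V → V} (hρ : IsMate G₀ Finset.univ ρ) :
    SimpleGraph V where
  Adj v w := H.Adj v w ∨ ρ v = w
  symm := ⟨fun v w h => h.imp (fun h => h.symm) fun h => by
    rw [← h, (hρ v (Finset.mem_univ _)).2.2]⟩
  loopless := ⟨fun v h => h.elim (fun h => h.ne rfl) fun h =>
    (hρ v (Finset.mem_univ _)).2.1.ne h.symm⟩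

theorem exists_extension (h : IsStage G₀ H M U) (hG₀ : IsExtendable G₀) (hne : H ≠ G₀) :
    ∃ H' U', IsStage G₀ H' M U' ∧ H < H' := by
  obtain ⟨N, hNmem, hmin⟩ := (Finset.univ.filter fun N : V → V =>
    IsMate G₀ Finset.univ N ∧ (exits H U N).Nonempty).exists_min_image
      (fun N => (exits H U N).card) (by
        obtain ⟨N, hN⟩ := h.exists_exits_nonempty hG₀ hne
        exact ⟨N, by simpa using hN⟩)
  obtain ⟨hN, t, ht⟩ := (Finset.mem_filter.1 hNmem).2
  have hfour := h.card_exits_le_four hN fun ρ hρ hρne => hmin ρ (by simp [hρ, hρne])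
  set J : Finset V := Finset.univ.filter fun v => ∃ x ∈ exits H U N,
    (earGraph H M N U).Reachable x v with hJ
  have hmJ : ∀ v, v ∈ J ↔ ∃ x ∈ exits H U N, (earGraph H M N U).Reachable x v :=
    fun v => by simp [hJ]
  have hJadj : ∀ v ∈ J, v ∈ U → ¬H.Adj v (N v) := by
    intro v hv
    obtain ⟨x, hx, hxv⟩ := (hmJ v).1 hv
    exact h.not_adj_of_reachable hN hxv hx
  have hJcl : ∀ v ∈ J, ∀ w, (earGraph H M N U).Adj v w → w ∈ J := by
    intro v hv w hvw
    obtain ⟨x, hx, hxv⟩ := (hmJ v).1 hv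
    exact (hmJ w).2 ⟨x, hx, hxv.trans hvw.reachable⟩
  have hTJ : exits H U N ⊆ J := fun x hx => (hmJ x).2 ⟨x, hx, Reachable.refl _⟩
  have hUJ : ∀ v ∈ U, v ∉ J → H.Adj v (N v) := by
    intro v hv hvJ
    by_contra hadj
    exact hvJ (hTJ (Finset.mem_filter.2 ⟨hv, hadj⟩))
  have hNi : ∀ v, N (N v) = v := fun v => (hN v (Finset.mem_univ _)).2.2
  obtain ⟨ρ, hρ, hρJ, hρU, hρM, hρT⟩ := h.exists_switch hN hJadj hJcl (μ := N) (by
    intro v hv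
    obtain ⟨hvU, hvJ⟩ := Finset.mem_sdiff.1 hv
    have hadj := hUJ v hvU hvJ
    have hNU := h.mem_of_adj v hvU _ hadj
    refine ⟨Finset.mem_sdiff.2 ⟨hNU, fun h' => hJadj _ h' hNU ?_⟩, hadj, hNi v⟩
    rw [hNi]
    exact hadj.symm)
  rw [Finset.inter_eq_left.2 hTJ] at hρT
  set H' := addMate H hρ with hH'
  have hadj' : ∀ v w, H'.Adj v w ↔ H.Adj v w ∨ ρ v = w := fun v w => Iff.rfl
  have hHH' : H ≤ H' := fun v w hvw => Or.inl hvw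
  have hρH' : IsMate H' Finset.univ ρ := fun v hv =>
    ⟨Finset.mem_univ _, Or.inr rfl, (hρ v hv).2.2⟩
  have htρ : ¬H.Adj t (ρ t) := by
    rw [← hρT] at ht
    exact (Finset.mem_filter.1 ht).2
  have hreach : ∀ v ∈ U ∪ J, ∃ x ∈ U, H'.Reachable x v := by
    intro v hv
    rcases Finset.mem_union.1 hv with hv | hv
    · exact ⟨v, hv, Reachable.refl _⟩
    obtain ⟨x, hx, hxv⟩ := (hmJ v).1 hv
    refine ⟨x, (Finset.mem_filter.1 hx).1, ?_⟩
    refine (hxv.mem_of_closed (Z := {v | v ∈ J ∧ H'.Reachable x v}) ?_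
      ⟨hTJ hx, Reachable.refl _⟩).2
    rintro y ⟨hyJ, hxy⟩ z hyz
    refine ⟨hJcl y hyJ z hyz, hxy.trans (Adj.reachable ?_)⟩
    rcases (h.earGraph_adj hN).1 hyz with ⟨-, rfl⟩ | ⟨-, rfl⟩
    · exact Or.inr (hρJ y hyJ)
    · exact Or.inl (h.mate y (Finset.mem_univ _)).2.1
  refine ⟨H', U ∪ J, ⟨?_, h.nonempty.mono Finset.subset_union_left, h.mate.mono hHH', ?_, ?_, ?_,
    ?_, ?_⟩, lt_of_le_of_ne hHH' fun h' => htρ (h' ▸ (hρH' t (Finset.mem_univ _)).2.1)⟩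
  · rintro v w (hvw | rfl)
    · exact h.le hvw
    · exact (hρ v (Finset.mem_univ _)).2.1
  · intro v hv w hvw
    rw [Finset.mem_union, not_or] at hv
    rcases hvw with hvw | rfl
    · exact h.eq_mate v hv.1 w hvw
    · exact hρM v hv.1 hv.2
  · intro v hv w hvw
    by_cases hvU : v ∈ U
    · rcases hvw with hvw | rfl
      · exact Finset.mem_union_left _ (h.mem_of_adj v hvU w hvw)
      · by_cases hvJ : v ∈ J
        · rw [hρJ v hvJ]
          exact Finset.mem_union_right _ (hJcl v hvJ _
            ((h.earGraph_adj hN).2 (Or.inl ⟨hJadj v hvJ, rfl⟩)))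
        · rw [hρU v hvU hvJ]
          exact Finset.mem_union_left _ (h.mem_of_adj v hvU _ (hUJ v hvU hvJ))
    · have hvJ := (Finset.mem_union.1 hv).resolve_left hvU
      refine Finset.mem_union_right _ (hJcl v hvJ w ((h.earGraph_adj hN).2 ?_))
      rcases hvw with hvw | rfl
      · exact Or.inr ⟨hvU, h.eq_mate v hvU w hvw⟩
      · exact Or.inl ⟨hJadj v hvJ, hρJ v hvJ⟩
  · intro v hv w hw
    obtain ⟨x, hx, hxv⟩ := hreach v hv
    obtain ⟨y, hy, hyw⟩ := hreach w hw
    exact hxv.symm.trans (((h.reachable x hx y hy).mono hHH').trans hyw)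
  · rintro v w (hvw | rfl)
    · obtain ⟨ν, hν, hνv⟩ := h.exists_mate v w hvw
      exact ⟨ν, hν.mono hHH', hνv⟩
    · exact ⟨ρ, hρH', rfl⟩
  · have hdeg : (Finset.univ.filter fun v => 3 ≤ (Finset.univ.filter (H'.Adj v)).card) ⊆
        (Finset.univ.filter fun v => 3 ≤ (Finset.univ.filter (H.Adj v)).card) ∪ exits H U N := by
      intro v hv
      rw [Finset.mem_filter] at hv
      rw [Finset.mem_union, Finset.mem_filter]
      by_cases hvU : v ∈ U
      · by_cases hvT : v ∈ exits H U N
        · exact Or.inr hvT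
        refine Or.inl ⟨Finset.mem_univ _, hv.2.trans (Finset.card_le_card fun w hw => ?_)⟩
        simp only [Finset.mem_filter, Finset.mem_univ, true_and, hadj'] at hw ⊢
        rcases hw with hw | rfl
        · exact hw
        · rw [← hρT] at hvT
          by_contra hadj
          exact hvT (Finset.mem_filter.2 ⟨hvU, hadj⟩)
      · have hsub : Finset.univ.filter (H'.Adj v) ⊆ {M v, ρ v} := by
          intro w hw
          simp only [Finset.mem_filter, Finset.mem_univ, true_and, hadj'] at hw
          rcases hw with hw | rfl
          · simp [h.eq_mate v hvU w hw]
          · simp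
        have h1 := hv.2.trans ((Finset.card_le_card hsub).trans Finset.card_le_two)
        omega
    have hmates : insert ρ (Finset.univ.filter fun μ : V → V => IsMate H Finset.univ μ) ⊆
        Finset.univ.filter fun μ : V → V => IsMate H' Finset.univ μ := by
      intro μ hμ
      rw [Finset.mem_insert, Finset.mem_filter] at hμ
      refine Finset.mem_filter.2 ⟨Finset.mem_univ _, ?_⟩
      rcases hμ with rfl | hμ
      · exact hρH'
      · exact hμ.2.mono hHH'
    have c1 := (Finset.card_le_card hdeg).trans (Finset.card_union_le _ _)
    have c2 := Finset.card_le_card hmates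
    rw [Finset.card_insert_of_notMem fun h' =>
      htρ ((Finset.mem_filter.1 h').2 t (Finset.mem_univ _)).2.1] at c2
    have c3 := h.card_le
    omega

end IsStage

theorem IsExtendable.exists_isMate [Nontrivial V] {D : SimpleGraph V} (hD : IsExtendable D) :
    ∃ μ, IsMate D Finset.univ μ := by
  by_contra hno
  obtain ⟨x, y, hxy⟩ := exists_pair_ne V
  refine hxy (hD.preconnected.mem_of_closed (Z := {y}) ?_ rfl x)
  rintro v - w hvw
  obtain ⟨ν, hν, -⟩ := hD.exists_mate v w hvw
  exact absurd ⟨ν, hν⟩ hno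

theorem IsMate.isStage {D : SimpleGraph V} {M : V → V} (hM : IsMate D Finset.univ M) (x : V) :
    IsStage D (IsStage.addMate ⊥ hM) M {x, M x} := by
  have hadj : ∀ v w, (IsStage.addMate ⊥ hM).Adj v w ↔ w = M v := fun v w => by
    simp [IsStage.addMate, eq_comm]
  have hMi : ∀ v, M (M v) = v := fun v => (hM v (Finset.mem_univ _)).2.2
  have hmate : IsMate (IsStage.addMate ⊥ hM) Finset.univ M := fun v _ =>
    ⟨Finset.mem_univ _, (hadj _ _).2 rfl, hMi v⟩
  have hr : (IsStage.addMate ⊥ hM).Reachable x (M x) := Adj.reachable ((hadj _ _).2 rfl)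
  refine ⟨fun v w hvw => ?_, ⟨x, by simp⟩, hmate, fun v _ w hvw => (hadj _ _).1 hvw, ?_, ?_, ?_, ?_⟩
  · rw [(hadj _ _).1 hvw]
    exact (hM v (Finset.mem_univ _)).2.1
  · intro v hv w hvw
    rw [(hadj _ _).1 hvw]
    simp only [Finset.mem_insert, Finset.mem_singleton] at hv ⊢
    rcases hv with rfl | rfl
    · exact Or.inr rfl
    · exact Or.inl (hMi x)
  · intro v hv w hw
    simp only [Finset.mem_insert, Finset.mem_singleton] at hv hw
    rcases hv with rfl | rfl <;> rcases hw with rfl | rfl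
    · exact Reachable.refl _
    · exact hr
    · exact hr.symm
    · exact Reachable.refl _
  · intro v w hvw
    exact ⟨M, hmate, ((hadj _ _).1 hvw).symm⟩
  · have h1 : (Finset.univ.filter fun v =>
        3 ≤ (Finset.univ.filter ((IsStage.addMate ⊥ hM).Adj v)).card) = ∅ := by
      refine Finset.filter_eq_empty_iff.2 fun v _ => ?_
      have : Finset.univ.filter ((IsStage.addMate ⊥ hM).Adj v) ⊆ {M v} := fun w hw => by
        simpa [hadj] using hw
      have := Finset.card_le_card this
      rw [Finset.card_singleton] at this
      omega
    have h2 : 0 < (Finset.univ.filter fun μ : V → V =>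
        IsMate (IsStage.addMate ⊥ hM) Finset.univ μ).card :=
      Finset.card_pos.2 ⟨M, by simpa using hmate⟩
    rw [h1, Finset.card_empty]
    omega

/-- An extendable graph has many perfect matchings, in terms of the number of vertices of degree at
least three. -/
theorem IsExtendable.card_add_four_le [Nontrivial V] {D : SimpleGraph V} (hD : IsExtendable D) :
    (Finset.univ.filter fun v => 3 ≤ (Finset.univ.filter (D.Adj v)).card).card + 4 ≤
      4 * (Finset.univ.filter fun μ : V → V => IsMate D Finset.univ μ).card := by
  obtain ⟨M, hM⟩ := hD.exists_isMate
  obtain ⟨x⟩ := (inferInstance : Nonempty V)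
  obtain ⟨H, ⟨U, hU⟩, hmax⟩ := (Set.toFinite {H | ∃ U, IsStage D H M U}).exists_maximal
    ⟨_, _, hM.isStage x⟩
  by_cases hne : H = D
  · rw [← hne]
    exact hU.card_le
  · obtain ⟨H', U', hU', hlt⟩ := hU.exists_extension hD hne
    exact absurd (hmax ⟨U', hU'⟩ hlt.le) hlt.not_ge

end Growth

section Count

variable [Fintype V] {G : SimpleGraph V}

theorem CubicGraph.card_le_card_filter_deleteEdges (hG : CubicGraph G) {D : SimpleGraph V}
    {u v a b : V} (hD : D = G.deleteEdges {s(u, v), s(a, b)}) :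
    Fintype.card V ≤
      (Finset.univ.filter fun w => 3 ≤ (Finset.univ.filter (D.Adj w)).card).card + 4 := by
  have hsub : Finset.univ ⊆
      (Finset.univ.filter fun w => 3 ≤ (Finset.univ.filter (D.Adj w)).card) ∪ {u, v, a, b} := by
    intro w _
    rw [Finset.mem_union, Finset.mem_filter]
    by_cases hw : w ∈ ({u, v, a, b} : Finset V)
    · exact Or.inr hw
    · refine Or.inl ⟨Finset.mem_univ _, ?_⟩
      simp only [Finset.mem_insert, Finset.mem_singleton, not_or] at hw
      have : G.neighborSet w = ↑(Finset.univ.filter (D.Adj w)) := by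
        ext x
        simp only [mem_neighborSet, Finset.coe_filter, Finset.mem_univ, true_and, Set.mem_ofPred_eq,
          hD, deleteEdges_adj, Set.mem_insert_iff, Set.mem_singleton_iff, Sym2.eq_iff]
        tauto
      rw [← Set.ncard_coe_finset, ← this, hG w]
  have h1 := (Finset.card_le_card hsub).trans (Finset.card_union_le _ _)
  have h2 : ({u, v, a, b} : Finset V).card ≤ 4 := Finset.card_le_four
  rw [Finset.card_univ] at h1
  omega

theorem card_isMate_le_ncard_isPM {D : SimpleGraph V} (hD : D ≤ G) {e : Sym2 V}
    (he : e ∉ D.edgeSet) : (Finset.univ.filter fun μ : V → V => IsMate D Finset.univ μ).card ≤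
      {M : Set (Sym2 V) | IsPM G M ∧ e ∉ M}.ncard := by
  rw [← Set.ncard_coe_finset]
  refine Set.ncard_le_ncard_of_injOn (fun μ => Set.range fun v => s(v, μ v)) ?_ ?_ (Set.toFinite _)
  · intro μ hμ
    have hμ : IsMate D Finset.univ μ := by simpa using hμ
    refine ⟨⟨?_, fun v => ⟨s(v, μ v), ⟨⟨v, rfl⟩, Sym2.mem_mk_left _ _⟩, ?_⟩⟩, ?_⟩
    · rintro _ ⟨v, rfl⟩
      exact hD (hμ v (Finset.mem_univ _)).2.1
    · rintro _ ⟨⟨w, rfl⟩, hw⟩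
      rcases Sym2.mem_iff.1 hw with rfl | rfl
      · rfl
      · rw [(hμ w (Finset.mem_univ _)).2.2]
        exact Sym2.eq_swap
    · rintro ⟨v, rfl⟩
      exact he (hμ v (Finset.mem_univ _)).2.1
  · intro μ _ μ' hμ' h
    have hμ' : IsMate D Finset.univ μ' := by simpa using hμ'
    ext v
    have hv : s(v, μ v) ∈ Set.range fun v => s(v, μ' v) := by
      beta_reduce at h
      rw [← h]
      exact ⟨v, rfl⟩
    obtain ⟨w, hw⟩ := hv
    rcases Sym2.eq_iff.1 hw with ⟨rfl, h'⟩ | ⟨rfl, h'⟩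
    · exact h'.symm
    · have := (hμ' (μ v) (Finset.mem_univ _)).2.2
      rw [h'] at this
      exact this.symm

end Count

/-- Every 3-edge-connected cubic graph with `n` vertices has at least `n/8` perfect
matchings avoiding any given edge `e` not contained in a cyclic 3-edge-cut. -/
theorem three_edge_connected_avoiding_matchings
    [Fintype V] (G : SimpleGraph V) (hcubic : CubicGraph G)
    (h3ec : EdgeConnectedGe G 3) (e : Sym2 V) (he : e ∈ G.edgeSet)
    (hnc : ∀ A : Set V, CyclicCut G A → (cutEdges G A).ncard = 3 →
      e ∉ cutEdges G A) :
    (Fintype.card V : ℝ) / 8 ≤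
      ({M : Set (Sym2 V) | IsPM G M ∧ e ∉ M}.ncard : ℝ) := by
  induction e with
  | _ u v =>
    have huv : G.Adj u v := he
    have : Nontrivial V := ⟨u, v, huv.ne⟩
    obtain ⟨a, b, hext⟩ := exists_isExtendable hcubic h3ec huv hnc
    have h1 := hext.card_add_four_le
    have h2 := hcubic.card_le_card_filter_deleteEdges (u := u) (v := v) (a := a) (b := b) rfl
    have h3 := card_isMate_le_ncard_isPM (deleteEdges_le _ :
      G.deleteEdges {s(u, v), s(a, b)} ≤ G) (e := s(u, v)) (by
        rw [mem_edgeSet, deleteEdges_adj]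
        simp)
    have h4 : Fintype.card V ≤ 4 * {M : Set (Sym2 V) | IsPM G M ∧ s(u, v) ∉ M}.ncard :=
      (h2.trans h1).trans (Nat.mul_le_mul_left 4 h3)
    have h5 : (Fintype.card V : ℝ) ≤
        4 * ({M : Set (Sym2 V) | IsPM G M ∧ s(u, v) ∉ M}.ncard : ℝ) := by
      exact_mod_cast h4
    have h6 : (0 : ℝ) ≤ (Fintype.card V : ℝ) := Nat.cast_nonneg _
    linarith
end
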